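/- arXiv:1905.03374 — 2 statements merged into one kernel-verified Lean document; each statement's English description precedes it below -/
import Mathlib

section
/- Let g : ℕ₀ → ℝ be a sequence which is both a generalised polynomial and automatic. Then g is ultimately periodic. -/
/-- Generalised polynomial maps `ℝ^d → ℝ`: the smallest family containing coordinate
maps and constants, closed under addition, multiplication and integer part. -/
inductive IsGenPoly {d : ℕ} : ((Fin d → ℝ) → ℝ) → Prop
  | coord (i : Fin d) : IsGenPoly (fun x => x i)
  | const (c : ℝ) : IsGenPoly (fun _ => c)
  | add {f g : (Fin d → ℝ) → ℝ} : IsGenPoly f → IsGenPoly g →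
      IsGenPoly (fun x => f x + g x)
  | mul {f g : (Fin d → ℝ) → ℝ} : IsGenPoly f → IsGenPoly g →
      IsGenPoly (fun x => f x * g x)
  | intPart {f : (Fin d → ℝ) → ℝ} : IsGenPoly f →
      IsGenPoly (fun x => (⌊f x⌋ : ℝ))

/-- A generalised polynomial on `ℕ`: the restriction to `ℕ` of a generalised
polynomial `ℝ → ℝ`. -/
def IsGenPolyNat (g : ℕ → ℝ) : Prop :=
  ∃ f : (Fin 1 → ℝ) → ℝ, IsGenPoly f ∧ ∀ n : ℕ, g n = f (fun _ => (n : ℝ))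

/-- A generalised polynomial subset of `ℕ`: the zero set of a generalised polynomial. -/
def IsGenPolySet (E : Set ℕ) : Prop :=
  ∃ g : ℕ → ℝ, IsGenPolyNat g ∧ E = {n : ℕ | g n = 0}

/-- A sequence is `k`-automatic: there is a finite automaton with states `Q`, initial
state `q0`, transition map `δ : Q × {0,…,k−1} → Q` and output `τ : Q → ℝ` computing
`g n` from the base-`k` digits of `n`, read starting from the least significant digit. -/
def IsKAutomatic (k : ℕ) (g : ℕ → ℝ) : Prop :=
  ∃ (Q : Type) (_ : Fintype Q) (q0 : Q) (δ : Q → Fin k → Q) (τ : Q → ℝ),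
    ∀ n : ℕ, g n = τ ((Nat.digits k n).foldl
      (fun s a => if h : a < k then δ s ⟨a, h⟩ else s) q0)

/-- A sequence is automatic if it is `k`-automatic for some `k ≥ 2`. -/
def IsAutomatic (g : ℕ → ℝ) : Prop :=
  ∃ k : ℕ, 2 ≤ k ∧ IsKAutomatic k g

namespace GenPolyAut
open Filter Topology

/-- Idempotent ultrafilters on `ℕ`, phrased through the quantifier they define. -/
def IsIdem (r : Ultrafilter ℕ) : Prop :=
  ∀ p : ℕ → Prop, (∀ᶠ m in r, p m) ↔ ∀ᶠ m in r, ∀ᶠ n in r, p (m + n)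

theorem IsIdem.tendsto_of_shift {r : Ultrafilter ℕ} (hr : IsIdem r) {T : Type*}
    [TopologicalSpace T] [RegularSpace T] {x y : ℕ → T} {X : T}
    (hx : Tendsto x r (𝓝 X))
    (hy : ∀ᶠ n in r, Tendsto (fun m => x (n + m)) r (𝓝 (y n))) :
    Tendsto y r (𝓝 X) := by
  rw [(closed_nhds_basis X).tendsto_right_iff]
  rintro U ⟨hU, hUc⟩
  have h := (hr (fun m => x m ∈ U)).1 (hx hU)
  filter_upwards [h, hy] with n h1 h2
  exact hUc.mem_of_tendsto h2 h1

theorem exists_tendsto {J : Type*} (r : Ultrafilter J) {T : Type*}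
    [TopologicalSpace T] [CompactSpace T] (x : J → T) :
    ∃ X, Tendsto x r (𝓝 X) := by
  obtain ⟨X, -, hX⟩ := isCompact_univ.ultrafilter_le_nhds (r.map x) (by simp)
  exact ⟨X, hX⟩

section RV

variable {I : Type*} {r : Ultrafilter ℕ} {u : Ultrafilter I}

/-- Sequences of functions which vanish after `d` cocycle differences `c (n + m) - c n - c m`
along `r`. -/
def RV (r : Ultrafilter ℕ) (u : Ultrafilter I) : ℕ → (ℕ → I → ℝ) → Prop
  | 0, c => ∀ᶠ n in r, ∀ᶠ i in u, c n i = 0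
  | d + 1, c => ∀ᶠ n in r, RV r u d (fun m i => c (n + m) i - c n i - c m i)

theorem RV.congr (hr : IsIdem r) {d : ℕ} {c c' : ℕ → I → ℝ} (h : RV r u d c)
    (hc : ∀ᶠ n in r, ∀ᶠ i in u, c n i = c' n i) : RV r u d c' := by
  induction d generalizing c c' with
  | zero =>
    unfold RV at h ⊢
    filter_upwards [h, hc] with n h1 h2
    filter_upwards [h1, h2] with i h1 h2
    rw [← h2, h1]
  | succ d ih =>
    unfold RV at h ⊢
    filter_upwards [h, hc, (hr _).1 hc] with n h1 h2 h3
    refine ih h1 ?_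
    filter_upwards [hc, h3] with m h4 h5
    filter_upwards [h2, h4, h5] with i h2 h4 h5
    rw [h2, h4, h5]

theorem RV.of_eventually_zero (hr : IsIdem r) (d : ℕ) {c : ℕ → I → ℝ}
    (h : ∀ᶠ n in r, ∀ᶠ i in u, c n i = 0) : RV r u d c := by
  induction d generalizing c with
  | zero => exact h
  | succ d ih =>
    unfold RV
    filter_upwards [h, (hr _).1 h] with n h1 h2
    refine ih ?_
    filter_upwards [h, h2] with m h3 h4
    filter_upwards [h1, h3, h4] with i h1 h3 h4
    simp [h1, h3, h4]

theorem RV.succ (hr : IsIdem r) {d : ℕ} {c : ℕ → I → ℝ} (h : RV r u d c) : RV r u (d + 1) c := by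
  induction d generalizing c with
  | zero => exact RV.of_eventually_zero hr 1 h
  | succ d ih =>
    unfold RV at h ⊢
    exact h.mono fun n hn => ih hn

theorem RV.mono (hr : IsIdem r) {d e : ℕ} (hde : d ≤ e) {c : ℕ → I → ℝ} (h : RV r u d c) :
    RV r u e c := by
  induction hde with
  | refl => exact h
  | step _ ih => exact ih.succ hr

theorem RV.add {d : ℕ} {c c' : ℕ → I → ℝ} (h : RV r u d c) (h' : RV r u d c') :
    RV r u d (fun n i => c n i + c' n i) := by
  induction d generalizing c c' with
  | zero =>
    unfold RV at h h' ⊢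
    filter_upwards [h, h'] with n h1 h2
    filter_upwards [h1, h2] with i h1 h2
    rw [h1, h2, add_zero]
  | succ d ih =>
    unfold RV at h h' ⊢
    filter_upwards [h, h'] with n h1 h2
    convert ih h1 h2 using 3
    ring

theorem RV.smul {d : ℕ} {c : ℕ → I → ℝ} (a : I → ℝ) (h : RV r u d c) :
    RV r u d (fun n i => a i * c n i) := by
  induction d generalizing c with
  | zero =>
    unfold RV at h ⊢
    filter_upwards [h] with n h1
    filter_upwards [h1] with i h1
    rw [h1, mul_zero]
  | succ d ih =>
    unfold RV at h ⊢
    filter_upwards [h] with n h1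
    convert ih h1 using 3
    ring

theorem RV.mul (hr : IsIdem r) {a b : ℕ} {v w : ℕ → I → ℝ} (hv : RV r u a v) (hw : RV r u b w) :
    RV r u (a + b) (fun n i => v n i * w n i) := by
  obtain ⟨N, hN⟩ : ∃ N, N = a + b := ⟨_, rfl⟩
  rw [← hN]
  induction N generalizing a b v w with
  | zero =>
    obtain rfl : a = 0 := by omega
    unfold RV at hv ⊢
    filter_upwards [hv] with n h1
    filter_upwards [h1] with i h1
    rw [h1, zero_mul]
  | succ N ih =>
    rcases a with _ | a
    · refine RV.of_eventually_zero hr _ ?_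
      unfold RV at hv
      filter_upwards [hv] with n h1
      filter_upwards [h1] with i h1
      rw [h1, zero_mul]
    rcases b with _ | b
    · refine RV.of_eventually_zero hr _ ?_
      unfold RV at hw
      filter_upwards [hw] with n h1
      filter_upwards [h1] with i h1
      rw [h1, mul_zero]
    have hv' := hv
    have hw' := hw
    unfold RV at hv hw ⊢
    filter_upwards [hv, hw] with n h1 h2
    have e1 : RV r u N (fun m i => v n i * w m i) := (hw'.smul (v n)).mono hr (by omega)
    have e2 : RV r u N (fun m i => w n i * v m i) := (hv'.smul (w n)).mono hr (by omega)
    have e3 := (h2.smul (v n)).mono hr (show b ≤ N by omega)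
    have e4 := (h1.smul (w n)).mono hr (show a ≤ N by omega)
    have e5 := ih hv' h2 (by omega)
    have e6 := ih h1 hw' (by omega)
    have e7 := (ih h1 (h2.succ hr) (by omega))
    have := (((((e1.add e2).add e3).add e4).add e5).add e6).add e7
    convert this using 3
    ring

theorem RV.tendsto_circle (hr : IsIdem r) {d : ℕ} {c : ℕ → I → ℝ} (h : RV r u d c)
    {x : ℕ → UnitAddCircle}
    (hx : ∀ n, Tendsto (fun i => (c n i : UnitAddCircle)) u (𝓝 (x n))) :
    Tendsto x r (𝓝 0) := by
  induction d generalizing c x with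
  | zero =>
    refine tendsto_nhds_of_eventually_eq ?_
    unfold RV at h
    filter_upwards [h] with n hn
    refine tendsto_nhds_unique (hx n) (tendsto_nhds_of_eventually_eq ?_)
    filter_upwards [hn] with i hi
    simp [hi]
  | succ d ih =>
    obtain ⟨X, hX⟩ := exists_tendsto r x
    unfold RV at h
    have key : ∀ᶠ n in r, Tendsto (fun m => x (n + m)) r (𝓝 (x n + X)) := by
      filter_upwards [h] with n hn
      have h1 := ih hn (x := fun m => x (n + m) - x n - x m) (fun m => by
        simpa using ((hx (n + m)).sub (hx n)).sub (hx m))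
      have := (h1.add (tendsto_const_nhds (x := x n))).add hX
      refine this.congr' ?_ |>.trans (by simp [add_comm])
      filter_upwards with m
      abel
    have h2 := hr.tendsto_of_shift hX key
    have h3 := tendsto_nhds_unique h2 (hX.add (tendsto_const_nhds (x := X)))
    have h4 : X = 0 := by simpa using h3
    rwa [h4] at hX

theorem RV.near_int (hr : IsIdem r) {d : ℕ} {c : ℕ → I → ℝ} (h : RV r u d c) {ε : ℝ}
    (hε : 0 < ε) : ∀ᶠ n in r, ∀ᶠ i in u, |c n i - round (c n i)| < ε := by
  choose x hx using fun n => exists_tendsto u (fun i => (c n i : UnitAddCircle))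
  have h1 := h.tendsto_circle hr hx
  have h2 : ∀ᶠ n in r, ‖x n‖ < ε := by
    have := h1.norm
    rw [norm_zero] at this
    exact this.eventually (gt_mem_nhds hε)
  filter_upwards [h2] with n hn
  filter_upwards [(hx n).norm.eventually (gt_mem_nhds hn)] with i hi
  rwa [UnitAddCircle.norm_eq] at hi

theorem RV.round_coe (hr : IsIdem r) {d : ℕ} {c : ℕ → I → ℝ} (h : RV r u d c) :
    RV r u d (fun n i => (round (c n i) : ℝ)) := by
  induction d generalizing c with
  | zero =>
    unfold RV at h ⊢
    filter_upwards [h] with n hn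
    filter_upwards [hn] with i hi
    simp [hi]
  | succ d ih =>
    have hn := h.near_int hr (show (0 : ℝ) < 1 / 10 by norm_num)
    unfold RV at h ⊢
    filter_upwards [h, hn, (hr _).1 hn] with n h1 h2 h3
    refine (ih h1).congr hr ?_
    filter_upwards [hn, h3] with m h4 h5
    filter_upwards [h2, h4, h5] with i h2 h4 h5
    have : round (c (n + m) i - c n i - c m i) = round (c (n + m) i) - round (c n i)
        - round (c m i) := by
      rw [round_eq, Int.floor_eq_iff]
      rw [abs_lt] at h2 h4 h5
      push_cast
      constructor <;> linarith [h2.1, h2.2, h4.1, h4.2, h5.1, h5.2]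
    rw [this]
    push_cast
    rfl

/-- Sequences lying in `RV r u d` for some `d`. -/
def RVe (r : Ultrafilter ℕ) (u : Ultrafilter I) (c : ℕ → I → ℝ) : Prop := ∃ d, RV r u d c

theorem RVe.add (hr : IsIdem r) {c c' : ℕ → I → ℝ} (h : RVe r u c) (h' : RVe r u c') :
    RVe r u (fun n i => c n i + c' n i) := by
  obtain ⟨d, h⟩ := h
  obtain ⟨e, h'⟩ := h'
  exact ⟨max d e, (h.mono hr (le_max_left _ _)).add (h'.mono hr (le_max_right _ _))⟩

theorem RVe.mul (hr : IsIdem r) {c c' : ℕ → I → ℝ} (h : RVe r u c) (h' : RVe r u c') :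
    RVe r u (fun n i => c n i * c' n i) := by
  obtain ⟨d, h⟩ := h
  obtain ⟨e, h'⟩ := h'
  exact ⟨_, h.mul hr h'⟩

theorem RVe.smul {c : ℕ → I → ℝ} (a : I → ℝ) (h : RVe r u c) :
    RVe r u (fun n i => a i * c n i) := by
  obtain ⟨d, h⟩ := h
  exact ⟨d, h.smul a⟩

theorem RVe.zero : RVe r u (fun _ _ => 0) := ⟨0, by simp [RV]⟩

theorem RVe.round_coe (hr : IsIdem r) {c : ℕ → I → ℝ} (h : RVe r u c) :
    RVe r u (fun n i => (round (c n i) : ℝ)) := by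
  obtain ⟨d, h⟩ := h
  exact ⟨d, h.round_coe hr⟩

theorem RVe.near_int (hr : IsIdem r) {c : ℕ → I → ℝ} (h : RVe r u c) {ε : ℝ}
    (hε : 0 < ε) : ∀ᶠ n in r, ∀ᶠ i in u, |c n i - round (c n i)| < ε := by
  obtain ⟨d, h⟩ := h
  exact h.near_int hr hε

theorem RVe.congr (hr : IsIdem r) {c c' : ℕ → I → ℝ} (h : RVe r u c)
    (hc : ∀ᶠ n in r, ∀ᶠ i in u, c n i = c' n i) : RVe r u c' := by
  obtain ⟨d, h⟩ := h
  exact ⟨d, h.congr hr hc⟩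

theorem RVe.natCast : RVe r u (fun n _ => (n : ℝ)) := ⟨1, by simp [RV]⟩

theorem RVe.sum (hr : IsIdem r) {J : Type*} (s : Finset J) {c : J → ℕ → I → ℝ}
    (h : ∀ j ∈ s, RVe r u (c j)) : RVe r u (fun n i => ∑ j ∈ s, c j n i) := by
  classical
  induction s using Finset.induction_on with
  | empty => simpa using RVe.zero
  | insert j s hj ih =>
    simp only [Finset.sum_insert hj]
    exact (h j (by simp)).add hr (ih fun j' hj' => h j' (by simp [hj']))

end RV

section SeqRec

variable {α : Type*}

/-- Sequences defined by course-of-values recursion. -/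
def seqRec (x0 : α) (step : ℕ → (ℕ → α) → α) : ℕ → α
  | 0 => x0
  | i + 1 => step i (fun j => if _h : j ≤ i then seqRec x0 step j else x0)

theorem seqRec_zero (x0 : α) (step : ℕ → (ℕ → α) → α) : seqRec x0 step 0 = x0 := by
  rw [seqRec]

theorem seqRec_succ (x0 : α) (step : ℕ → (ℕ → α) → α) (i : ℕ)
    (hs : ∀ x y : ℕ → α, (∀ j ≤ i, x j = y j) → step i x = step i y) :
    seqRec x0 step (i + 1) = step i (seqRec x0 step) := by
  rw [seqRec]
  exact hs _ _ fun j hj => by simp [hj]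

end SeqRec

open MvPolynomial

/-- A polynomial program: the `i`-th instruction only involves the variables of index `≤ i`. -/
def Prog (f : ℕ → MvPolynomial ℕ ℝ) : Prop := ∀ i, ∀ j ∈ (f i).vars, j ≤ i

theorem aeval_congr_vars {R A : Type*} [CommSemiring R] [CommSemiring A] [Algebra R A]
    {q : MvPolynomial ℕ R} {x y : ℕ → A} (h : ∀ j ∈ q.vars, x j = y j) :
    aeval x q = aeval y q :=
  MvPolynomial.eval₂Hom_congr' rfl (fun j hj _ => h j hj) rfl

theorem eval_congr_vars {q : MvPolynomial ℕ ℝ} {x y : ℕ → ℝ} (h : ∀ j ∈ q.vars, x j = y j) :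
    eval x q = eval y q :=
  MvPolynomial.eval₂Hom_congr' rfl (fun j hj _ => h j hj) rfl

/-- Evaluation of a polynomial at an integer point. -/
noncomputable def ev (x : ℕ → ℤ) (q : MvPolynomial ℕ ℝ) : ℝ := eval (fun j => (x j : ℝ)) q

/-- The register contents computed by a program on a given input. -/
noncomputable def run (f : ℕ → MvPolynomial ℕ ℝ) (x : ℤ) : ℕ → ℤ :=
  seqRec x fun i y => ⌊ev y (f i)⌋

theorem run_zero (f : ℕ → MvPolynomial ℕ ℝ) (x : ℤ) : run f x 0 = x := seqRec_zero _ _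

theorem run_succ {f : ℕ → MvPolynomial ℕ ℝ} (hf : Prog f) (x : ℤ) (i : ℕ) :
    run f x (i + 1) = ⌊ev (run f x) (f i)⌋ := by
  refine seqRec_succ _ _ i fun y z h => ?_
  dsimp only [ev]
  rw [eval_congr_vars fun j hj => ?_]
  rw [h j (hf i j hj)]

/-- Functions of an integer variable computed by a polynomial program. -/
def IsProg (h : ℤ → ℝ) : Prop :=
  ∃ f, Prog f ∧ ∃ q, ∀ x, h x = ev (run f x) q

theorem _root_.IsGenPoly.exists_prog {F : (Fin 1 → ℝ) → ℝ} (hF : IsGenPoly F) (α β : ℝ) :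
    ∀ f, Prog f → ∀ ℓ : ℕ, ∃ f', Prog f' ∧ (∀ i < ℓ, f' i = f i) ∧ ∃ ℓ' ≥ ℓ, ∃ q : MvPolynomial ℕ ℝ,
      (∀ j ∈ q.vars, j ≤ ℓ') ∧ ∀ f'', Prog f'' → (∀ i < ℓ', f'' i = f' i) →
        ∀ x : ℤ, F (fun _ => α * x + β) = ev (run f'' x) q := by
  induction hF with
  | coord i =>
    intro f hf ℓ
    refine ⟨f, hf, fun _ _ => rfl, ℓ, le_rfl, C α * X 0 + C β, ?_, ?_⟩
    · intro j hj
      have := MvPolynomial.vars_add_subset _ _ hj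
      rw [vars_C, Finset.union_empty] at this
      have := MvPolynomial.vars_mul _ _ this
      rw [vars_C, Finset.empty_union, vars_X] at this
      simp at this
      omega
    · intro f'' _ _ x
      simp [ev, run_zero]
  | const c =>
    intro f hf ℓ
    exact ⟨f, hf, fun _ _ => rfl, ℓ, le_rfl, C c, by simp, by simp [ev]⟩
  | add _ _ ih1 ih2 =>
    intro f hf ℓ
    obtain ⟨f1, hf1, e1, ℓ1, hℓ1, q1, hq1, H1⟩ := ih1 f hf ℓ
    obtain ⟨f2, hf2, e2, ℓ2, hℓ2, q2, hq2, H2⟩ := ih2 f1 hf1 ℓ1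
    refine ⟨f2, hf2, fun i hi => ?_, ℓ2, by omega, q1 + q2, fun j hj => ?_, fun f'' hf'' e x => ?_⟩
    · rw [e2 i (by omega), e1 i hi]
    · rcases Finset.mem_union.1 (MvPolynomial.vars_add_subset _ _ hj) with h | h
      · exact (hq1 j h).trans hℓ2
      · exact hq2 j h
    · dsimp only
      rw [H1 f'' hf'' (fun i hi => by rw [e i (by omega), e2 i hi]) x, H2 f'' hf'' e x]
      simp [ev]
  | mul _ _ ih1 ih2 =>
    intro f hf ℓ
    obtain ⟨f1, hf1, e1, ℓ1, hℓ1, q1, hq1, H1⟩ := ih1 f hf ℓ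
    obtain ⟨f2, hf2, e2, ℓ2, hℓ2, q2, hq2, H2⟩ := ih2 f1 hf1 ℓ1
    refine ⟨f2, hf2, fun i hi => ?_, ℓ2, by omega, q1 * q2, fun j hj => ?_, fun f'' hf'' e x => ?_⟩
    · rw [e2 i (by omega), e1 i hi]
    · rcases Finset.mem_union.1 (MvPolynomial.vars_mul _ _ hj) with h | h
      · exact (hq1 j h).trans hℓ2
      · exact hq2 j h
    · dsimp only
      rw [H1 f'' hf'' (fun i hi => by rw [e i (by omega), e2 i hi]) x, H2 f'' hf'' e x]
      simp [ev]
  | intPart _ ih =>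
    intro f hf ℓ
    obtain ⟨f1, hf1, e1, ℓ1, hℓ1, q1, hq1, H1⟩ := ih f hf ℓ
    have hP : Prog (Function.update f1 ℓ1 q1) := by
      intro i j hj
      rcases eq_or_ne i ℓ1 with rfl | hne
      · rw [Function.update_self] at hj
        exact hq1 j hj
      · rw [Function.update_of_ne hne] at hj
        exact hf1 i j hj
    refine ⟨Function.update f1 ℓ1 q1, hP, fun i hi => ?_, ℓ1 + 1, by omega, X (ℓ1 + 1),
      fun j hj => ?_, fun f'' hf'' e x => ?_⟩
    · rw [Function.update_of_ne (by omega), e1 i hi]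
    · rw [vars_X, Finset.mem_singleton] at hj
      omega
    · dsimp only
      rw [H1 f'' hf'' (fun i hi => by
        rw [e i (by omega), Function.update_of_ne (by omega)]) x]
      simp only [ev, eval_X, run_succ hf'']
      rw [e ℓ1 (by omega), Function.update_self]

theorem _root_.IsGenPoly.isProg {F : (Fin 1 → ℝ) → ℝ} (hF : IsGenPoly F) (α β : ℝ) :
    IsProg fun x => F (fun _ => α * x + β) := by
  obtain ⟨f, hf, -, ℓ, -, q, -, H⟩ := hF.exists_prog α β (fun _ => 0)
    (fun i j hj => by simp at hj) 0
  exact ⟨f, hf, q, H f hf fun _ _ => rfl⟩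

section Fibre

variable {I : Type*} {r : Ultrafilter ℕ} {u : Ultrafilter I}

theorem eventually₂_not {p : ℕ → I → Prop} (h : ¬ ∀ᶠ n : ℕ in r, ∀ᶠ i in u, p n i) :
    ∀ᶠ n : ℕ in r, ∀ᶠ i in u, ¬ p n i := by
  rw [← Ultrafilter.eventually_not] at h
  simpa only [Ultrafilter.eventually_not] using h

theorem eventually₂_and {p q : ℕ → I → Prop} (hp : ∀ᶠ n : ℕ in r, ∀ᶠ i in u, p n i)
    (hq : ∀ᶠ n : ℕ in r, ∀ᶠ i in u, q n i) : ∀ᶠ n : ℕ in r, ∀ᶠ i in u, p n i ∧ q n i := by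
  filter_upwards [hp, hq] with n h1 h2 using h1.and h2

theorem eventually₂_mono {p q : ℕ → I → Prop} (hp : ∀ᶠ n : ℕ in r, ∀ᶠ i in u, p n i)
    (hpq : ∀ n i, p n i → q n i) : ∀ᶠ n : ℕ in r, ∀ᶠ i in u, q n i :=
  hp.mono fun n h => h.mono fun i => hpq n i

theorem eventually₂_const {p : Prop} (h : ∀ᶠ _n : ℕ in r, ∀ᶠ _i : I in u, p) : p := by
  obtain ⟨n, hn⟩ := h.exists
  exact hn.exists.choose_spec

theorem natDegree_taylor_sub_le {e : Polynomial ℝ} {D : ℕ} (he : e.natDegree ≤ D + 1) :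
    (Polynomial.taylor 1 e - e).natDegree ≤ D := by
  rw [Polynomial.natDegree_le_iff_coeff_eq_zero]
  intro N hN
  rw [Polynomial.coeff_sub, sub_eq_zero]
  rcases lt_or_ge e.natDegree N with h | h
  · rw [Polynomial.coeff_eq_zero_of_natDegree_lt h, Polynomial.coeff_eq_zero_of_natDegree_lt]
    rwa [Polynomial.natDegree_taylor]
  · obtain rfl : N = e.natDegree := by omega
    rw [Polynomial.coeff_taylor_natDegree, Polynomial.leadingCoeff]

theorem exists_eventually_sign (D : ℕ) (e : ℕ → I → Polynomial ℝ)
    (he : ∀ n i, (e n i).natDegree ≤ D) :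
    ∃ (σ : Prop) (C0 : ℕ), ∀ C ≥ C0, ∀ᶠ n : ℕ in r, ∀ᶠ i in u, (e n i).eval (C : ℝ) < 0 ↔ σ := by
  induction D generalizing e with
  | zero =>
    by_cases h : ∀ᶠ n : ℕ in r, ∀ᶠ i in u, (e n i).coeff 0 < 0
    · refine ⟨True, 0, fun C _ => eventually₂_mono h fun n i h => ?_⟩
      rw [Polynomial.eq_C_of_natDegree_le_zero (he n i)]
      simpa using h
    · refine ⟨False, 0, fun C _ => eventually₂_mono (eventually₂_not h) fun n i h => ?_⟩
      rw [Polynomial.eq_C_of_natDegree_le_zero (he n i)]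
      simpa using h
  | succ D ih =>
    obtain ⟨σ, C0, h⟩ := ih (fun n i => Polynomial.taylor 1 (e n i) - e n i)
      fun n i => natDegree_taylor_sub_le (he n i)
    have hev : ∀ n i (C : ℕ), (Polynomial.taylor 1 (e n i) - e n i).eval (C : ℝ) =
        (e n i).eval ((C + 1 : ℕ) : ℝ) - (e n i).eval (C : ℝ) := by
      intro n i C
      simp [Polynomial.taylor_eval]
    simp only [hev] at h
    by_cases hσ : σ
    · by_cases hA : ∃ C1 ≥ C0, ∀ᶠ n : ℕ in r, ∀ᶠ i in u, (e n i).eval (C1 : ℝ) < 0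
      · obtain ⟨C1, hC1, hA⟩ := hA
        refine ⟨True, C1, fun C hC => ?_⟩
        simp only [iff_true]
        induction hC with
        | refl => exact hA
        | @step C hC ih' =>
          refine eventually₂_mono (eventually₂_and ih' (h C (by simp at hC; omega)))
              fun n i hh => ?_
          have := hh.2.2 hσ
          have := hh.1
          simp only [Nat.succ_eq_add_one] at *
          linarith
      · refine ⟨False, C0, fun C hC => ?_⟩
        have : ¬ ∀ᶠ n : ℕ in r, ∀ᶠ i in u, (e n i).eval (C : ℝ) < 0 := fun h => hA ⟨C, hC, h⟩
        exact eventually₂_mono (eventually₂_not this) fun n i h => by simpa using h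
    · by_cases hA : ∃ C1 ≥ C0, ∀ᶠ n : ℕ in r, ∀ᶠ i in u, ¬ (e n i).eval (C1 : ℝ) < 0
      · obtain ⟨C1, hC1, hA⟩ := hA
        refine ⟨False, C1, fun C hC => ?_⟩
        simp only [iff_false]
        induction hC with
        | refl => exact hA
        | @step C hC ih' =>
          refine eventually₂_mono (eventually₂_and ih' (h C (by simp at hC; omega)))
              fun n i hh => ?_
          have h5 : ¬ _ := fun h => hσ (hh.2.1 h)
          have := hh.1
          simp only [Nat.succ_eq_add_one, not_lt] at *
          linarith
      · refine ⟨True, C0, fun C hC => ?_⟩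
        have : ¬ ∀ᶠ n : ℕ in r, ∀ᶠ i in u, ¬ (e n i).eval (C : ℝ) < 0 := fun h => hA ⟨C, hC, h⟩
        exact eventually₂_mono (eventually₂_not this) fun n i h => by simpa using h

/-- Polynomial families of bounded degree whose constant coefficient does not depend on `n` and
whose other coefficients lie in `RVe`. -/
def PolyRV (r : Ultrafilter ℕ) (u : Ultrafilter I) (P : ℕ → I → Polynomial ℝ) : Prop :=
  (∃ D, ∀ n i, (P n i).natDegree ≤ D) ∧ (∃ s : I → ℝ, ∀ n i, (P n i).coeff 0 = s i) ∧
    ∀ j ≥ 1, RVe r u fun n i => (P n i).coeff j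

theorem PolyRV.const (s : I → ℝ) : PolyRV r u fun _ i => Polynomial.C (s i) :=
  ⟨⟨0, by simp⟩, ⟨s, by simp⟩, fun j hj => by
    simpa [Polynomial.coeff_C, show j ≠ 0 by omega] using RVe.zero⟩

theorem PolyRV.add (hr : IsIdem r) {P Q : ℕ → I → Polynomial ℝ} (hP : PolyRV r u P)
    (hQ : PolyRV r u Q) : PolyRV r u fun n i => P n i + Q n i := by
  obtain ⟨⟨D, hD⟩, ⟨s, hs⟩, h⟩ := hP
  obtain ⟨⟨D', hD'⟩, ⟨s', hs'⟩, h'⟩ := hQ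
  refine ⟨⟨max D D', fun n i => Polynomial.natDegree_add_le_of_le (hD n i) (hD' n i)⟩,
    ⟨fun i => s i + s' i, fun n i => by simp [hs, hs']⟩, fun j hj => ?_⟩
  simp only [Polynomial.coeff_add]
  exact (h j hj).add hr (h' j hj)

theorem PolyRV.mul (hr : IsIdem r) {P Q : ℕ → I → Polynomial ℝ} (hP : PolyRV r u P)
    (hQ : PolyRV r u Q) : PolyRV r u fun n i => P n i * Q n i := by
  obtain ⟨⟨D, hD⟩, ⟨s, hs⟩, h⟩ := hP
  obtain ⟨⟨D', hD'⟩, ⟨s', hs'⟩, h'⟩ := hQ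
  refine ⟨⟨D + D', fun n i => Polynomial.natDegree_mul_le_of_le (hD n i) (hD' n i)⟩,
    ⟨fun i => s i * s' i, fun n i => by simp [Polynomial.mul_coeff_zero, hs, hs']⟩, fun j hj => ?_⟩
  simp only [Polynomial.coeff_mul]
  refine RVe.sum hr _ fun x hx => ?_
  rw [Finset.HasAntidiagonal.mem_antidiagonal] at hx
  rcases x with ⟨a, b⟩
  dsimp only at hx ⊢
  rcases Nat.eq_zero_or_pos a with rfl | ha
  · simp only [hs]
    exact (h' b (by omega)).smul s
  · rcases Nat.eq_zero_or_pos b with rfl | hb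
    · simp only [hs']
      simpa only [mul_comm] using (h a ha).smul s'
    · exact (h a ha).mul hr (h' b hb)

theorem PolyRV.aeval (hr : IsIdem r) {P : ℕ → ℕ → I → Polynomial ℝ} (hP : ∀ j, PolyRV r u (P j))
    (q : MvPolynomial ℕ ℝ) :
    PolyRV r u fun n i => MvPolynomial.aeval (fun j => P j n i) q := by
  induction q using MvPolynomial.induction_on with
  | C a => simpa using PolyRV.const fun _ => a
  | add p q hp hq => simpa using hp.add hr hq
  | mul_X p j hp => simpa using hp.mul hr (hP j)

/-- Coefficientwise rounding. -/
noncomputable def roundPoly (e : Polynomial ℝ) : Polynomial ℤ :=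
  ∑ j ∈ Finset.range (e.natDegree + 1), Polynomial.monomial j (round (e.coeff j))

theorem coeff_roundPoly (e : Polynomial ℝ) (j : ℕ) : (roundPoly e).coeff j = round (e.coeff j) := by
  unfold roundPoly
  rw [Polynomial.finsetSum_coeff]
  simp only [Polynomial.coeff_monomial]
  by_cases h : j ∈ Finset.range (e.natDegree + 1)
  · rw [Finset.sum_eq_single_of_mem j h] <;> simp +contextual
  · rw [Finset.sum_eq_zero]
    · rw [Polynomial.coeff_eq_zero_of_natDegree_lt (by simpa using h)]
      simp
    · intro b hb
      rw [if_neg]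
      rintro rfl
      exact h hb

theorem PolyRV.floor (hr : IsIdem r) {P : ℕ → I → Polynomial ℝ} (hP : PolyRV r u P) :
    ∃ Q, PolyRV r u Q ∧ ∃ C0 : ℕ, ∀ C ≥ C0, ∀ᶠ n : ℕ in r, ∀ᶠ i in u,
      (⌊(P n i).eval (C : ℝ)⌋ : ℝ) = (Q n i).eval (C : ℝ) := by
  have hP' := hP
  obtain ⟨⟨D, hD⟩, ⟨s, hs⟩, h⟩ := hP
  set Z : ℕ → I → Polynomial ℝ := fun n i => (roundPoly (P n i)).map (Int.castRingHom ℝ) with hZ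
  have cZ : ∀ n i j, (Z n i).coeff j = round ((P n i).coeff j) := fun n i j => by
    simp [hZ, coeff_roundPoly]
  have dZ : ∀ n i, (Z n i).natDegree ≤ D := fun n i => by
    rw [Polynomial.natDegree_le_iff_coeff_eq_zero]
    intro N hN
    rw [cZ, Polynomial.coeff_eq_zero_of_natDegree_lt ((hD n i).trans_lt hN)]
    simp
  have hZP : PolyRV r u Z := by
    refine ⟨⟨D, dZ⟩, ⟨fun i => round (s i), fun n i => by rw [cZ, hs]⟩, fun j hj => ?_⟩
    simp only [cZ]
    exact (h j hj).round_coe hr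
  obtain ⟨σ, C0, hσ⟩ := exists_eventually_sign (r := r) (u := u) D (fun n i => P n i - Z n i)
    fun n i => (Polynomial.natDegree_sub_le_of_le (hD n i) (dZ n i)).trans (by simp)
  classical
  refine ⟨fun n i => Z n i + Polynomial.C (if σ then -1 else 0), hZP.add hr (PolyRV.const _), C0,
    fun C hC => ?_⟩
  have hsmall : ∀ᶠ n : ℕ in r, ∀ᶠ i in u, |(P n i - Z n i).eval (C : ℝ)| < 1 := by
    have hε : (0 : ℝ) < 1 / (3 * (∑ j ∈ Finset.range D, (C : ℝ) ^ (j + 1) + 1)) := by positivity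
    have h1 : ∀ᶠ n : ℕ in r, ∀ᶠ i in u, ∀ j ∈ Finset.range D,
        |(P n i).coeff (j + 1) - round ((P n i).coeff (j + 1))| <
          1 / (3 * (∑ j ∈ Finset.range D, (C : ℝ) ^ (j + 1) + 1)) := by
      simp only [Filter.eventually_all_finset]
      exact fun j _ => (h (j + 1) (by omega)).near_int hr hε
    refine eventually₂_mono h1 fun n i h1 => ?_
    have hd : (P n i - Z n i).natDegree < D + 1 := by
      have := (Polynomial.natDegree_sub_le_of_le (hD n i) (dZ n i))
      simp at this
      omega
    rw [Polynomial.eval_eq_sum_range' hd, Finset.sum_range_succ']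
    have h2 : |∑ j ∈ Finset.range D, (P n i - Z n i).coeff (j + 1) *
        (C : ℝ) ^ (j + 1)| ≤ 1 / 3 := by
      refine (Finset.abs_sum_le_sum_abs _ _).trans ?_
      calc _ ≤ ∑ j ∈ Finset.range D, 1 / (3 * (∑ j ∈ Finset.range D, (C : ℝ) ^ (j + 1) + 1)) *
            (C : ℝ) ^ (j + 1) := by
            refine Finset.sum_le_sum fun j hj => ?_
            rw [abs_mul, abs_of_nonneg (show (0 : ℝ) ≤ (C : ℝ) ^ (j + 1) by positivity),
              Polynomial.coeff_sub, cZ]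
            gcongr
            exact (h1 j hj).le
        _ ≤ 1 / 3 := by
            rw [← Finset.mul_sum]
            have : (0 : ℝ) ≤ ∑ j ∈ Finset.range D, (C : ℝ) ^ (j + 1) := by positivity
            rw [div_mul_eq_mul_div, div_le_div_iff₀ (by positivity) (by norm_num)]
            linarith
    have h3 : |(P n i - Z n i).coeff 0 * (C : ℝ) ^ 0| ≤ 1 / 2 := by
      rw [pow_zero, mul_one, Polynomial.coeff_sub, cZ]
      exact abs_sub_round _
    refine (abs_add_le _ _).trans_lt ?_
    linarith
  refine eventually₂_mono (eventually₂_and hsmall (hσ C hC)) fun n i ⟨h1, h2⟩ => ?_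
  have h3 : (Z n i).eval (C : ℝ) = (((roundPoly (P n i)).eval (C : ℤ) : ℤ) : ℝ) := by
    simp [hZ, Polynomial.eval_map, Polynomial.eval₂_at_natCast]
  rw [abs_lt, Polynomial.eval_sub, h3] at h1
  rw [Polynomial.eval_sub, h3] at h2
  by_cases hh : σ
  · have h4 := h2.2 hh
    have : ⌊(P n i).eval (C : ℝ)⌋ = (roundPoly (P n i)).eval (C : ℤ) - 1 := by
      rw [Int.floor_eq_iff]
      push_cast
      constructor <;> linarith
    rw [this, Polynomial.eval_add, h3]
    simp [hh]
    ring
  · have h4 : ¬ _ := fun h => hh (h2.1 h)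
    rw [not_lt] at h4
    have : ⌊(P n i).eval (C : ℝ)⌋ = (roundPoly (P n i)).eval (C : ℤ) := by
      rw [Int.floor_eq_iff]
      constructor <;> linarith
    rw [this, Polynomial.eval_add, h3]
    simp [hh]

theorem exists_polyRV_run (hr : IsIdem r) {f : ℕ → MvPolynomial ℕ ℝ} (hf : Prog f)
    (base : I → ℤ) (l : ℕ) :
    ∃ P, PolyRV r u P ∧ ∃ C0 : ℕ, ∀ C : ℕ, C ≥ C0 → ∀ᶠ n : ℕ in r, ∀ᶠ i in u,
      (run f (base i + C * n) l : ℝ) = (P n i).eval (C : ℝ) := by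
  induction l using Nat.strong_induction_on with
  | _ l ih =>
    rcases l with _ | l
    · refine ⟨fun n i => Polynomial.C (base i : ℝ) + Polynomial.C (n : ℝ) * Polynomial.X,
        ⟨⟨1, fun n i => by
          dsimp only
          rw [add_comm]
          exact Polynomial.natDegree_linear_le⟩, ⟨fun i => base i, by simp⟩, fun j hj => ?_⟩, 0,
        fun C _ => ?_⟩
      · simp only [Polynomial.coeff_add, Polynomial.coeff_C_mul, Polynomial.coeff_X,
          Polynomial.coeff_C, show j ≠ 0 by omega, if_false, zero_add]
        by_cases h1 : 1 = j
        · simpa [h1] using RVe.natCast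
        · simpa [h1] using RVe.zero
      · refine Eventually.of_forall fun n => Eventually.of_forall fun i => ?_
        simp [run_zero, mul_comm]
    · have ih' : ∀ j : ℕ, ∃ P, PolyRV r u P ∧ ∃ C0 : ℕ, j ≤ l → ∀ C : ℕ, C ≥ C0 →
          ∀ᶠ n : ℕ in r, ∀ᶠ i in u, (run f (base i + C * n) j : ℝ) = (P n i).eval (C : ℝ) := by
        intro j
        by_cases hj : j ≤ l
        · obtain ⟨P, hP, C0, h⟩ := ih j (by omega)
          exact ⟨P, hP, C0, fun _ => h⟩
        · exact ⟨_, PolyRV.const fun _ => 0, 0, fun h => absurd h hj⟩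
      choose P hP C0 hC using ih'
      obtain ⟨Q, hQ, C1, h1⟩ := (PolyRV.aeval hr hP (f l)).floor hr
      refine ⟨Q, hQ, max C1 (∑ j ∈ Finset.range (l + 1), C0 j), fun C hC' => ?_⟩
      have h2 : ∀ᶠ n : ℕ in r, ∀ᶠ i in u, ∀ j ∈ Finset.range (l + 1),
          (run f (base i + C * n) j : ℝ) = (P j n i).eval (C : ℝ) := by
        simp only [Filter.eventually_all_finset]
        intro j hj
        refine hC j (by simp at hj; omega) C ?_
        exact (Finset.single_le_sum (fun _ _ => Nat.zero_le _) hj).trans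
          ((le_max_right _ _).trans hC')
      refine eventually₂_mono (eventually₂_and h2 (h1 C ((le_max_left _ _).trans hC')))
        fun n i ⟨h2, h1⟩ => ?_
      rw [run_succ hf, ← h1]
      congr 2
      have : (MvPolynomial.aeval (fun j => P j n i) (f l)).eval (C : ℝ) =
          MvPolynomial.eval (fun j => (P j n i).eval (C : ℝ)) (f l) := by
        rw [MvPolynomial.aeval_def, ← Polynomial.coe_evalRingHom, MvPolynomial.hom_eval₂,
          ← MvPolynomial.eval₂_id]
        congr 1
        ext x
        simp
      rw [this]
      exact eval_congr_vars fun j hj => h2 j (by have := hf l j hj; simp; omega)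

theorem exists_eventually_const_of_finite (hr : IsIdem r) {h : ℤ → ℝ} (hh : IsProg h)
    (base : I → ℤ) {V : Set ℝ} (hV : V.Finite)
    (hyp : ∀ C : ℕ, 1 ≤ C → ∀ᶠ n : ℕ in r, ∀ᶠ i in u, h (base i + C * n) ∈ V) :
    ∃ (w : ℝ) (C0 : ℕ), ∀ C : ℕ, C ≥ C0 → ∀ᶠ n : ℕ in r, ∀ᶠ i in u, h (base i + C * n) = w := by
  obtain ⟨f, hf, q, hq⟩ := hh
  choose P hP C0 hC using fun l => exists_polyRV_run (u := u) hr hf base l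
  have hE := PolyRV.aeval hr hP q
  set E := fun n i => MvPolynomial.aeval (fun j => P j n i) q with hEdef
  obtain ⟨⟨D, hD⟩, -, -⟩ := hE
  have hval : ∃ C1, ∀ C : ℕ, C ≥ C1 → ∀ᶠ n : ℕ in r, ∀ᶠ i in u,
      h (base i + C * n) = (E n i).eval (C : ℝ) := by
    refine ⟨∑ j ∈ q.vars, C0 j, fun C hC' => ?_⟩
    have h2 : ∀ᶠ n : ℕ in r, ∀ᶠ i in u, ∀ j ∈ q.vars,
        (run f (base i + C * n) j : ℝ) = (P j n i).eval (C : ℝ) := by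
      simp only [Filter.eventually_all_finset]
      exact fun j hj => hC j C ((Finset.single_le_sum (fun _ _ => Nat.zero_le _) hj).trans hC')
    refine eventually₂_mono h2 fun n i h2 => ?_
    have : (MvPolynomial.aeval (fun j => P j n i) q).eval (C : ℝ) =
        MvPolynomial.eval (fun j => (P j n i).eval (C : ℝ)) q := by
      rw [MvPolynomial.aeval_def, ← Polynomial.coe_evalRingHom, MvPolynomial.hom_eval₂,
        ← MvPolynomial.eval₂_id]
      congr 1
      ext x
      simp
    rw [hq, hEdef, this]
    exact eval_congr_vars h2
  obtain ⟨C1, hC1⟩ := hval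
  choose σ K hK using fun w : ℝ => exists_eventually_sign (r := r) (u := u) D
    (fun n i => E n i - Polynomial.C w) fun n i => by
      refine (Polynomial.natDegree_sub_le_of_le (hD n i) (Polynomial.natDegree_C w).le).trans ?_
      simp
  choose σ' K' hK' using fun w : ℝ => exists_eventually_sign (r := r) (u := u) D
    (fun n i => Polynomial.C w - E n i) fun n i => by
      refine (Polynomial.natDegree_sub_le_of_le (Polynomial.natDegree_C w).le (hD n i)).trans ?_
      simp
  set C2 := C1 + 1 + ∑ w ∈ hV.toFinset, (K w + K' w) with hC2
  have hstar : ∀ C ≥ C2, ∃ w ∈ V, ∀ᶠ n : ℕ in r, ∀ᶠ i in u, h (base i + C * n) = w := by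
    intro C hC
    by_contra hcon
    push Not at hcon
    have h1 : ∀ᶠ n : ℕ in r, ∀ᶠ i in u, ∀ w ∈ hV.toFinset, h (base i + C * n) ≠ w := by
      simp only [Filter.eventually_all_finset]
      exact fun w hw => hcon w (by simpa using hw)
    refine eventually₂_const (eventually₂_mono (eventually₂_and h1 (hyp C (by omega)))
      fun n i ⟨h1, h2⟩ => h1 _ (by simpa using h2) rfl)
  obtain ⟨w, hw, hw2⟩ := hstar C2 le_rfl
  have hKw : K w + K' w ≤ ∑ w ∈ hV.toFinset, (K w + K' w) :=
    Finset.single_le_sum (f := fun w => K w + K' w) (fun _ _ => Nat.zero_le _) (by simpa using hw)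
  have hσ : ¬ σ w ∧ ¬ σ' w := by
    refine eventually₂_const (eventually₂_mono (eventually₂_and hw2 (eventually₂_and
      (hC1 C2 (by omega)) (eventually₂_and (hK w C2 (by omega)) (hK' w C2 (by omega)))))
      fun n i ⟨h1, h2, h3, h4⟩ => ?_)
    rw [← h3, ← h4]
    simp only [Polynomial.eval_sub, Polynomial.eval_C]
    constructor <;> linarith
  refine ⟨w, C2, fun C hC => eventually₂_mono (eventually₂_and
      (hC1 C (by omega)) (eventually₂_and (hK w C (by omega)) (hK' w C (by omega))))
      fun n i ⟨h2, h3, h4⟩ => ?_⟩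
  have h5 : ¬ _ := fun h => hσ.1 (h3.1 h)
  have h6 : ¬ _ := fun h => hσ.2 (h4.1 h)
  simp only [Polynomial.eval_sub, Polynomial.eval_C, not_lt] at h5 h6
  linarith

end Fibre

theorem induction_of_vars_le {R : Type*} [CommSemiring R] {P : MvPolynomial ℕ R → Prop} {i : ℕ}
    {q : MvPolynomial ℕ R} (hq : ∀ j ∈ q.vars, j ≤ i) (hX : ∀ j ≤ i, P (X j)) (hC : ∀ a, P (C a))
    (hadd : ∀ p q, P p → P q → P (p + q)) (hmul : ∀ p q, P p → P q → P (p * q)) : P q := by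
  have hq' : q ∈ Algebra.adjoin R (X '' {j : ℕ | j ≤ i} : Set (MvPolynomial ℕ R)) :=
    mem_supported.2 hq
  induction hq' using Algebra.adjoin_induction with
  | mem x hx =>
    obtain ⟨j, hj, rfl⟩ := hx
    exact hX j hj
  | algebraMap a => exact hC a
  | add x y hx hy h1 h2 =>
    exact hadd _ _ (h1 (mem_supported.1 hx)) (h2 (mem_supported.1 hy))
  | mul x y hx hy h1 h2 =>
    exact hmul _ _ (h1 (mem_supported.1 hx)) (h2 (mem_supported.1 hy))

section Filtration

/-- The polynomials whose monomials have weight at most `j`. -/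
def Filt (w : ℕ → ℕ) (j : ℕ) (q : MvPolynomial ℕ ℝ) : Prop :=
  ∀ m ∈ q.support, Finsupp.weight w m ≤ j

variable {w : ℕ → ℕ}

theorem Filt.mono {j j' : ℕ} (h : j ≤ j') {q : MvPolynomial ℕ ℝ} (hq : Filt w j q) :
    Filt w j' q := fun m hm => (hq m hm).trans h

theorem Filt.zero (j : ℕ) : Filt w j 0 := fun m hm => by simp at hm

theorem Filt.add {j : ℕ} {p q : MvPolynomial ℕ ℝ} (hp : Filt w j p) (hq : Filt w j q) :
    Filt w j (p + q) := by
  classical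
  intro m hm
  rcases Finset.mem_union.1 (MvPolynomial.support_add hm) with h | h
  exacts [hp m h, hq m h]

theorem Filt.sum {J : Type*} (s : Finset J) {j : ℕ} {q : J → MvPolynomial ℕ ℝ}
    (hq : ∀ a ∈ s, Filt w j (q a)) : Filt w j (∑ a ∈ s, q a) := by
  classical
  induction s using Finset.induction_on with
  | empty => simpa using Filt.zero j
  | insert a s ha ih =>
    rw [Finset.sum_insert ha]
    exact (hq a (by simp)).add (ih fun b hb => hq b (by simp [hb]))

theorem Filt.mul {a b : ℕ} {p q : MvPolynomial ℕ ℝ} (hp : Filt w a p) (hq : Filt w b q) :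
    Filt w (a + b) (p * q) := by
  classical
  intro m hm
  obtain ⟨x, hx, y, hy, rfl⟩ := Finset.mem_add.1 (MvPolynomial.support_mul _ _ hm)
  rw [map_add]
  exact Nat.add_le_add (hp x hx) (hq y hy)

theorem Filt.monomial (m : ℕ →₀ ℕ) (c : ℝ) : Filt w (Finsupp.weight w m) (monomial m c) := by
  intro m' hm'
  have := MvPolynomial.support_monomial_subset hm'
  rw [Finset.mem_singleton] at this
  rw [this]

theorem exists_filt (w : ℕ → ℕ) (q : MvPolynomial ℕ ℝ) : ∃ j, Filt w j q :=
  ⟨q.support.sup fun m => Finsupp.weight w m,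
    fun _ hm => Finset.le_sup (f := fun m => Finsupp.weight w m) hm⟩

end Filtration

/-- Weights adapted to a program. -/
noncomputable def wt (F : ℕ → MvPolynomial ℕ ℝ) : ℕ → ℕ :=
  seqRec 1 fun i w => 1 + (F i).support.sup fun m => Finsupp.weight w m

/-- The values on variables of the derivation attached to a program. -/
noncomputable def dvar (F : ℕ → MvPolynomial ℕ ℝ) : ℕ → MvPolynomial ℕ ℝ :=
  seqRec 1 fun i d => mkDerivation ℝ d (F i)

/-- The derivation with `X 0 ↦ 1` and `X (i + 1) ↦ der (F i)`. -/
noncomputable def der (F : ℕ → MvPolynomial ℕ ℝ) :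
    Derivation ℝ (MvPolynomial ℕ ℝ) (MvPolynomial ℕ ℝ) := mkDerivation ℝ (dvar F)

variable {F : ℕ → MvPolynomial ℕ ℝ}

theorem weight_congr {w w' : ℕ → ℕ} {m : ℕ →₀ ℕ} (h : ∀ j ∈ m.support, w j = w' j) :
    Finsupp.weight w m = Finsupp.weight w' m := by
  rw [Finsupp.weight_apply, Finsupp.weight_apply]
  exact Finset.sum_congr rfl fun j hj => by dsimp only; rw [h j hj]

theorem wt_succ (hF : Prog F) (i : ℕ) :
    wt F (i + 1) = 1 + (F i).support.sup fun m => Finsupp.weight (wt F) m := by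
  refine seqRec_succ _ _ i fun w w' h => ?_
  congr 1
  refine Finset.sup_congr rfl fun m hm => weight_congr fun j hj => h j (hF i j ?_)
  exact (mem_vars_iff_mem_support _).2 ⟨m, hm, hj⟩

theorem one_le_wt (hF : Prog F) (i : ℕ) : 1 ≤ wt F i := by
  rcases i with _ | i
  · rw [wt, seqRec_zero]
  · rw [wt_succ hF]
    omega

theorem filt_wt (hF : Prog F) (i : ℕ) : Filt (wt F) (wt F (i + 1)) (F i) := by
  intro m hm
  rw [wt_succ hF]
  have := Finset.le_sup (f := fun m => Finsupp.weight (wt F) m) hm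
  omega

theorem der_X_zero : der F (X 0) = 1 := by
  rw [der, mkDerivation_X, dvar, seqRec_zero]

theorem der_X_succ (hF : Prog F) (i : ℕ) : der F (X (i + 1)) = der F (F i) := by
  rw [der, mkDerivation_X, dvar, seqRec_succ]
  intro d d' h
  refine derivation_eq_of_forall_mem_vars fun j hj => ?_
  rw [mkDerivation_X, mkDerivation_X, h j (hF i j hj)]

theorem der_eq_sum (q : MvPolynomial ℕ ℝ) : der F q = ∑ m ∈ q.support,
    q.coeff m • ∑ j ∈ m.support, monomial (m - Finsupp.single j 1) (m j : ℝ) * dvar F j := by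
  conv_lhs => rw [q.as_sum, map_sum]
  refine Finset.sum_congr rfl fun m _ => ?_
  rw [der, mkDerivation_monomial]
  rfl

theorem filt_der_of (hF : Prog F) {k i : ℕ} {q : MvPolynomial ℕ ℝ} (hq : Filt (wt F) k q)
    (hi : ∀ j ∈ q.vars, j ≤ i) (h : ∀ j ≤ i, Filt (wt F) (wt F j - 1) (dvar F j)) :
    Filt (wt F) (k - 1) (der F q) := by
  rw [der_eq_sum]
  refine Filt.sum _ fun m hm => ?_
  rw [MvPolynomial.smul_eq_C_mul]
  have hC : Filt (wt F) 0 (C (q.coeff m)) := by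
    have := Filt.monomial (w := wt F) 0 (q.coeff m)
    simpa using this
  have := hC.mul (Filt.sum (w := wt F) (j := k - 1) m.support
    (q := fun j => monomial (m - Finsupp.single j 1) (m j : ℝ) * dvar F j) fun j hj => ?_)
  · simpa using this
  have hj' : j ≤ i := hi j ((mem_vars_iff_mem_support _).2 ⟨m, hm, hj⟩)
  refine ((Filt.monomial _ _).mul (h j hj')).mono ?_
  have h1 : Finsupp.weight (wt F) (m - Finsupp.single j 1) + wt F j = Finsupp.weight (wt F) m := by
    have h2 : m - Finsupp.single j 1 + Finsupp.single j 1 = m := by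
      ext a
      have : m j ≠ 0 := Finsupp.mem_support_iff.1 hj
      rcases eq_or_ne a j with rfl | hne
      · simp; omega
      · simp [Finsupp.single_eq_of_ne hne]
    conv_rhs => rw [← h2, map_add, Finsupp.weight_single]
    simp
  have h3 := hq m hm
  have h4 := one_le_wt hF j
  omega

theorem filt_dvar (hF : Prog F) (i : ℕ) : Filt (wt F) (wt F i - 1) (dvar F i) := by
  induction i using Nat.strong_induction_on with
  | _ i ih =>
    rcases i with _ | i
    · rw [dvar, seqRec_zero]
      have := Filt.monomial (w := wt F) 0 1
      exact Filt.mono (Nat.zero_le _) (by simpa using this)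
    · have := filt_der_of hF (filt_wt hF i) (hF i) fun j hj => ih j (by omega)
      rw [← der_X_succ hF, der, mkDerivation_X] at this
      exact this

theorem filt_der (hF : Prog F) {k : ℕ} {q : MvPolynomial ℕ ℝ} (hq : Filt (wt F) k q) :
    Filt (wt F) (k - 1) (der F q) :=
  filt_der_of hF hq (i := q.vars.sup id) (fun _ hj => Finset.le_sup (f := id) hj)
    fun j _ => filt_dvar hF j

theorem der_eq_zero (hF : Prog F) {q : MvPolynomial ℕ ℝ} (hq : Filt (wt F) 0 q) : der F q = 0 := by
  rw [der_eq_sum]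
  refine Finset.sum_eq_zero fun m hm => ?_
  rw [Finset.sum_eq_zero, smul_zero]
  intro j hj
  exfalso
  have h1 := hq m hm
  have h2 : wt F j ≤ Finsupp.weight (wt F) m :=
      Finsupp.le_weight_of_ne_zero' _ (Finsupp.mem_support_iff.1 hj)
  have h3 := one_le_wt hF j
  omega

/-- The polynomial curve attached to a program and a sequence of fractional parts. -/
noncomputable def curve (F : ℕ → MvPolynomial ℕ ℝ) (ξ : ℕ → ℝ) : ℕ → Polynomial ℝ :=
  seqRec Polynomial.X fun i Z => aeval Z (F i) - Polynomial.C (ξ (i + 1))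

theorem curve_zero (ξ : ℕ → ℝ) : curve F ξ 0 = Polynomial.X := seqRec_zero _ _

theorem curve_succ (hF : Prog F) (ξ : ℕ → ℝ) (i : ℕ) :
    curve F ξ (i + 1) = aeval (curve F ξ) (F i) - Polynomial.C (ξ (i + 1)) := by
  refine seqRec_succ _ _ i fun y z h => ?_
  rw [aeval_congr_vars fun j hj => ?_]
  exact h j (hF i j hj)

theorem eval_aeval (Z : ℕ → Polynomial ℝ) (a : ℝ) (q : MvPolynomial ℕ ℝ) :
    (aeval Z q).eval a = eval (fun j => (Z j).eval a) q := by
  rw [aeval_def, ← Polynomial.coe_evalRingHom, hom_eval₂, ← eval₂_id]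
  congr 1
  ext x
  simp

theorem eval_curve (hF : Prog F) {ξ : ℕ → ℝ} {y : ℕ → ℤ}
    (hy : ∀ i, (y (i + 1) : ℝ) = ev y (F i) - ξ (i + 1)) (i : ℕ) :
    (curve F ξ i).eval (y 0 : ℝ) = y i := by
  induction i using Nat.strong_induction_on with
  | _ i ih =>
    rcases i with _ | i
    · simp [curve_zero]
    · rw [curve_succ hF, Polynomial.eval_sub, eval_aeval, hy, Polynomial.eval_C, ev]
      rw [eval_congr_vars fun j hj => ?_]
      exact ih j (by have := hF i j hj; omega)

theorem eval_aeval_curve (hF : Prog F) {ξ : ℕ → ℝ} {y : ℕ → ℤ}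
    (hy : ∀ i, (y (i + 1) : ℝ) = ev y (F i) - ξ (i + 1)) (q : MvPolynomial ℕ ℝ) :
    (aeval (curve F ξ) q).eval (y 0 : ℝ) = ev y q := by
  rw [eval_aeval, ev]
  congr 2
  ext i
  exact eval_curve hF hy i

theorem derivative_aeval_of (Z : ℕ → Polynomial ℝ) {i : ℕ} {q : MvPolynomial ℕ ℝ}
    (hq : ∀ j ∈ q.vars, j ≤ i)
    (h : ∀ j ≤ i, Polynomial.derivative (Z j) = aeval Z (der F (X j))) :
    Polynomial.derivative (aeval Z q) = aeval Z (der F q) := by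
  refine induction_of_vars_le (P := fun q => Polynomial.derivative (aeval Z q) =
    aeval Z (der F q)) hq (fun j hj => ?_) (fun a => ?_) (fun p q hp hq => ?_) (fun p q hp hq => ?_)
  · rw [aeval_X, h j hj]
  · rw [← algebraMap_eq, Derivation.map_algebraMap, map_zero, algebraMap_eq, aeval_C]
    simp
  · simp [hp, hq]
  · simp [hp, hq, smul_eq_mul]
    ring

theorem derivative_aeval_curve (hF : Prog F) (ξ : ℕ → ℝ) (q : MvPolynomial ℕ ℝ) :
    Polynomial.derivative (aeval (curve F ξ) q) = aeval (curve F ξ) (der F q) := by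
  have key : ∀ j, Polynomial.derivative (curve F ξ j) = aeval (curve F ξ) (der F (X j)) := by
    intro j
    induction j using Nat.strong_induction_on with
    | _ j ih =>
      rcases j with _ | j
      · rw [curve_zero, der_X_zero]
        simp
      · rw [der_X_succ hF, curve_succ hF, Polynomial.derivative_sub, Polynomial.derivative_C,
          sub_zero]
        exact derivative_aeval_of _ (hF j) fun a ha => ih a (by omega)
  exact derivative_aeval_of _ (i := q.vars.sup id) (fun _ hj => Finset.le_sup (f := id) hj)
    fun j _ => key j

theorem iterate_derivative_aeval_curve (hF : Prog F) (ξ : ℕ → ℝ) (q : MvPolynomial ℕ ℝ) (k : ℕ) :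
    Polynomial.derivative^[k] (aeval (curve F ξ) q) = aeval (curve F ξ) ((der F)^[k] q) := by
  induction k with
  | zero => rfl
  | succ k ih => rw [Function.iterate_succ_apply', Function.iterate_succ_apply', ih,
      derivative_aeval_curve hF]

/-- Families of polynomials of bounded degree with continuous coefficients. -/
def PolyCont (G : (ℕ → ℝ) → Polynomial ℝ) : Prop :=
  (∃ D, ∀ ξ, (G ξ).natDegree ≤ D) ∧ ∀ k, Continuous fun ξ => (G ξ).coeff k

theorem PolyCont.const (P : Polynomial ℝ) : PolyCont fun _ => P :=
  ⟨⟨P.natDegree, by simp⟩, fun k => continuous_const⟩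

theorem PolyCont.add {G H : (ℕ → ℝ) → Polynomial ℝ} (hG : PolyCont G) (hH : PolyCont H) :
    PolyCont fun ξ => G ξ + H ξ := by
  obtain ⟨⟨D, hD⟩, hG⟩ := hG
  obtain ⟨⟨E, hE⟩, hH⟩ := hH
  refine ⟨⟨max D E, fun ξ => Polynomial.natDegree_add_le_of_le (hD ξ) (hE ξ)⟩, fun k => ?_⟩
  simp only [Polynomial.coeff_add]
  exact (hG k).add (hH k)

theorem PolyCont.mul {G H : (ℕ → ℝ) → Polynomial ℝ} (hG : PolyCont G) (hH : PolyCont H) :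
    PolyCont fun ξ => G ξ * H ξ := by
  obtain ⟨⟨D, hD⟩, hG⟩ := hG
  obtain ⟨⟨E, hE⟩, hH⟩ := hH
  refine ⟨⟨D + E, fun ξ => Polynomial.natDegree_mul_le_of_le (hD ξ) (hE ξ)⟩, fun k => ?_⟩
  simp only [Polynomial.coeff_mul]
  exact continuous_finsetSum _ fun x _ => (hG x.1).mul (hH x.2)

theorem PolyCont.aeval_of {Z : (ℕ → ℝ) → ℕ → Polynomial ℝ} {i : ℕ} {q : MvPolynomial ℕ ℝ}
    (hq : ∀ j ∈ q.vars, j ≤ i) (hZ : ∀ j ≤ i, PolyCont fun ξ => Z ξ j) :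
    PolyCont fun ξ => aeval (Z ξ) q := by
  refine induction_of_vars_le (P := fun q => PolyCont fun ξ => aeval (Z ξ) q) hq (fun j hj => ?_)
    (fun a => ?_) (fun p q hp hq => ?_) (fun p q hp hq => ?_)
  · simpa using hZ j hj
  · simpa using PolyCont.const _
  · simpa using hp.add hq
  · simpa using hp.mul hq

theorem polyCont_aeval_curve (hF : Prog F) (q : MvPolynomial ℕ ℝ) :
    PolyCont fun ξ => aeval (curve F ξ) q := by
  have key : ∀ j, PolyCont fun ξ => curve F ξ j := by
    intro j
    induction j using Nat.strong_induction_on with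
    | _ j ih =>
      rcases j with _ | j
      · simpa only [curve_zero] using PolyCont.const _
      · simp only [curve_succ hF, sub_eq_add_neg, ← Polynomial.C_neg]
        refine (PolyCont.aeval_of (hF j) fun a ha => ih a (by omega)).add
          ⟨⟨0, fun ξ => by simp⟩, fun k => ?_⟩
        simp only [Polynomial.coeff_C]
        split_ifs
        · exact (continuous_apply _).neg
        · exact continuous_const
  exact PolyCont.aeval_of (i := q.vars.sup id) (fun _ hj => Finset.le_sup (f := id) hj)
    fun j _ => key j

theorem tendsto_eval_div_pow {T : Type*} {l : Filter T} {P : T → Polynomial ℝ} {Q : Polynomial ℝ}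
    {J : ℕ} (hdeg : ∀ᶠ t in l, (P t).natDegree ≤ J)
    (hP : ∀ k, Tendsto (fun t => (P t).coeff k) l (𝓝 (Q.coeff k))) {y : T → ℝ}
    (hy : Tendsto y l atTop) :
    Tendsto (fun t => (P t).eval (y t) / y t ^ J) l (𝓝 (Q.coeff J)) := by
  have h1 : Tendsto (fun t => ∑ k ∈ Finset.range (J + 1), (P t).coeff k * (y t ^ k / y t ^ J)) l
      (𝓝 (∑ k ∈ Finset.range (J + 1), Q.coeff k * if k = J then 1 else 0)) := by
    refine tendsto_finsetSum _ fun k hk => (hP k).mul ?_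
    split_ifs with h
    · subst h
      refine tendsto_nhds_of_eventually_eq ?_
      filter_upwards [hy.eventually_gt_atTop 0] with t ht
      exact div_self (by positivity)
    · have hk' : k < J := by simp at hk; omega
      exact (tendsto_pow_div_pow_atTop_zero hk').comp hy
  have h2 : ∑ k ∈ Finset.range (J + 1), Q.coeff k * (if k = J then 1 else 0) = Q.coeff J := by
    simp
  rw [h2] at h1
  refine h1.congr' ?_
  filter_upwards [hdeg] with t ht
  rw [Polynomial.eval_eq_sum_range' (Nat.lt_succ_of_le ht), Finset.sum_div]
  exact Finset.sum_congr rfl fun k _ => by rw [mul_div_assoc]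

theorem sign_eventually_eq {T : Type*} {l : Filter T} {a : T → ℝ} {b : ℝ}
    (h : Tendsto a l (𝓝 b)) (hb : b ≠ 0) : ∀ᶠ t in l, SignType.sign (a t) = SignType.sign b := by
  rcases lt_or_gt_of_ne hb with hb | hb
  · filter_upwards [h.eventually (gt_mem_nhds hb)] with t ht
    rw [sign_neg ht, sign_neg hb]
  · filter_upwards [h.eventually (lt_mem_nhds hb)] with t ht
    rw [sign_pos ht, sign_pos hb]

theorem sign_eval_eventually_eq {T : Type*} {l : Filter T} {P : T → Polynomial ℝ}
    {Q : Polynomial ℝ} {J : ℕ} (hdeg : ∀ᶠ t in l, (P t).natDegree ≤ J)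
    (hP : ∀ k, Tendsto (fun t => (P t).coeff k) l (𝓝 (Q.coeff k))) {y : T → ℝ}
    (hy : Tendsto y l atTop) (hQ : Q.coeff J ≠ 0) :
    ∀ᶠ t in l, SignType.sign ((P t).eval (y t)) = SignType.sign (Q.coeff J) := by
  filter_upwards [sign_eventually_eq (tendsto_eval_div_pow hdeg hP hy) hQ,
    hy.eventually_gt_atTop 0] with t h1 h2
  rw [← h1, div_eq_mul_inv, sign_mul, sign_pos (show 0 < (y t ^ J)⁻¹ by positivity), mul_one]

/-- Two families of integer points, `x s` and `y s n`, obeying the same polynomial recursion with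
bounded errors `ξ s` and `η s n`, where `η s n` converges to `ξ s`. -/
structure Core (p r : Ultrafilter ℕ) where
  F : ℕ → MvPolynomial ℕ ℝ
  prog : Prog F
  x : ℕ → ℕ → ℤ
  y : ℕ → ℕ → ℕ → ℤ
  ξ : ℕ → ℕ → ℝ
  η : ℕ → ℕ → ℕ → ℝ
  x_succ : ∀ s i, (x s (i + 1) : ℝ) = ev (x s) (F i) - ξ s (i + 1)
  y_succ : ∀ s n i, (y s n (i + 1) : ℝ) = ev (y s n) (F i) - η s n (i + 1)
  ξ_lim : ∀ s, Tendsto (fun t => ξ (s + t)) p (𝓝 (ξ s))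
  η_lim : ∀ s, Tendsto (η s) r (𝓝 (ξ s))
  x_lim : ∀ s, Tendsto (fun t => (x (s + t) 0 : ℝ)) p atTop
  y_lim : ∀ s, Tendsto (fun n => (y s n 0 : ℝ)) r atTop

/-- The value of a monomial at an integer point. -/
def mon (y : ℕ → ℤ) (m : ℕ →₀ ℕ) : ℤ := m.prod fun j k => y j ^ k

theorem ev_eq_sum (y : ℕ → ℤ) (q : MvPolynomial ℕ ℝ) {M : Finset (ℕ →₀ ℕ)} (hM : q.support ⊆ M) :
    ev y q = ∑ m ∈ M, q.coeff m * mon y m := by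
  rw [ev, eval_eq, Finset.sum_subset hM fun m _ hm => by rw [notMem_support_iff.1 hm, zero_mul]]
  refine Finset.sum_congr rfl fun m _ => ?_
  simp [mon, Finsupp.prod]

/-- Apply an additive map to the coefficients of a polynomial. -/
noncomputable def mapCoeff (φ : ℝ →+ ℝ) (q : MvPolynomial ℕ ℝ) : MvPolynomial ℕ ℝ :=
  ∑ m ∈ q.support, monomial m (φ (q.coeff m))

theorem coeff_sum_monomial (M : Finset (ℕ →₀ ℕ)) (c : (ℕ →₀ ℕ) → ℝ)
    (m : ℕ →₀ ℕ) [Decidable (m ∈ M)] :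
    (∑ m ∈ M, monomial m (c m)).coeff m = if m ∈ M then c m else 0 := by
  classical
  rw [coeff_sum]
  simp

theorem coeff_mapCoeff (φ : ℝ →+ ℝ) (q : MvPolynomial ℕ ℝ) (m : ℕ →₀ ℕ) :
    (mapCoeff φ q).coeff m = φ (q.coeff m) := by
  classical
  rw [mapCoeff, coeff_sum_monomial]
  split_ifs with h
  · rfl
  · rw [notMem_support_iff.1 h, map_zero]

theorem support_mapCoeff_subset (φ : ℝ →+ ℝ) (q : MvPolynomial ℕ ℝ) :
    (mapCoeff φ q).support ⊆ q.support := by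
  intro m hm
  rw [mem_support_iff, coeff_mapCoeff] at hm
  rw [mem_support_iff]
  rintro h
  rw [h, map_zero] at hm
  exact hm rfl

theorem ev_mapCoeff (φ : ℝ →+ ℝ) (q : MvPolynomial ℕ ℝ) (y : ℕ → ℤ) :
    ev y (mapCoeff φ q) = φ (ev y q) := by
  rw [ev_eq_sum y q subset_rfl, ev_eq_sum y _ (support_mapCoeff_subset φ q), map_sum]
  refine Finset.sum_congr rfl fun m _ => ?_
  rw [coeff_mapCoeff, mul_comm, mul_comm (q.coeff m), ← zsmul_eq_mul, ← zsmul_eq_mul, map_zsmul]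

/-- Polynomials with rational coefficients take discrete values at integer points. -/
theorem exists_discrete (q : MvPolynomial ℕ ℝ) (hq : ∀ m, ∃ a : ℚ, q.coeff m = a) :
    ∃ δ > 0, ∀ y, |ev y q| < δ → ev y q = 0 := by
  choose a ha using hq
  set D : ℕ := ∏ m ∈ q.support, (a m).den with hD
  have hD0 : 0 < D := Finset.prod_pos fun m _ => (a m).pos
  have hint : ∀ y, ∃ z : ℤ, (D : ℝ) * ev y q = z := by
    intro y
    refine ⟨∑ m ∈ q.support, ((∏ m' ∈ q.support.erase m, ((a m').den : ℤ)) *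
        (a m).num) * mon y m, ?_⟩
    rw [ev_eq_sum y q subset_rfl, Finset.mul_sum]
    push_cast
    refine Finset.sum_congr rfl fun m hm => ?_
    rw [← mul_assoc]
    congr 1
    rw [hD, ← Finset.mul_prod_erase _ _ hm, ha]
    push_cast
    have : ((a m : ℚ) : ℝ) * (a m).den = (a m).num := by exact_mod_cast (a m).mul_den_eq_num
    rw [← this]
    ring
  have hD1 : (0 : ℝ) < D := by exact_mod_cast hD0
  refine ⟨1 / D, by positivity, fun y hy => ?_⟩
  obtain ⟨z, hz⟩ := hint y
  have h1 : |(z : ℝ)| < 1 := by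
    rw [← hz, abs_mul, abs_of_pos hD1]
    rwa [lt_div_iff₀ hD1, mul_comm] at hy
  have h2 : z = 0 := by
    rw [← Int.abs_lt_one_iff]
    exact_mod_cast h1
  rw [h2, Int.cast_zero] at hz
  exact (mul_eq_zero.1 hz).resolve_left hD1.ne'

/-- Every polynomial is a combination of polynomials with rational coefficients, obtained from it
by additive maps on the coefficients. -/
theorem exists_rational_components (q : MvPolynomial ℕ ℝ) :
    ∃ (E : Finset ℝ) (φ : ℝ → ℝ →+ ℝ), (∀ e x, ∃ a : ℚ, φ e x = a) ∧
      q = ∑ e ∈ E, C e * mapCoeff (φ e) q := by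
  classical
  set b := Module.Basis.ofVectorSpace ℚ ℝ
  set E0 := q.support.biUnion fun m => (b.repr (q.coeff m)).support with hE0
  let φ0 : (Module.Basis.ofVectorSpaceIndex ℚ ℝ) → ℝ →+ ℝ := fun i =>
    ((Rat.castHom ℝ).toAddMonoidHom).comp (b.coord i).toAddMonoidHom
  have hφ0 : ∀ i x, φ0 i x = ((b.repr x i : ℚ) : ℝ) := fun i x => rfl
  have hinj : Function.Injective fun i : Module.Basis.ofVectorSpaceIndex ℚ ℝ => (b i) := b.injective
  refine ⟨E0.image fun i => b i, fun e => if h : ∃ i, b i = e then φ0 h.choose else 0, ?_, ?_⟩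
  · intro e x
    dsimp only
    split_ifs with h
    · exact ⟨_, hφ0 _ _⟩
    · exact ⟨0, by simp⟩
  · rw [Finset.sum_image fun i _ j _ h => hinj h]
    ext m
    rw [coeff_sum]
    have : ∀ i, (dite (∃ i', b i' = b i) (fun h => φ0 h.choose) fun _ => 0) = φ0 i := by
      intro i
      have h : ∃ i', b i' = b i := ⟨i, rfl⟩
      rw [dif_pos h, hinj h.choose_spec]
    simp only [this, coeff_C_mul, coeff_mapCoeff, hφ0]
    by_cases hm : m ∈ q.support
    · conv_lhs => rw [← b.linearCombination_repr (q.coeff m)]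
      rw [Finsupp.linearCombination_apply, Finsupp.sum]
      rw [Finset.sum_subset (s₂ := E0)]
      · refine Finset.sum_congr rfl fun i _ => ?_
        rw [Rat.smul_def, mul_comm]
      · exact Finset.subset_biUnion_of_mem (fun m => (b.repr (q.coeff m)).support) hm
      · intro i _ hi
        rw [Finsupp.notMem_support_iff.1 hi, zero_smul]
    · rw [notMem_support_iff.1 hm]
      simp

theorem natDegree_le_of_iterate_derivative_eq_zero {P : Polynomial ℝ} {J : ℕ}
    (h : Polynomial.derivative^[J + 1] P = 0) : P.natDegree ≤ J := by
  rw [Polynomial.natDegree_le_iff_coeff_eq_zero]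
  intro N hN
  have h1 := Polynomial.coeff_iterate_derivative (k := J + 1) P (N - (J + 1))
  rw [h, Polynomial.coeff_zero, show N - (J + 1) + (J + 1) = N by omega,
    eq_comm, smul_eq_zero] at h1
  refine h1.resolve_left ?_
  rw [Nat.descFactorial_eq_zero_iff_lt]
  omega

/-- Evaluation of the coefficients of a polynomial whose coefficients are sequences. -/
noncomputable def evalCoeff (t : ℕ) : MvPolynomial ℕ (ℕ → ℝ) →+* MvPolynomial ℕ ℝ :=
  MvPolynomial.map (Pi.evalRingHom _ t)

theorem ev_evalCoeff (z : ℕ → ℤ) (Q : MvPolynomial ℕ (ℕ → ℝ)) (t : ℕ) :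
    ev z (evalCoeff t Q) = ∑ m ∈ Q.support, Q.coeff m t * mon z m := by
  rw [ev_eq_sum z (evalCoeff t Q) (support_map_subset _ _)]
  refine Finset.sum_congr rfl fun m _ => ?_
  rw [evalCoeff, coeff_map]
  rfl

namespace Core

variable {p r : Ultrafilter ℕ} (K : Core p r)

/-- The polynomials vanishing at almost all of the points `x s`. -/
def Van (q : MvPolynomial ℕ ℝ) : Prop := ∀ᶠ s in p, ev (K.x s) q = 0

theorem coeff_ξ_lim (q : MvPolynomial ℕ ℝ) (s k : ℕ) :
    Tendsto (fun t => (aeval (curve K.F (K.ξ (s + t))) q).coeff k) p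
      (𝓝 ((aeval (curve K.F (K.ξ s)) q).coeff k)) :=
  (((polyCont_aeval_curve K.prog q).2 k).tendsto _).comp (K.ξ_lim s)

theorem coeff_η_lim (q : MvPolynomial ℕ ℝ) (s k : ℕ) :
    Tendsto (fun n => (aeval (curve K.F (K.η s n)) q).coeff k) r
      (𝓝 ((aeval (curve K.F (K.ξ s)) q).coeff k)) :=
  (((polyCont_aeval_curve K.prog q).2 k).tendsto _).comp (K.η_lim s)

theorem ev_x (q : MvPolynomial ℕ ℝ) (s : ℕ) :
    (aeval (curve K.F (K.ξ s)) q).eval (K.x s 0 : ℝ) = ev (K.x s) q :=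
  eval_aeval_curve K.prog (K.x_succ s) q

theorem ev_y (q : MvPolynomial ℕ ℝ) (s n : ℕ) :
    (aeval (curve K.F (K.η s n)) q).eval (K.y s n 0 : ℝ) = ev (K.y s n) q :=
  eval_aeval_curve K.prog (K.y_succ s n) q

variable {K}

theorem Van.curve_eq_zero (hp : IsIdem p) {q : MvPolynomial ℕ ℝ} (hq : K.Van q) :
    ∀ᶠ s in p, aeval (curve K.F (K.ξ s)) q = 0 := by
  by_contra hcon
  rw [← Ultrafilter.eventually_not] at hcon
  obtain ⟨D, hD⟩ := (polyCont_aeval_curve K.prog q).1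
  obtain ⟨J, -, hJ⟩ := (Ultrafilter.eventually_exists_mem_iff (f := p)
    (P := fun J s => (aeval (curve K.F (K.ξ s)) q).natDegree = J) (Set.finite_Iic D)).1
      (Eventually.of_forall fun s => ⟨_, hD (K.ξ s), rfl⟩)
  obtain ⟨s, h1, h2, h3, h4⟩ := (hcon.and (hJ.and (((hp _).1 hJ).and ((hp _).1 hq)))).exists
  have h5 : (aeval (curve K.F (K.ξ s)) q).coeff J ≠ 0 := by
    rw [← h2, Polynomial.coeff_natDegree, Polynomial.leadingCoeff_ne_zero]
    exact h1
  obtain ⟨t, ht, ht'⟩ := ((sign_eval_eventually_eq (h3.mono fun t h => h.le) (K.coeff_ξ_lim q s)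
    (K.x_lim s) h5).and h4).exists
  rw [K.ev_x, ht', sign_zero, eq_comm, sign_eq_zero_iff] at ht
  exact h5 ht

theorem Van.der (hp : IsIdem p) {q : MvPolynomial ℕ ℝ} (hq : K.Van q) : K.Van (der K.F q) := by
  filter_upwards [hq.curve_eq_zero hp] with s hs
  rw [← K.ev_x, ← derivative_aeval_curve K.prog, hs]
  simp

theorem Van.curve_η_of_derivative (hp : IsIdem p) {q : MvPolynomial ℕ ℝ} (hq : K.Van q)
    (hrat : ∀ m, ∃ a : ℚ, q.coeff m = a)
    (hd : ∀ᶠ s in p, ∀ᶠ n : ℕ in r, aeval (curve K.F (K.η s n)) (GenPolyAut.der K.F q) = 0) :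
    ∀ᶠ s in p, ∀ᶠ n : ℕ in r, aeval (curve K.F (K.η s n)) q = 0 := by
  obtain ⟨δ, hδ, hdisc⟩ := exists_discrete q hrat
  filter_upwards [hq.curve_eq_zero hp, hd] with s h1 h2
  have h3 := K.coeff_η_lim q s 0
  rw [h1, Polynomial.coeff_zero] at h3
  filter_upwards [h2, h3.abs.eventually (gt_mem_nhds (by simpa using hδ))] with n h4 h5
  rw [← derivative_aeval_curve K.prog] at h4
  have h6 := Polynomial.eq_C_of_natDegree_eq_zero (Polynomial.derivative_eq_zero.1 h4)
  have h7 := K.ev_y q s n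
  rw [h6, Polynomial.eval_C] at h7
  rw [h7] at h5 h6
  rw [h6, hdisc _ h5, Polynomial.C_0]

theorem Van.curve_η_eq_zero (hp : IsIdem p) {q : MvPolynomial ℕ ℝ} (hq : K.Van q) :
    ∀ᶠ s in p, ∀ᶠ n : ℕ in r, aeval (curve K.F (K.η s n)) q = 0 := by
  obtain ⟨j, hj⟩ := exists_filt (wt K.F) q
  induction j generalizing q with
  | zero => ?_
  | succ j ih => ?_
  all_goals
    obtain ⟨E, φ, hφ, hE⟩ := exists_rational_components q
    have key : ∀ e ∈ E, ∀ᶠ s in p, ∀ᶠ n : ℕ in r,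
        aeval (curve K.F (K.η s n)) (mapCoeff (φ e) q) = 0 := by
      intro e _
      have hf := fun m hm => hj m (support_mapCoeff_subset (φ e) q hm)
      have hv : K.Van (mapCoeff (φ e) q) := hq.mono fun s hs => by rw [ev_mapCoeff, hs, map_zero]
      refine hv.curve_η_of_derivative hp (fun m => ?_) ?_
      · rw [coeff_mapCoeff]
        exact hφ _ _
      · first
        | exact ih (hv.der hp) (filt_der K.prog hf)
        | simp [der_eq_zero K.prog hf]
    rw [← Finset.eventually_all] at key
    filter_upwards [key] with s hs
    rw [← Finset.eventually_all] at hs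
    filter_upwards [hs] with n hn
    rw [hE, map_sum]
    exact Finset.sum_eq_zero fun e he => by rw [map_mul, hn e he, mul_zero]

theorem sign_eq (hp : IsIdem p) (q : MvPolynomial ℕ ℝ) : ∀ᶠ s in p, ∀ᶠ n : ℕ in r,
    SignType.sign (ev (K.y s n) q) = SignType.sign (ev (K.x s) q) := by
  classical
  have hex : ∃ J, K.Van ((der K.F)^[J] q) := by
    obtain ⟨j, hj⟩ := exists_filt (wt K.F) q
    have : ∀ i, Filt (wt K.F) (j - i) ((der K.F)^[i] q) := by
      intro i
      induction i with
      | zero => exact hj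
      | succ i ih =>
        rw [Function.iterate_succ_apply']
        exact (filt_der K.prog ih).mono (by omega)
    refine ⟨j + 1, ?_⟩
    have h := this j
    rw [Nat.sub_self] at h
    rw [Function.iterate_succ_apply', der_eq_zero K.prog h]
    exact Eventually.of_forall fun s => by simp [ev]
  have hJ := Nat.find_spec hex
  have hmin := fun m => Nat.find_min (m := m) hex
  generalize Nat.find hex = J at hJ hmin
  rcases J with _ | J
  · filter_upwards [hJ.curve_η_eq_zero hp, hJ] with s hs hs'
    rw [Function.iterate_zero, id] at hs hs'
    filter_upwards [hs] with n hn
    rw [hs', ← K.ev_y, hn, Polynomial.eval_zero]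
  have hJ' := hmin J (Nat.lt_succ_self J)
  rw [Van, ← Ultrafilter.eventually_not] at hJ'
  have hdeg : ∀ᶠ s in p, (aeval (curve K.F (K.ξ s)) q).natDegree ≤ J := by
    filter_upwards [hJ.curve_eq_zero hp] with s hs
    exact natDegree_le_of_iterate_derivative_eq_zero
      (by rw [iterate_derivative_aeval_curve K.prog, hs])
  have hcoeff : ∀ᶠ s in p, (aeval (curve K.F (K.ξ s)) q).coeff J ≠ 0 := by
    filter_upwards [hdeg, hJ'] with s h1 h2 h3
    refine h2 ?_
    rw [← K.ev_x, ← iterate_derivative_aeval_curve K.prog]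
    have h4 : Polynomial.derivative^[J] (aeval (curve K.F (K.ξ s)) q) = 0 := by
      ext k
      rw [Polynomial.coeff_iterate_derivative, Polynomial.coeff_zero]
      rcases Nat.eq_zero_or_pos k with rfl | hk
      · rw [zero_add, h3, smul_zero]
      · rw [Polynomial.coeff_eq_zero_of_natDegree_lt (by omega), smul_zero]
    rw [h4, Polynomial.eval_zero]
  obtain ⟨σ, hσ⟩ := (Ultrafilter.eventually_exists_iff (f := p)
    (P := fun σ s => SignType.sign (ev (K.x s) q) = σ)).1 (Eventually.of_forall fun s => ⟨_, rfl⟩)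
  filter_upwards [hdeg, (hp _).1 hdeg, hcoeff, hσ, (hp _).1 hσ, hJ.curve_η_eq_zero hp]
    with s h1 h2 h3 h4 h5 h6
  obtain ⟨t, h7, h8⟩ := (h5.and (sign_eval_eventually_eq h2
    (K.coeff_ξ_lim q s) (K.x_lim s) h3)).exists
  have h9 := sign_eval_eventually_eq (l := (r : Filter ℕ)) (h6.mono fun n hn =>
    natDegree_le_of_iterate_derivative_eq_zero (by rw [iterate_derivative_aeval_curve K.prog, hn]))
    (K.coeff_η_lim q s) (K.y_lim s) h3
  filter_upwards [h9] with n hn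
  rw [← K.ev_y, hn, h4, ← h8, K.ev_x, h7]

theorem sign_sum_eq (hp : IsIdem p) (M : Finset (ℕ →₀ ℕ)) (c : ℕ → (ℕ →₀ ℕ) → ℝ) :
    ∀ᶠ s in p, ∀ᶠ n : ℕ in r, ∀ᶠ t in p, SignType.sign (∑ m ∈ M, c t m * mon (K.y s n) m) =
      SignType.sign (∑ m ∈ M, c t m * mon (K.x s) m) := by
  classical
  induction M using Finset.strongInduction generalizing c with
  | H M ih =>
    rcases M.eq_empty_or_nonempty with rfl | hne
    · simp
    obtain ⟨m0, hm0, hmax⟩ := (Ultrafilter.eventually_exists_mem_iff (f := p)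
      (P := fun m0 t => ∀ m ∈ M, |c t m| ≤ |c t m0|) M.finite_toSet).1
        (Eventually.of_forall fun t => by simpa using M.exists_max_image (fun m => |c t m|) hne)
    rw [Finset.mem_coe] at hm0
    by_cases h0 : ∀ᶠ t in p, c t m0 = 0
    · refine Eventually.of_forall fun s => Eventually.of_forall fun n => ?_
      filter_upwards [h0, hmax] with t h1 h2
      have h3 : ∀ m ∈ M, c t m = 0 := fun m hm => by
        have := h2 m hm
        rw [h1, abs_zero] at this
        exact abs_nonpos_iff.1 this
      rw [Finset.sum_eq_zero fun m hm => by rw [h3 m hm, zero_mul],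
        Finset.sum_eq_zero fun m hm => by rw [h3 m hm, zero_mul]]
    rw [← Ultrafilter.eventually_not] at h0
    have hlim : ∀ m, ∃ ω, m ∈ M → Tendsto (fun t => c t m / c t m0) p (𝓝 ω) := by
      intro m
      by_cases hm : m ∈ M
      · have hbd : ∀ᶠ t in p, c t m / c t m0 ∈ Set.Icc (-1 : ℝ) 1 := by
          filter_upwards [hmax, h0] with t h1 h2
          rw [Set.mem_Icc, ← abs_le, abs_div, div_le_one (abs_pos.2 h2)]
          exact h1 m hm
        obtain ⟨ω, -, hω⟩ := isCompact_Icc.ultrafilter_le_nhds (p.map fun t => c t m / c t m0)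
          (Filter.le_principal_iff.2 hbd)
        exact ⟨ω, fun _ => hω⟩
      · exact ⟨0, fun h => absurd h hm⟩
    choose ω hω using hlim
    have hω0 : ω m0 = 1 := by
      refine tendsto_nhds_unique (hω m0 hm0) (tendsto_nhds_of_eventually_eq ?_)
      filter_upwards [h0] with t ht using div_self ht
    have hev : ∀ z : ℕ → ℤ, ev z (∑ m ∈ M, monomial m (ω m)) = ∑ m ∈ M, ω m * mon z m := by
      intro z
      rw [ev_eq_sum (M := M)]
      · exact Finset.sum_congr rfl fun m hm => by rw [coeff_sum_monomial, if_pos hm]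
      · intro m hm
        rw [mem_support_iff, coeff_sum_monomial] at hm
        by_contra h
        simp [h] at hm
    have hS := sign_eq (K := K) hp (∑ m ∈ M, monomial m (ω m))
    simp only [hev] at hS
    by_cases hz : ∀ᶠ s in p, ∑ m ∈ M, ω m * mon (K.x s) m = 0
    · have hrec := ih (M.erase m0) (Finset.erase_ssubset hm0) fun t m => c t m - c t m0 * ω m
      filter_upwards [hS, hz, hrec] with s h1 h2 h3
      filter_upwards [h1, h3] with n h4 h5
      rw [h2, sign_zero, sign_eq_zero_iff] at h4
      filter_upwards [h5] with t h6
      have hexp : ∀ z : ℕ → ℤ, ∑ m ∈ M, ω m * mon z m = 0 →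
          ∑ m ∈ M.erase m0, (c t m - c t m0 * ω m) * mon z m = ∑ m ∈ M, c t m * mon z m := by
        intro z hz
        rw [Finset.sum_erase _ (by rw [hω0]; ring)]
        simp only [sub_mul, Finset.sum_sub_distrib, mul_assoc]
        rw [← Finset.mul_sum, hz]
        ring
      rwa [hexp _ h2, hexp _ h4] at h6
    · rw [← Ultrafilter.eventually_not] at hz
      have hconv : ∀ z : ℕ → ℤ, ∑ m ∈ M, ω m * mon z m ≠ 0 → ∀ᶠ t in p,
          SignType.sign (∑ m ∈ M, c t m * mon z m) =
            SignType.sign (c t m0) * SignType.sign (∑ m ∈ M, ω m * mon z m) := by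
        intro z hz
        have h1 : Tendsto (fun t => ∑ m ∈ M, c t m / c t m0 * mon z m) p
            (𝓝 (∑ m ∈ M, ω m * mon z m)) :=
          tendsto_finsetSum _ fun m hm => (hω m hm).mul_const _
        filter_upwards [sign_eventually_eq h1 hz, h0] with t h2 h3
        rw [← h2, ← sign_mul, Finset.mul_sum]
        congr 1
        refine Finset.sum_congr rfl fun m _ => ?_
        field_simp
      filter_upwards [hS, hz] with s h1 h2
      filter_upwards [h1] with n h3
      have h4 : ∑ m ∈ M, ω m * mon (K.y s n) m ≠ 0 := by
        rw [← sign_ne_zero, h3, sign_ne_zero]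
        exact h2
      filter_upwards [hconv _ h2, hconv _ h4] with t h5 h6
      rw [h5, h6, h3]

theorem sign_ev_evalCoeff_eq (hp : IsIdem p) (Q : MvPolynomial ℕ (ℕ → ℝ)) :
    ∀ᶠ s in p, ∀ᶠ n : ℕ in r, ∀ᶠ t in p, SignType.sign (ev (K.y s n) (evalCoeff t Q)) =
      SignType.sign (ev (K.x s) (evalCoeff t Q)) := by
  simp only [ev_evalCoeff]
  exact sign_sum_eq hp _ fun t m => Q.coeff m t

end Core

theorem vars_aeval_le {R : Type*} [CommSemiring R] [Algebra ℝ R] {Φ : ℕ → MvPolynomial ℕ R} {i : ℕ}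
    (hΦ : ∀ j ≤ i, ∀ a ∈ (Φ j).vars, a ≤ i) {q : MvPolynomial ℕ ℝ} (hq : ∀ j ∈ q.vars, j ≤ i) :
    ∀ a ∈ (aeval Φ q).vars, a ≤ i := by
  classical
  refine induction_of_vars_le (P := fun q => ∀ a ∈ (aeval Φ q).vars, a ≤ i) hq (fun j hj => ?_)
    (fun c => ?_) (fun p q hp hq => ?_) fun p q hp hq => ?_
  · simpa using hΦ j hj
  · intro a ha
    rw [aeval_C, MvPolynomial.algebraMap_apply, vars_C] at ha
    simp at ha
  · intro a ha
    rw [map_add] at ha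
    rcases Finset.mem_union.1 (vars_add_subset _ _ ha) with h | h
    exacts [hp a h, hq a h]
  · intro a ha
    rw [map_mul] at ha
    rcases Finset.mem_union.1 (vars_mul _ _ ha) with h | h
    exacts [hp a h, hq a h]

theorem vars_le_of_support_subset {R S : Type*} [CommSemiring R] [CommSemiring S]
    {P : MvPolynomial ℕ R} {Q : MvPolynomial ℕ S} (h : P.support ⊆ Q.support) {i : ℕ}
    (hQ : ∀ a ∈ Q.vars, a ≤ i) : ∀ a ∈ P.vars, a ≤ i := by
  intro a ha
  obtain ⟨m, hm, ham⟩ := (mem_vars_iff_mem_support _).1 ha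
  exact hQ a ((mem_vars_iff_mem_support _).2 ⟨m, h hm, ham⟩)

/-- Coefficientwise integer part. -/
noncomputable def floorM (Q : MvPolynomial ℕ (ℕ → ℝ)) : MvPolynomial ℕ (ℕ → ℝ) :=
  ∑ m ∈ Q.support, monomial m fun t => (⌊Q.coeff m t⌋ : ℝ)

theorem coeff_floorM (Q : MvPolynomial ℕ (ℕ → ℝ)) (m : ℕ →₀ ℕ) (t : ℕ) :
    (floorM Q).coeff m t = ⌊Q.coeff m t⌋ := by
  classical
  have : (floorM Q).coeff m = if m ∈ Q.support then fun t => (⌊Q.coeff m t⌋ : ℝ) else 0 := by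
    rw [floorM, coeff_sum]
    simp only [coeff_monomial]
    rw [Finset.sum_ite_eq']
  rw [this]
  split_ifs with h
  · rfl
  · rw [notMem_support_iff.1 h]
    simp

theorem support_floorM_subset (Q : MvPolynomial ℕ (ℕ → ℝ)) : (floorM Q).support ⊆ Q.support := by
  intro m hm
  rw [mem_support_iff] at hm ⊢
  rintro h
  refine hm ?_
  ext t
  rw [coeff_floorM, h]
  simp

theorem exists_int_ev_floorM (Q : MvPolynomial ℕ (ℕ → ℝ)) (z : ℕ → ℤ) (t : ℕ) :
    ∃ k : ℤ, ev z (evalCoeff t (floorM Q)) = k := by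
  refine ⟨∑ m ∈ (floorM Q).support, ⌊Q.coeff m t⌋ * mon z m, ?_⟩
  rw [ev_evalCoeff]
  push_cast
  exact Finset.sum_congr rfl fun m _ => by rw [coeff_floorM]

theorem ev_evalCoeff_congr {Q : MvPolynomial ℕ (ℕ → ℝ)} {z z' : ℕ → ℤ}
    (h : ∀ j ∈ Q.vars, z j = z' j)
    (t : ℕ) : ev z (evalCoeff t Q) = ev z' (evalCoeff t Q) := by
  refine eval_congr_vars fun j hj => ?_
  rw [h j (vars_map _ _ hj)]

theorem ev_evalCoeff_aeval (Φ : ℕ → MvPolynomial ℕ (ℕ → ℝ)) (q : MvPolynomial ℕ ℝ)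
    (z : ℕ → ℤ) (t : ℕ) :
    ev z (evalCoeff t (aeval Φ q)) = eval (fun j => ev z (evalCoeff t (Φ j))) q := by
  have : ((eval fun j => (z j : ℝ)).comp (evalCoeff t)).comp (aeval Φ : _ →ₐ[ℝ] _).toRingHom =
      eval fun j => ev z (evalCoeff t (Φ j)) := by
    refine ringHom_ext (fun a => ?_) fun j => ?_
    · simp [evalCoeff, MvPolynomial.algebraMap_apply]
    · simp [ev]
  exact congrArg (fun g => g q) this

section LimitProgram

variable (f : ℕ → MvPolynomial ℕ ℝ) (κ : ℕ) (p : Ultrafilter ℕ)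

/-- Polynomials expressing the register contents on the input `a * κ ^ t` in terms of registers not
depending on `t`. -/
noncomputable def Phi : ℕ → MvPolynomial ℕ (ℕ → ℝ) :=
  seqRec (C (fun t => (κ : ℝ) ^ t) * X 0) fun i Φ => X (i + 1) + floorM (aeval Φ (f i))

/-- The coefficientwise fractional part of the substituted program. -/
noncomputable def theta (i : ℕ) : MvPolynomial ℕ (ℕ → ℝ) :=
  aeval (Phi f κ) (f i) - floorM (aeval (Phi f κ) (f i))

/-- The coefficientwise limit of `theta`. -/
noncomputable def flim (i : ℕ) : MvPolynomial ℕ ℝ :=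
  ∑ m ∈ (theta f κ i).support, monomial m (limUnder (p : Filter ℕ) fun t => (theta f κ i).coeff m t)

open Classical in
/-- The limit registers. -/
noncomputable def mlim (a : ℤ) : ℕ → ℤ :=
  seqRec a fun i z => Classical.epsilon fun k : ℤ =>
      ∀ᶠ t in p, ⌊ev z (evalCoeff t (theta f κ i))⌋ = k

/-- The errors of the limit registers with respect to the limit program. -/
noncomputable def mErr (a : ℤ) : ℕ → ℝ
  | 0 => 0
  | i + 1 => ev (mlim f κ p a) (flim f κ p i) - mlim f κ p a (i + 1)

variable {f κ p}

theorem Phi_zero : Phi f κ 0 = C (fun t => (κ : ℝ) ^ t) * X 0 := seqRec_zero _ _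

theorem Phi_succ (hf : Prog f) (i : ℕ) :
    Phi f κ (i + 1) = X (i + 1) + floorM (aeval (Phi f κ) (f i)) := by
  refine seqRec_succ _ _ i fun y z h => ?_
  rw [aeval_congr_vars fun j hj => h j (hf i j hj)]

theorem vars_Phi (hf : Prog f) (i : ℕ) : ∀ a ∈ (Phi f κ i).vars, a ≤ i := by
  classical
  induction i using Nat.strong_induction_on with
  | _ i ih =>
    intro a ha
    rcases i with _ | i
    · rw [Phi_zero] at ha
      rcases Finset.mem_union.1 (vars_mul _ _ ha) with h | h
      · rw [vars_C] at h
        simp at h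
      · rw [vars_X, Finset.mem_singleton] at h
        omega
    · rw [Phi_succ hf] at ha
      rcases Finset.mem_union.1 (vars_add_subset _ _ ha) with h | h
      · rw [vars_X, Finset.mem_singleton] at h
        omega
      · have := vars_le_of_support_subset (support_floorM_subset _)
          (vars_aeval_le (i := i) (fun j hj b hb => (ih j (by omega) b hb).trans hj) (hf i)) a h
        omega

theorem vars_theta (hf : Prog f) (i : ℕ) : ∀ a ∈ (theta f κ i).vars, a ≤ i := by
  classical
  have h1 := vars_aeval_le (i := i) (fun j hj b hb => (vars_Phi (κ := κ) hf j b hb).trans hj) (hf i)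
  intro a ha
  rcases Finset.mem_union.1 (vars_sub_subset _ ha) with h | h
  · exact h1 a h
  · exact vars_le_of_support_subset (support_floorM_subset _) h1 a h

theorem coeff_theta_mem (i : ℕ) (m : ℕ →₀ ℕ) (t : ℕ) :
    (theta f κ i).coeff m t ∈ Set.Icc (0 : ℝ) 1 := by
  rw [theta, coeff_sub, Pi.sub_apply, coeff_floorM]
  exact ⟨Int.fract_nonneg _, (Int.fract_lt_one _).le⟩

theorem coeff_theta_lim (i : ℕ) (m : ℕ →₀ ℕ) :
    Tendsto (fun t => (theta f κ i).coeff m t) p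
      (𝓝 (limUnder (p : Filter ℕ) fun t => (theta f κ i).coeff m t)) := by
  refine tendsto_nhds_limUnder ?_
  obtain ⟨ω, -, hω⟩ := isCompact_Icc.ultrafilter_le_nhds (p.map fun t => (theta f κ i).coeff m t)
    (Filter.le_principal_iff.2 (Filter.mem_map.2 (Eventually.of_forall
      fun t => coeff_theta_mem i m t)))
  exact ⟨ω, hω⟩

theorem support_flim_subset (i : ℕ) : (flim f κ p i).support ⊆ (theta f κ i).support := by
  classical
  intro m hm
  rw [mem_support_iff, flim, coeff_sum_monomial] at hm
  by_contra h
  simp [h] at hm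

theorem prog_flim (hf : Prog f) : Prog (flim f κ p) := fun i =>
  vars_le_of_support_subset (support_flim_subset i) (vars_theta hf i)

theorem ev_theta_lim (i : ℕ) (z : ℕ → ℤ) :
    Tendsto (fun t => ev z (evalCoeff t (theta f κ i))) p (𝓝 (ev z (flim f κ p i))) := by
  classical
  rw [ev_eq_sum z _ (support_flim_subset i)]
  simp only [ev_evalCoeff]
  refine tendsto_finsetSum _ fun m hm => ?_
  rw [flim, coeff_sum_monomial, if_pos hm]
  exact (coeff_theta_lim i m).mul_const _

theorem exists_floor_theta (i : ℕ) (z : ℕ → ℤ) :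
    ∃ k : ℤ, ∀ᶠ t in p, ⌊ev z (evalCoeff t (theta f κ i))⌋ = k := by
  have h1 := ev_theta_lim (p := p) (f := f) (κ := κ) i z
  set L := ev z (flim f κ p i)
  have h2 : ∀ᶠ t in p, ∃ k ∈ Set.Icc (⌊L⌋ - 1) (⌊L⌋ + 1),
      ⌊ev z (evalCoeff t (theta f κ i))⌋ = k := by
    filter_upwards [h1.eventually (lt_mem_nhds (sub_one_lt L)),
      h1.eventually (gt_mem_nhds (lt_add_one L))] with t h3 h4
    refine ⟨_, ⟨?_, ?_⟩, rfl⟩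
    · rw [← Int.floor_sub_one]
      exact Int.floor_le_floor h3.le
    · rw [← Int.floor_add_one]
      exact Int.floor_le_floor h4.le
  obtain ⟨k, -, hk⟩ := (Ultrafilter.eventually_exists_mem_iff (Set.finite_Icc _ _)).1 h2
  exact ⟨k, hk⟩

theorem mlim_zero (a : ℤ) : mlim f κ p a 0 = a := seqRec_zero _ _

theorem mlim_succ (hf : Prog f) (a : ℤ) (i : ℕ) :
    ∀ᶠ t in p, ⌊ev (mlim f κ p a) (evalCoeff t (theta f κ i))⌋ = mlim f κ p a (i + 1) := by
  have : mlim f κ p a (i + 1) = _ := seqRec_succ _ _ i fun y z h => by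
    have : ∀ t, ev y (evalCoeff t (theta f κ i)) = ev z (evalCoeff t (theta f κ i)) :=
      ev_evalCoeff_congr fun j hj => h j (vars_theta hf i j hj)
    simp only [this]
  rw [this]
  exact Classical.epsilon_spec (exists_floor_theta i (mlim f κ p a))

theorem ev_aeval_Phi (a : ℤ) {q : MvPolynomial ℕ ℝ}
    (h : ∀ j ∈ q.vars, ∀ᶠ t in p, (run f (a * κ ^ t) j : ℝ) =
        ev (mlim f κ p a) (evalCoeff t (Phi f κ j))) :
    ∀ᶠ t in p, ev (run f (a * κ ^ t)) q = ev (mlim f κ p a) (evalCoeff t (aeval (Phi f κ) q)) := by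
  rw [← Finset.eventually_all] at h
  filter_upwards [h] with t ht
  rw [ev_evalCoeff_aeval, ev]
  exact eval_congr_vars ht

theorem run_eventually_eq (hf : Prog f) (a : ℤ) (i : ℕ) :
    ∀ᶠ t in p, (run f (a * κ ^ t) i : ℝ) = ev (mlim f κ p a) (evalCoeff t (Phi f κ i)) := by
  induction i using Nat.strong_induction_on with
  | _ i ih =>
    rcases i with _ | i
    · refine Eventually.of_forall fun t => ?_
      rw [Phi_zero, run_zero]
      simp [ev, evalCoeff, mlim_zero, mul_comm]
    · filter_upwards [ev_aeval_Phi a fun j hj => ih j (Nat.lt_succ_of_le (hf i j hj)),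
        mlim_succ hf a i] with t h1 h2
      obtain ⟨k, hk⟩ := exists_int_ev_floorM (aeval (Phi f κ) (f i)) (mlim f κ p a) t
      rw [theta, map_sub, ev, map_sub, ← ev, ← ev, ← h1, hk, Int.floor_sub_intCast,
        ← run_succ hf] at h2
      rw [Phi_succ hf, map_add, ev, map_add, ← ev, ← ev, hk]
      rw [sub_eq_iff_eq_add] at h2
      rw [h2]
      simp [ev, evalCoeff]

theorem fract_lim (hf : Prog f) (a : ℤ) (i : ℕ) :
    Tendsto (fun t => Int.fract (ev (run f (a * κ ^ t)) (f i))) p (𝓝 (mErr f κ p a (i + 1))) := by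
  refine ((ev_theta_lim i (mlim f κ p a)).sub_const _).congr' ?_
  filter_upwards [ev_aeval_Phi a fun j _ => run_eventually_eq hf a j, mlim_succ hf a i] with t h1 h2
  rw [← h2]
  obtain ⟨k, hk⟩ := exists_int_ev_floorM (aeval (Phi f κ) (f i)) (mlim f κ p a) t
  change Int.fract _ = _
  rw [theta, map_sub, ev, map_sub, ← ev, ← ev, ← h1, hk, Int.fract_sub_intCast]

end LimitProgram

/-- Registers following those in `x` at the nearest integer. -/
noncomputable def follow (F : ℕ → MvPolynomial ℕ ℝ) (x : ℕ → ℤ) (a : ℤ) : ℕ → ℤ :=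
  seqRec a fun i y => x (i + 1) + round (ev y (F i) - ev x (F i))

theorem follow_zero (F : ℕ → MvPolynomial ℕ ℝ) (x : ℕ → ℤ) (a : ℤ) : follow F x a 0 = a :=
  seqRec_zero _ _

theorem follow_succ {F : ℕ → MvPolynomial ℕ ℝ} (hF : Prog F) (x : ℕ → ℤ) (a : ℤ) (i : ℕ) :
    follow F x a (i + 1) = x (i + 1) + round (ev (follow F x a) (F i) - ev x (F i)) := by
  refine seqRec_succ _ _ i fun y z h => ?_
  have : ev y (F i) = ev z (F i) := eval_congr_vars fun j hj => by rw [h j (hF i j hj)]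
  simp only [this]

theorem rve_ev_sub {r : Ultrafilter ℕ} (hr : IsIdem r) {I : Type*} {u : Ultrafilter I} {i : ℕ}
    {q : MvPolynomial ℕ ℝ} (hq : ∀ j ∈ q.vars, j ≤ i) {x : ℕ → ℤ} {y : ℕ → ℕ → ℤ}
    (h : ∀ j ≤ i, RVe r u fun n _ => (y n j : ℝ) - x j) :
    RVe r u fun n _ => ev (y n) q - ev x q := by
  refine induction_of_vars_le (P := fun q => RVe r u fun n _ => ev (y n) q - ev x q) hq
    (fun j hj => ?_) (fun c => ?_) (fun p q hp hq => ?_) fun p q hp hq => ?_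
  · simpa [ev] using h j hj
  · simpa [ev] using RVe.zero
  · refine (hp.add hr hq).congr hr (Eventually.of_forall fun n => Eventually.of_forall fun _ => ?_)
    simp only [ev, map_add]
    ring
  · refine (((hp.mul hr hq).add hr (hq.smul fun _ => ev x p)).add hr
        (hp.smul fun _ => ev x q)).congr
      hr (Eventually.of_forall fun n => Eventually.of_forall fun _ => ?_)
    simp only [ev, map_mul]
    ring

theorem rve_follow {r : Ultrafilter ℕ} (hr : IsIdem r) {I : Type*} {u : Ultrafilter I}
    {F : ℕ → MvPolynomial ℕ ℝ} (hF : Prog F) {x : ℕ → ℤ} {v : ℕ → ℤ}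
    (hv : RVe r u fun n _ => (v n : ℝ)) (i : ℕ) :
    RVe r u fun n _ => (follow F x (x 0 + v n) i : ℝ) - x i := by
  induction i using Nat.strong_induction_on with
  | _ i ih =>
    rcases i with _ | i
    · simpa [follow_zero] using hv
    · refine ((rve_ev_sub hr (hF i) fun j hj => ih j (by omega)).round_coe hr).congr hr
        (Eventually.of_forall fun n => Eventually.of_forall fun _ => ?_)
      rw [follow_succ hF]
      push_cast
      ring

section Main

variable {f : ℕ → MvPolynomial ℕ ℝ} {κ : ℕ} {p r : Ultrafilter ℕ} {a₀ : ℤ} {v : ℕ → ℕ → ℤ}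

/-- The errors of the registers in `follow`. -/
noncomputable def followErr (F : ℕ → MvPolynomial ℕ ℝ) (x : ℕ → ℤ) (a : ℤ) : ℕ → ℝ
  | 0 => 0
  | i + 1 => ev (follow F x a) (F i) - follow F x a (i + 1)

theorem mErr_lim (hp : IsIdem p) (hf : Prog f) (s : ℕ) :
    Tendsto (fun t => mErr f κ p (a₀ * κ ^ (s + t))) p (𝓝 (mErr f κ p (a₀ * κ ^ s))) := by
  rw [tendsto_pi_nhds]
  intro i
  rcases i with _ | i
  · exact tendsto_const_nhds
  refine hp.tendsto_of_shift (x := fun t => Int.fract (ev (run f (a₀ * κ ^ (s + t))) (f i))) ?_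
    (Eventually.of_forall fun n => ?_)
  · simpa only [pow_add, mul_assoc] using fract_lim (κ := κ) hf (a₀ * κ ^ s) i
  · have := fract_lim (p := p) (κ := κ) hf (a₀ * κ ^ (s + n)) i
    simpa only [pow_add, mul_assoc] using this

theorem followErr_lim (hr : IsIdem r) {F : ℕ → MvPolynomial ℕ ℝ} (hF : Prog F) {x : ℕ → ℤ}
    {v : ℕ → ℤ} (hv : RVe r (pure ()) fun n _ => (v n : ℝ)) {ξ : ℕ → ℝ} (h0 : ξ 0 = 0)
    (hξ : ∀ i, ξ (i + 1) = ev x (F i) - x (i + 1)) :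
    Tendsto (fun n => followErr F x (x 0 + v n)) r (𝓝 ξ) := by
  rw [tendsto_pi_nhds]
  intro i
  rcases i with _ | i
  · rw [h0]
    exact tendsto_const_nhds
  rw [Metric.tendsto_nhds]
  intro ε hε
  have h1 := (rve_ev_sub hr (hF i) fun j _ => rve_follow hr hF (x := x) hv j).near_int hr hε
  filter_upwards [h1] with n hn
  have hn' := hn.exists.choose_spec
  rw [Real.dist_eq, hξ, followErr, follow_succ hF]
  refine lt_of_eq_of_lt ?_ hn'
  congr 1
  push_cast
  ring

/-- The registers of the limit program along `a₀ * κ ^ s` and nearby points. -/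
noncomputable def mkCore (hp : IsIdem p) (hr : IsIdem r) (hp' : (p : Filter ℕ) ≤ atTop)
    (hf : Prog f)
    (hκ : 2 ≤ κ) (ha : 0 < a₀) (hv : ∀ s, RVe r (pure ()) fun n _ => (v s n : ℝ))
    (hv' : ∀ s, Tendsto (v s) r atTop) : Core p r where
  F := flim f κ p
  prog := prog_flim hf
  x s := mlim f κ p (a₀ * κ ^ s)
  y s n := follow (flim f κ p) (mlim f κ p (a₀ * κ ^ s)) (mlim f κ p (a₀ * κ ^ s) 0 + v s n)
  ξ s := mErr f κ p (a₀ * κ ^ s)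
  η s n := followErr (flim f κ p) (mlim f κ p (a₀ * κ ^ s)) (mlim f κ p (a₀ * κ ^ s) 0 + v s n)
  x_succ s i := by rw [mErr]; ring
  y_succ s n i := by rw [followErr]; ring
  ξ_lim := mErr_lim hp hf
  η_lim s := followErr_lim hr (prog_flim hf) (hv s) rfl fun i => rfl
  x_lim s := by
    simp only [mlim_zero]
    push_cast
    have h1 : Tendsto (fun t => (κ : ℝ) ^ t) p atTop :=
      (tendsto_pow_atTop_atTop_of_one_lt (by exact_mod_cast hκ)).mono_left hp'
    simp only [pow_add, ← mul_assoc]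
    refine h1.const_mul_atTop ?_
    have : (0 : ℝ) < a₀ := by exact_mod_cast ha
    have : (0 : ℝ) < κ := by exact_mod_cast (by omega : 0 < κ)
    positivity
  y_lim s := by
    simp only [follow_zero, Int.cast_add]
    exact tendsto_atTop_add_const_left _ _ (tendsto_intCast_atTop_atTop.comp (hv' s))

theorem mlim_eventually_eq_follow (hp : IsIdem p) (hr : IsIdem r) (hp' : (p : Filter ℕ) ≤ atTop)
    (hf : Prog f) (hκ : 2 ≤ κ) (ha : 0 < a₀) (hv : ∀ s, RVe r (pure ()) fun n _ => (v s n : ℝ))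
    (hv' : ∀ s, Tendsto (v s) r atTop) (i : ℕ) : ∀ᶠ s in p, ∀ᶠ n : ℕ in r,
      mlim f κ p (a₀ * κ ^ s + v s n) i = (mkCore hp hr hp' hf hκ ha hv hv').y s n i := by
  set K := mkCore hp hr hp' hf hκ ha hv hv'
  induction i using Nat.strong_induction_on with
  | _ i ih =>
    rcases i with _ | i
    · refine Eventually.of_forall fun s => Eventually.of_forall fun n => ?_
      simp [K, mkCore, mlim_zero, follow_zero]
    have ih' : ∀ j ∈ Finset.range (i + 1), ∀ᶠ s in p, ∀ᶠ n : ℕ in r,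
        mlim f κ p (a₀ * κ ^ s + v s n) j = K.y s n j := fun j hj => ih j (by simpa using hj)
    rw [← Finset.eventually_all] at ih'
    filter_upwards [ih', K.sign_ev_evalCoeff_eq hp (theta f κ i - X (i + 1)),
      K.sign_ev_evalCoeff_eq hp (theta f κ i - X (i + 1) - 1)] with s h1 h2 h3
    rw [← Finset.eventually_all] at h1
    filter_upwards [h1, h2, h3] with n h4 h5 h6
    have h7 := mlim_succ (p := p) (κ := κ) hf (a₀ * κ ^ s) i
    obtain ⟨t, h8, h9, h10, h11⟩ := (h5.and (h6.and
      ((mlim_succ (p := p) (κ := κ) hf (a₀ * κ ^ s + v s n) i).and h7))).exists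
    rw [ev_evalCoeff_congr (z' := K.y s n) fun j hj => h4 j
      (by have := vars_theta hf i j hj; simpa using Nat.lt_succ_of_le this)] at h10
    rw [← h10]
    have hx : K.x s = mlim f κ p (a₀ * κ ^ s) := rfl
    rw [Int.floor_eq_iff, ← hx] at h11
    have e1 : ∀ z : ℕ → ℤ, ev z (evalCoeff t (theta f κ i - X (i + 1))) =
        ev z (evalCoeff t (theta f κ i)) - z (i + 1) := fun z => by simp [ev, evalCoeff]
    have e2 : ∀ z : ℕ → ℤ, ev z (evalCoeff t (theta f κ i - X (i + 1) - 1)) =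
        ev z (evalCoeff t (theta f κ i)) - z (i + 1) - 1 := fun z => by simp [ev, evalCoeff]
    rw [e1, e1] at h8
    rw [e2, e2] at h9
    rw [Int.floor_eq_iff]
    constructor
    · have : 0 ≤ SignType.sign (ev (K.x s) (evalCoeff t (theta f κ i)) - K.x s (i + 1)) := by
        rw [sign_nonneg_iff]
        linarith
      rw [← h8, sign_nonneg_iff] at this
      linarith
    · have : SignType.sign (ev (K.x s) (evalCoeff t (theta f κ i)) - K.x s (i + 1) - 1) = -1 := by
        rw [sign_eq_neg_one_iff]
        linarith
      rw [← h9, sign_eq_neg_one_iff] at this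
      linarith

theorem IsProg.eventually_eq {H : ℤ → ℝ} (hH : IsProg H) (hp : IsIdem p) (hr : IsIdem r)
    (hp' : (p : Filter ℕ) ≤ atTop) (hκ : 2 ≤ κ) (ha : 0 < a₀)
    (hv : ∀ s, RVe r (pure ()) fun n _ => (v s n : ℝ)) (hv' : ∀ s, Tendsto (v s) r atTop)
    (h1 : ∀ s : ℕ, H (a₀ * κ ^ s) = H a₀)
    (h2 : ∀ s, ∀ᶠ n : ℕ in r, ∀ t : ℕ, H ((a₀ * κ ^ s + v s n) * κ ^ t) = H (a₀ * κ ^ s + v s n)) :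
    ∀ᶠ s in p, ∀ᶠ n : ℕ in r, H (a₀ * κ ^ s + v s n) = H a₀ := by
  obtain ⟨f, hf, q, hq⟩ := hH
  set K := mkCore hp hr hp' hf hκ ha hv hv' with hK
  set Q := aeval (Phi f κ) q - C (fun _ => H a₀) with hQ
  have hev : ∀ z t, ev z (evalCoeff t Q) =
      ev z (evalCoeff t (aeval (Phi f κ) q)) - H a₀ := fun z t => by
    simp [hQ, ev, evalCoeff]
  have hlim : ∀ a : ℤ, ∀ᶠ t in p, ev (mlim f κ p a) (evalCoeff t Q) = H (a * κ ^ t) - H a₀ := by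
    intro a
    filter_upwards [ev_aeval_Phi a (q := q) fun j _ => run_eventually_eq hf a j] with t ht
    rw [hev, ← ht, ← hq]
  have hy : ∀ j ∈ Q.vars, _ := fun j _ => mlim_eventually_eq_follow hp hr hp' hf hκ ha hv hv' j
  rw [← Finset.eventually_all] at hy
  filter_upwards [hy, K.sign_ev_evalCoeff_eq hp Q] with s h3 h4
  rw [← Finset.eventually_all] at h3
  filter_upwards [h3, h4, h2 s] with n h5 h6 h7
  obtain ⟨t, h8, h9, h10⟩ := (h6.and ((hlim (a₀ * κ ^ s)).and (hlim (a₀ * κ ^ s + v s n)))).exists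
  have hx : K.x s = mlim f κ p (a₀ * κ ^ s) := rfl
  rw [hx, h9, mul_assoc, ← pow_add, h1, sub_self, sign_zero, sign_eq_zero_iff,
    ← ev_evalCoeff_congr h5, h10, h7, sub_eq_zero] at h8
  exact h8

end Main

/-- `Sparse k i j n`: `n` is a sum of `j ≥ 1` distinct numbers `k ^ m!` with `m ≥ i`. -/
inductive Sparse (k : ℕ) : ℕ → ℕ → ℕ → Prop
  | one {i i' : ℕ} : i ≤ i' → Sparse k i 1 (k ^ (i'.factorial))
  | cons {i i' j m : ℕ} : i ≤ i' → Sparse k (i' + 1) j m → Sparse k i (j + 1) (k ^ i'.factorial + m)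

theorem Sparse.mono {k i i₀ j n : ℕ} (h : Sparse k i j n) (hi : i₀ ≤ i) : Sparse k i₀ j n := by
  cases h with
  | one h => exact .one (hi.trans h)
  | cons h h' => exact .cons (hi.trans h) h'

theorem Sparse.append {k i j m : ℕ} (h : Sparse k i j m) :
    ∃ i₁, ∀ j' n, Sparse k i₁ j' n → Sparse k i (j + j') (m + n) := by
  induction h with
  | @one i i' h => exact ⟨i' + 1, fun j' n hn => by simpa [add_comm] using Sparse.cons h hn⟩
  | @cons i i' j m h _ ih =>
    obtain ⟨i₁, hi₁⟩ := ih
    refine ⟨i₁, fun j' n hn => ?_⟩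
    rw [add_right_comm j, add_assoc (k ^ _)]
    exact .cons h (hi₁ j' n hn)

theorem Sparse.pos {k i j n : ℕ} (h : Sparse k i j n) : 1 ≤ j := by
  cases h <;> omega

theorem Sparse.dvd {k i j n : ℕ} (h : Sparse k i j n) : k ^ i.factorial ∣ n := by
  induction h with
  | one h => exact pow_dvd_pow _ (Nat.factorial_le h)
  | cons h _ ih =>
    exact dvd_add (pow_dvd_pow _ (Nat.factorial_le h))
      ((pow_dvd_pow _ (Nat.factorial_le (by omega))).trans ih)

theorem Sparse.lt {k i j n : ℕ} (hk : 2 ≤ k) (h : Sparse k i j n) : i < n := by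
  have h1 : ∀ i i' : ℕ, i ≤ i' → i < k ^ i'.factorial := fun i i' h =>
    (h.trans (Nat.self_le_factorial i')).trans_lt (Nat.lt_pow_self (by omega))
  cases h with
  | one h => exact h1 _ _ h
  | cons h => exact (h1 _ _ h).trans_le (by omega)

theorem exists_isIdem_sparse (k : ℕ) :
    ∃ r : Ultrafilter ℕ, IsIdem r ∧ ∀ i, ∀ᶠ n in r, ∃ j, Sparse k i j n := by
  let _ : AddSemigroup (Ultrafilter ℕ) := Ultrafilter.addSemigroup
  let S : Set (Ultrafilter ℕ) := ⋂ i, { U | ∀ᶠ n in U, ∃ j, Sparse k i j n }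
  have h := exists_idempotent_in_compact_add_subsemigroup ?_ S ?_ ?_ ?_
  · obtain ⟨U, hU, hU'⟩ := h
    refine ⟨U, fun p => ?_, Set.mem_iInter.1 hU⟩
    rw [← Ultrafilter.eventually_add, hU']
  · exact Ultrafilter.continuous_add_left
  · apply IsCompact.nonempty_iInter_of_sequence_nonempty_isCompact_isClosed
    · intro n U hU
      filter_upwards [hU] with m ⟨j, hj⟩ using ⟨j, hj.mono (by omega)⟩
    · exact fun n => ⟨pure _, mem_pure.mpr ⟨1, Sparse.one le_rfl⟩⟩
    · exact (ultrafilter_isClosed_basic _).isCompact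
    · exact fun n => ultrafilter_isClosed_basic _
  · exact IsClosed.isCompact (isClosed_iInter fun i => ultrafilter_isClosed_basic _)
  · intro U hU V hV
    rw [Set.mem_iInter] at *
    intro i
    rw [Set.mem_ofPred_eq, Ultrafilter.eventually_add]
    filter_upwards [hU i] with m ⟨j, hm⟩
    obtain ⟨i₁, hi₁⟩ := hm.append
    filter_upwards [hV i₁] with n ⟨j', hn⟩ using ⟨_, hi₁ j' n hn⟩

theorem exists_pos_iterate_idempotent {S : Type*} [Finite S] (f : S → S) :
    ∃ N, 1 ≤ N ∧ ∀ c φ, 1 ≤ c → (f^[c * N]) φ = (f^[N]) φ := by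
  obtain ⟨a, b, hab, h⟩ := Finite.exists_ne_map_eq_of_infinite fun n : ℕ => f^[n]
  wlog hlt : a < b generalizing a b
  · exact this b a hab.symm h.symm (by omega)
  have h1 : ∀ n, a ≤ n → ∀ c, f^[n + c * (b - a)] = f^[n] := by
    intro n hn c
    induction c with
    | zero => simp
    | succ c ih =>
      have e1 : n + (c + 1) * (b - a) = (n - a + c * (b - a)) + b := by
        rw [add_mul, one_mul]; omega
      have e2 : n + c * (b - a) = (n - a + c * (b - a)) + a := by omega
      rw [e1, Function.iterate_add, ← h, ← Function.iterate_add, ← e2, ih]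
  refine ⟨(a + 1) * (b - a), Nat.mul_pos (by omega) (by omega), fun c φ hc => ?_⟩
  obtain ⟨c, rfl⟩ := Nat.exists_eq_add_of_le' hc
  have h2 : a ≤ (a + 1) * (b - a) := by nlinarith [Nat.sub_pos_of_lt hlt]
  have := h1 _ h2 (c * (a + 1))
  rw [← this]
  congr 2
  ring

/-- A finite family of sequences, indexed by `S` and closed under the sections
`n ↦ φ (b + k * n)`, all of them generalised polynomials in a rescaled variable. -/
structure Aut (k : ℕ) (S : Type) where
  /-- taking sections -/
  T : ℕ → S → S
  /-- the sequence attached to a state -/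
  val : S → ℕ → ℝ
  two_le : 2 ≤ k
  val_T : ∀ b < k, ∀ φ n, val φ (b + k * n) = val (T b φ) n
  val_inj : Function.Injective val
  gp : ∀ φ, ∃ F : (Fin 1 → ℝ) → ℝ, IsGenPoly F ∧ ∃ α β : ℝ, ∀ n : ℕ,
    val φ n = F fun _ => α * n + β

namespace Aut

variable {k : ℕ} {S : Type} (A : Aut k S)

/-- Reading the `s` least significant base `k` digits of `B`. -/
def act : ℕ → ℕ → S → S
  | 0, _, φ => φ
  | s + 1, B, φ => act s (B / k) (A.T (B % k) φ)

theorem pos (A : Aut k S) : 0 < k := by have := A.two_le; omega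

theorem act_zero_left (B : ℕ) (φ : S) : A.act 0 B φ = φ := rfl

theorem act_succ (s B : ℕ) (φ : S) : A.act (s + 1) B φ = A.act s (B / k) (A.T (B % k) φ) := rfl

theorem act_one {b : ℕ} (hb : b < k) (φ : S) : A.act 1 b φ = A.T b φ := by
  rw [act_succ, act_zero_left, Nat.mod_eq_of_lt hb]

theorem act_add (s s' B : ℕ) (φ : S) :
    A.act (s + s') B φ = A.act s' (B / k ^ s) (A.act s B φ) := by
  induction s generalizing B φ with
  | zero => simp [act_zero_left]
  | succ s ih => rw [add_right_comm, act_succ, act_succ, ih, Nat.div_div_eq_div_mul, pow_succ']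

theorem act_add_mul (s B j : ℕ) (φ : S) : A.act s (B + k ^ s * j) φ = A.act s B φ := by
  induction s generalizing B φ with
  | zero => rfl
  | succ s ih =>
    have := A.pos
    rw [act_succ, act_succ, pow_succ', mul_assoc, Nat.add_mul_div_left _ _ this,
      Nat.add_mul_mod_self_left, ih]

theorem act_append {s B : ℕ} (hB : B < k ^ s) (s' B' : ℕ) (φ : S) :
    A.act (s + s') (B + k ^ s * B') φ = A.act s' B' (A.act s B φ) := by
  rw [act_add, act_add_mul, Nat.add_mul_div_left _ _ (Nat.pow_pos A.pos),
    Nat.div_eq_of_lt hB, zero_add]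

theorem act_zero (s : ℕ) (φ : S) : A.act s 0 φ = (A.T 0)^[s] φ := by
  induction s generalizing φ with
  | zero => rfl
  | succ s ih => rw [act_succ, Nat.zero_div, Nat.zero_mod, ih, Function.iterate_succ_apply]

theorem act_pred (s : ℕ) (φ : S) : A.act s (k ^ s - 1) φ = (A.T (k - 1))^[s] φ := by
  have := A.two_le
  induction s generalizing φ with
  | zero => rfl
  | succ s ih =>
    have h : k ^ (s + 1) - 1 = (k - 1) + k ^ 1 * (k ^ s - 1) := by
      have := Nat.pow_pos (n := s) A.pos
      rw [pow_succ', pow_one, Nat.mul_sub, mul_one]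
      have : k ≤ k * k ^ s := Nat.le_mul_of_pos_right _ this
      omega
    rw [h, add_comm s, act_append A (by rw [pow_one]; omega), ih, act_one A (by omega),
      add_comm 1, Function.iterate_succ_apply]

theorem val_act (s B : ℕ) (hB : B < k ^ s) (φ : S) (n : ℕ) :
    A.val φ (B + k ^ s * n) = A.val (A.act s B φ) n := by
  induction s generalizing B φ with
  | zero => obtain rfl : B = 0 := by simpa using hB
            simp [act_zero_left]
  | succ s ih =>
    have h : B + k ^ (s + 1) * n = B % k + k * (B / k + k ^ s * n) := by
      rw [mul_add, ← mul_assoc, ← pow_succ', ← add_assoc, Nat.mod_add_div]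
    rw [act_succ, h, A.val_T _ (Nat.mod_lt _ A.pos), ih]
    rw [Nat.div_lt_iff_lt_mul A.pos, ← pow_succ]
    exact hB

theorem val_eq_zero (φ : S) {s n : ℕ} (hn : n < k ^ s) : A.val φ n = A.val (A.act s n φ) 0 := by
  simpa using A.val_act s n hn φ 0

theorem val_mem (φ : S) (n : ℕ) : A.val φ n ∈ Set.range fun ψ => A.val ψ 0 :=
  ⟨_, (A.val_eq_zero φ (Nat.lt_pow_self A.two_le)).symm⟩

/-- Reading `L` digits at a time. -/
def baseChange {L : ℕ} (hL : 1 ≤ L) : Aut (k ^ L) S where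
  T := A.act L
  val := A.val
  two_le := A.two_le.trans (Nat.le_self_pow (by omega) k)
  val_T b hb φ n := A.val_act L b hb φ n
  val_inj := A.val_inj
  gp := A.gp

end Aut

theorem iterate_succ_of_idem {S : Type*} {f : S → S} (h : ∀ φ, f (f φ) = f φ) (n : ℕ) (φ : S) :
    f^[n + 1] φ = f φ := by
  induction n with
  | zero => rfl
  | succ n ih => rw [Function.iterate_succ_apply', ih, h]

namespace Aut

variable {k : ℕ} {S : Type} (A : Aut k S)

section Stabilised

/-- The action of the digits of `C` followed by a zero. -/
def W (C : ℕ) (φ : S) : S := A.act (C + 1) C φ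

theorem act_add_succ (he : ∀ φ, A.T 0 (A.T 0 φ) = A.T 0 φ) {s C : ℕ} (hC : C < k ^ s)
    (d : ℕ) (φ : S) :
    A.act (s + (d + 1)) C φ = A.T 0 (A.act s C φ) := by
  have := A.act_append hC (d + 1) 0 φ
  rwa [mul_zero, add_zero, act_zero, iterate_succ_of_idem he] at this

theorem W_eq (he : ∀ φ, A.T 0 (A.T 0 φ) = A.T 0 φ) {s C : ℕ} (hC : C < k ^ s) (φ : S) :
    A.W C φ = A.T 0 (A.act s C φ) := by
  have h := A.act_add_succ he (Nat.lt_pow_self A.two_le : C < k ^ C)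
  rw [W, h 0, ← h s, ← A.act_add_succ he hC C]
  congr 1
  omega

theorem T_W (he : ∀ φ, A.T 0 (A.T 0 φ) = A.T 0 φ) (C : ℕ) (φ : S) : A.T 0 (A.W C φ) = A.W C φ := by
  rw [A.W_eq he (Nat.lt_pow_self A.two_le : C < k ^ C), he]

theorem W_zero (φ : S) : A.W 0 φ = A.T 0 φ := by rw [W, act_zero]; rfl

theorem W_append (he : ∀ φ, A.T 0 (A.T 0 φ) = A.T 0 φ) {s N : ℕ} (hN : N < k ^ s) (m : ℕ) (φ : S) :
    A.W (N + k ^ s * m) φ = A.W m (A.act s N φ) := by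
  have hm : m < k ^ m := Nat.lt_pow_self A.two_le
  have h : N + k ^ s * m < k ^ (s + m) := by
    rw [pow_add]
    calc _ < k ^ s + k ^ s * m := by omega
      _ = k ^ s * (m + 1) := by ring
      _ ≤ _ := Nat.mul_le_mul_left _ hm
  rw [A.W_eq he h, A.act_append hN, ← A.W_eq he hm]

theorem W_digit (he : ∀ φ, A.T 0 (A.T 0 φ) = A.T 0 φ) {b : ℕ} (hb : b < k) (m : ℕ) (φ : S) :
    A.W (b + k * m) φ = A.W m (A.T b φ) := by
  have := A.W_append he (s := 1) (N := b) (by simpa using hb) m φ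
  rwa [pow_one, act_one A hb] at this

theorem W_T (he : ∀ φ, A.T 0 (A.T 0 φ) = A.T 0 φ) {m : ℕ} (hm : k ∣ m) (φ : S) :
    A.W m (A.T 0 φ) = A.W m φ := by
  obtain ⟨m, rfl⟩ := hm
  rw [← zero_add (k * m), A.W_digit he A.pos, A.W_digit he A.pos, he]

theorem W_mul (he : ∀ φ, A.T 0 (A.T 0 φ) = A.T 0 φ) (s m : ℕ) {φ : S} (hφ : A.T 0 φ = φ) :
    A.W (k ^ s * m) φ = A.W m φ := by
  rw [← zero_add (k ^ s * m), A.W_append he (Nat.pow_pos A.pos), act_zero,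
    Function.iterate_fixed hφ]

theorem W_add (he : ∀ φ, A.T 0 (A.T 0 φ) = A.T 0 φ) {s N m : ℕ} (hN : N < k ^ s)
    (hm : k ^ (s + 1) ∣ m) (φ : S) : A.W (N + m) φ = A.W m (A.W N φ) := by
  obtain ⟨m, rfl⟩ := hm
  rw [pow_succ, mul_assoc, A.W_append he hN, A.W_mul he _ _ (A.T_W he _ _), A.W_eq he hN,
    A.W_T he (dvd_mul_right _ _)]

end Stabilised

theorem exists_isProg (φ : S) : ∃ h : ℤ → ℝ, IsProg h ∧ ∀ n : ℕ, h n = A.val φ n := by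
  obtain ⟨F, hF, α, β, h⟩ := A.gp φ
  exact ⟨_, hF.isProg α β, fun n => by simp [h]⟩

theorem exists_separating [Finite S] : ∃ M : ℕ, ∀ φ ψ,
    (∀ a < M, A.val φ a = A.val ψ a) → φ = ψ := by
  have h : ∀ x : S × S, ∃ M : ℕ, (∀ a < M, A.val x.1 a = A.val x.2 a) → x.1 = x.2 := by
    intro x
    by_contra! hx
    obtain ⟨-, h1⟩ := hx 0
    exact h1 (A.val_inj (funext fun a => (hx (a + 1)).1 a (by omega)))
  choose M hM using h
  obtain ⟨B, hB⟩ := (Set.finite_range M).bddAbove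
  exact ⟨B, fun φ ψ h => hM (φ, ψ) fun a ha => h a (ha.trans_le (hB ⟨_, rfl⟩))⟩

theorem exists_act_eventually_const [Finite S] {r : Ultrafilter ℕ} (hr : IsIdem r) {I : Type*}
    {u : Ultrafilter I} (base : I → ℤ) (len : I → ℕ)
    (hyp : ∀ C : ℕ, 1 ≤ C → ∀ᶠ n : ℕ in r, ∀ᶠ i in u,
      0 ≤ base i + C * n ∧ base i + C * n < (k : ℤ) ^ len i) :
    ∃ (ψ : S → S) (C0 : ℕ), ∀ C : ℕ, C0 ≤ C → ∀ᶠ n : ℕ in r, ∀ᶠ i in u, ∀ φ,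
      A.act (len i) (base i + C * n).toNat φ = ψ φ := by
  obtain ⟨M, hM⟩ := A.exists_separating
  choose h hh hval using A.exists_isProg
  have key : ∀ (n : ℕ) (i : I) (C : ℕ), 0 ≤ base i + C * n → base i + C * n < (k : ℤ) ^ len i →
      ∀ φ, ∀ a : ℕ, h φ (base i + (k : ℤ) ^ len i * a + C * n) =
        A.val (A.act (len i) (base i + C * n).toNat φ) a := by
    intro n i C h0 h1 φ a
    have e : base i + (k : ℤ) ^ len i * a + C * n =
        (((base i + C * n).toNat + k ^ len i * a : ℕ) : ℤ) := by
      push_cast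
      rw [Int.toNat_of_nonneg h0]
      ring
    rw [e, hval, A.val_act]
    zify
    rwa [Int.toNat_of_nonneg h0]
  have h1 : ∀ φ : S, ∀ a : ℕ, ∃ (w : ℝ) (C0 : ℕ), ∀ C : ℕ, C ≥ C0 → ∀ᶠ n : ℕ in r, ∀ᶠ i in u,
      h φ (base i + (k : ℤ) ^ len i * a + C * n) = w := fun φ a =>
    exists_eventually_const_of_finite hr (hh φ) _ (Set.finite_range fun ψ => A.val ψ 0) fun C hC =>
      eventually₂_mono (hyp C hC) fun n i hi => by
        rw [key n i C hi.1 hi.2]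
        exact A.val_mem _ _
  choose w C0 hw using h1
  obtain ⟨B, hB⟩ := (Set.finite_range fun x : S × Fin M => C0 x.1 x.2).bddAbove
  have h2 : ∀ C : ℕ, B + 1 ≤ C → ∀ᶠ n : ℕ in r, ∀ᶠ i in u, ∀ φ, ∀ a : Fin M,
      A.val (A.act (len i) (base i + C * n).toNat φ) a = w φ a := by
    intro C hC
    have h3 : ∀ᶠ n : ℕ in r, ∀ᶠ i in u, ∀ φ, ∀ a : Fin M,
        h φ (base i + (k : ℤ) ^ len i * (a : ℕ) + C * n) = w φ a := by
      simp only [eventually_all]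
      exact fun φ a => hw φ a C ((hB ⟨(φ, a), rfl⟩).trans (by omega))
    refine eventually₂_mono (eventually₂_and (hyp C (by omega)) h3) fun n i hi φ a => ?_
    rw [← key n i C hi.1.1 hi.1.2, hi.2]
  obtain ⟨n, hn⟩ := (h2 (B + 1) le_rfl).exists
  obtain ⟨i, hi⟩ := hn.exists
  exact ⟨fun φ => A.act (len i) (base i + (B + 1 : ℕ) * n).toNat φ, B + 1, fun C hC =>
    eventually₂_mono (h2 C hC) fun n' i' hi' φ =>
      hM _ _ fun a ha => (hi' φ ⟨a, ha⟩).trans (hi φ ⟨a, ha⟩).symm⟩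

/-- The number whose base `k ^ ℓ` expansion is `ι` digits `b`. -/
def rep (k b ℓ : ℕ) : ℕ → ℕ
  | 0 => 0
  | ι + 1 => b + k ^ ℓ * rep k b ℓ ι

theorem rep_add (b ℓ M ι : ℕ) : rep k b ℓ (M + ι) = rep k b ℓ M + k ^ (ℓ * M) * rep k b ℓ ι := by
  induction M with
  | zero => simp [rep]
  | succ M ih => rw [add_right_comm, rep, ih, rep]; ring

theorem rep_zero_digit (ℓ ι : ℕ) : rep k 0 ℓ ι = 0 := by
  induction ι with
  | zero => rfl
  | succ ι ih => simp [rep, ih]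

theorem rep_add_self_lt {b ℓ : ℕ} (hb : b + 1 < k ^ ℓ) (ι : ℕ) : rep k b ℓ ι + ι < k ^ (ℓ * ι) := by
  induction ι with
  | zero => simp [rep]
  | succ ι ih =>
    rw [rep, mul_add, mul_one, pow_add, mul_comm (k ^ (ℓ * ι))]
    calc _ < k ^ ℓ * (rep k b ℓ ι + ι + 1) := by nlinarith
      _ ≤ _ := Nat.mul_le_mul_left _ ih

/-- The transformation attached to `…bbb + N`. -/
def Lim (b ℓ N : ℕ) (E : S → S) : Prop :=
  ∀ᶠ ι in atTop, ∀ φ, A.act (ℓ * ι) (rep k b ℓ ι + N) φ = E φ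

section Lim

variable {A} {b ℓ : ℕ}

theorem Lim.append {N M C : ℕ} {E : S → S} (h : A.Lim b ℓ N E)
    (hC : rep k b ℓ M + C < k ^ (ℓ * M)) :
    A.Lim b ℓ (C + k ^ (ℓ * M) * N) fun φ => E (A.act (ℓ * M) (rep k b ℓ M + C) φ) := by
  obtain ⟨ι₀, h⟩ := eventually_atTop.1 h
  refine eventually_atTop.2 ⟨M + ι₀, fun ι hι φ => ?_⟩
  obtain ⟨ι, rfl⟩ := Nat.exists_eq_add_of_le (show M ≤ ι by omega)
  simp only
  rw [← h ι (by omega), rep_add, mul_add, ← A.act_append hC]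
  congr 1
  ring

theorem Lim.mul (hD : ∀ φ, A.act ℓ b (A.act ℓ b φ) = A.act ℓ b φ) (hb : b < k ^ ℓ)
    {N : ℕ} {E : S → S} (h : A.Lim b ℓ N E) (t : ℕ) :
    A.Lim b ℓ (k ^ (ℓ * (t + 1)) * N) fun φ => E (A.act ℓ b φ) := by
  have h1 : ∀ {N : ℕ} {E : S → S}, A.Lim b ℓ N E →
      A.Lim b ℓ (k ^ ℓ * N) fun φ => E (A.act ℓ b φ) := by
    intro N E h
    have := h.append (M := 1) (C := 0) (by simpa [rep] using hb)
    simpa [rep] using this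
  induction t with
  | zero => simpa using h1 h
  | succ t ih =>
    have := h1 ih
    simp only [hD] at this
    rwa [← mul_assoc, ← pow_add, show ℓ + ℓ * (t + 1) = ℓ * (t + 1 + 1) by ring] at this

theorem lim_zero (hD : ∀ φ, A.act ℓ b (A.act ℓ b φ) = A.act ℓ b φ) (hb : b < k ^ ℓ) :
    A.Lim b ℓ 0 (A.act ℓ b) := by
  refine eventually_atTop.2 ⟨1, fun ι hι φ => ?_⟩
  obtain ⟨ι, rfl⟩ := Nat.exists_eq_add_of_le' hι
  rw [add_zero]
  clear hι
  induction ι generalizing φ with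
  | zero => simp [rep]
  | succ ι ih =>
    rw [rep, show ℓ * (ι + 1 + 1) = ℓ + ℓ * (ι + 1) by ring, A.act_append hb, ih, hD]

theorem lim_sparse (hD : ∀ φ, A.act ℓ b (A.act ℓ b φ) = A.act ℓ b φ) (hb : b < k ^ ℓ) (hℓ : 1 ≤ ℓ)
    {M C : ℕ} (hC : rep k b ℓ M + C < k ^ (ℓ * M)) {i j n : ℕ} (hi : ℓ * (M + 1) < i)
    (h : Sparse k i j n) (q n' : ℕ) (hq : ℓ * q < i.factorial) (hn : n = k ^ (ℓ * q) * n') :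
    A.Lim b ℓ (C * n') fun φ =>
      (fun ψ => A.act ℓ b (A.act (ℓ * M) (rep k b ℓ M + C) ψ))^[j] (A.act ℓ b φ) := by
  have hk := A.pos
  have key : ∀ i i' q, i ≤ i' → ℓ * q < i.factorial → ℓ * (M + 1) < i →
      ∃ t, i'.factorial = ℓ * (q + (t + 1)) ∧ ℓ * (q + (t + 1) + M) < (i' + 1).factorial := by
    intro i i' q hii hq hi
    obtain ⟨H, hH⟩ : ℓ ∣ i'.factorial := Nat.dvd_factorial hℓ (by nlinarith)
    have h2 := Nat.factorial_le hii
    have h3 : q < H := by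
      by_contra! h
      have := Nat.mul_le_mul_left ℓ h
      omega
    have h4 : i'.factorial = ℓ * (q + (H - q - 1 + 1)) := by rw [hH]; congr 1; omega
    refine ⟨H - q - 1, h4, ?_⟩
    rw [mul_add ℓ, ← h4, Nat.factorial_succ]
    nlinarith [Nat.factorial_pos i']
  induction h generalizing q n' with
  | @one i i' hii =>
    obtain ⟨t, ht, -⟩ := key i i' q hii hq hi
    obtain rfl : n' = k ^ (ℓ * (t + 1)) := by
      rw [ht, mul_add, pow_add] at hn
      exact (Nat.eq_of_mul_eq_mul_left (Nat.pow_pos hk) hn).symm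
    have := ((lim_zero hD hb).append hC).mul hD hb t
    simpa [mul_comm C] using this
  | @cons i i' j m hii hm ih =>
    obtain ⟨t, ht, ht'⟩ := key i i' q hii hq hi
    obtain ⟨m', rfl⟩ := (pow_dvd_pow k ht'.le).trans hm.dvd
    obtain rfl : n' = k ^ (ℓ * (t + 1)) * (1 + k ^ (ℓ * M) * m') := by
      rw [ht] at hn
      refine (Nat.eq_of_mul_eq_mul_left (Nat.pow_pos (n := ℓ * q) hk) ?_).symm
      rw [← hn]
      ring
    have := ((ih (by omega) _ m' ht' rfl).append hC).mul hD hb t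
    rw [show C * (k ^ (ℓ * (t + 1)) * (1 + k ^ (ℓ * M) * m')) =
      k ^ (ℓ * (t + 1)) * (C + k ^ (ℓ * M) * (C * m')) by ring]
    simpa only [Function.iterate_succ_apply] using this

end Lim

end Aut

theorem le_atTop_of_sparse {k : ℕ} (hk : 2 ≤ k) {r : Ultrafilter ℕ}
    (hs : ∀ i, ∀ᶠ n in r, ∃ j, Sparse k i j n) : (r : Filter ℕ) ≤ atTop :=
  tendsto_id'.1 (tendsto_atTop.2 fun i => (hs i).mono fun _ ⟨_, h⟩ => (h.lt hk).le)

theorem eventually_pow_dvd_of_sparse {k : ℕ} {r : Ultrafilter ℕ}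
    (hs : ∀ i, ∀ᶠ n in r, ∃ j, Sparse k i j n) (s : ℕ) : ∀ᶠ n in r, k ^ s ∣ n :=
  (hs s).mono fun _ ⟨_, h⟩ => (pow_dvd_pow k (Nat.self_le_factorial s)).trans h.dvd

namespace Aut

variable {k : ℕ} {S : Type} {A : Aut k S} {r : Ultrafilter ℕ}

theorem exists_center [Finite S] (hr : IsIdem r) (hs : ∀ i, ∀ᶠ n in r, ∃ j, Sparse k i j n)
    {b ℓ : ℕ} (hD : ∀ φ, A.act ℓ b (A.act ℓ b φ) = A.act ℓ b φ) (hb : b + 1 < k ^ ℓ)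
    (hℓ : 1 ≤ ℓ) :
    ∃ E : S → S, ∀ C M, 1 ≤ C → rep k b ℓ M + C < k ^ (ℓ * M) →
      (∀ᶠ n in r, A.Lim b ℓ (C * n) E) ∧ ∃ j, 1 ≤ j ∧ ∀ φ,
        E φ = (fun ψ => A.act ℓ b (A.act (ℓ * M) (rep k b ℓ M + C) ψ))^[j] (A.act ℓ b φ) := by
  have hr' := le_atTop_of_sparse A.two_le hs
  obtain ⟨E, C0, hE⟩ := A.exists_act_eventually_const hr (u := r) (fun ι => (rep k b ℓ ι : ℤ))
    (fun ι => ℓ * ι) (fun C _ => Eventually.of_forall fun n => hr' <|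
      eventually_atTop.2 ⟨C * n, fun ι hι => ⟨by positivity, by
        have := rep_add_self_lt hb ι
        zify at this hι
        linarith⟩⟩)
  refine ⟨E, fun C M hC hM => ?_⟩
  have h1 : ∀ᶠ n in r, ∃ j, 1 ≤ j ∧ A.Lim b ℓ (C * n) E ∧ ∀ φ,
      E φ = (fun ψ => A.act ℓ b (A.act (ℓ * M) (rep k b ℓ M + C) ψ))^[j] (A.act ℓ b φ) := by
    have hC' : C0 ≤ k ^ (ℓ * (C0 + 1)) * C := by
      have h1 : C0 + 1 < k ^ (C0 + 1) := Nat.lt_pow_self A.two_le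
      have h2 : k ^ (C0 + 1) ≤ k ^ (ℓ * (C0 + 1)) := Nat.pow_le_pow_right A.pos (by nlinarith)
      nlinarith
    filter_upwards [hs (ℓ * (M + 1) + 1), hE _ hC'] with n ⟨j, hj⟩ h2
    have h3 := lim_sparse hD (by omega) hℓ hM (by omega) hj 0 n
      (by simpa using Nat.factorial_pos _) (by simp)
    have h4 := h3.mul hD (by omega) C0
    simp only [hD] at h4
    obtain ⟨ι, h5, h6⟩ := (h2.and (hr' h4)).exists
    have h7 : ∀ φ, E φ =
        (fun ψ => A.act ℓ b (A.act (ℓ * M) (rep k b ℓ M + C) ψ))^[j] (A.act ℓ b φ) := by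
      intro φ
      rw [← h5 φ]
      refine Eq.trans ?_ (h6 φ)
      congr 1
      norm_cast
      ring
    exact ⟨j, hj.pos, by rwa [← funext h7] at h3, h7⟩
  obtain ⟨n, j, hj, -, h⟩ := h1.exists
  exact ⟨h1.mono fun n ⟨j, _, h, _⟩ => h, j, hj, h⟩

theorem Lim.eq_W (he : ∀ φ, A.T 0 (A.T 0 φ) = A.T 0 φ) {N : ℕ} {E : S → S} (h : A.Lim 0 1 N E)
    (φ : S) : E φ = A.W N φ := by
  obtain ⟨ι, h1, h2⟩ := (h.and (eventually_ge_atTop (N + 1))).exists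
  obtain ⟨d, rfl⟩ := Nat.exists_eq_add_of_le h2
  have hN : N < k ^ N := Nat.lt_pow_self A.two_le
  rw [← h1, rep_zero_digit, zero_add, one_mul, add_assoc, add_comm 1, A.act_add_succ he hN,
    A.W_eq he hN]

theorem T_act (he : ∀ φ, A.T 0 (A.T 0 φ) = A.T 0 φ) (C : ℕ) :
    (fun ψ => A.act 1 0 (A.act (1 * C) (rep k 0 1 C + C) ψ)) = A.W C := by
  funext φ
  rw [rep_zero_digit, zero_add, one_mul, act_one A A.pos, A.W_eq he (Nat.lt_pow_self A.two_le)]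

theorem rep_zero_digit_add_lt (A : Aut k S) (C : ℕ) : rep k 0 1 C + C < k ^ (1 * C) := by
  rw [rep_zero_digit, zero_add, one_mul]
  exact Nat.lt_pow_self A.two_le

theorem W_sparse (he : ∀ φ, A.T 0 (A.T 0 φ) = A.T 0 φ) {C i j n : ℕ} (hi : C + 1 < i)
    (h : Sparse k i j n) (φ : S) : A.W (C * n) φ = (A.W C)^[j] (A.T 0 φ) := by
  have := lim_sparse (A := A) (b := 0) (ℓ := 1) (by simpa only [act_one A A.pos] using he)
    (by simpa using A.pos) le_rfl (A.rep_zero_digit_add_lt C) (by omega) h 0 n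
    (by simpa using Nat.factorial_pos _) (by simp)
  have := this.eq_W he φ
  rw [← this, T_act he, act_one A A.pos]

/-- The limit `ε` along `r` of the transformations `W n`. -/
structure IsCenter (A : Aut k S) (r : Ultrafilter ℕ) (ε : S → S) : Prop where
  eventually_eq : ∀ C, 1 ≤ C → ∀ᶠ n in r, ∀ φ, A.W (C * n) φ = ε φ
  exists_iterate : ∀ C, 1 ≤ C → ∃ j, 1 ≤ j ∧ ∀ φ, ε φ = (A.W C)^[j] (A.T 0 φ)

theorem exists_isCenter [Finite S] (hr : IsIdem r) (hs : ∀ i, ∀ᶠ n in r, ∃ j, Sparse k i j n)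
    (he : ∀ φ, A.T 0 (A.T 0 φ) = A.T 0 φ) : ∃ ε, A.IsCenter r ε := by
  obtain ⟨E, hE⟩ := exists_center (A := A) hr hs (b := 0) (ℓ := 1)
    (by simpa only [act_one A A.pos] using he) (by have := A.two_le; simp; omega) le_rfl
  refine ⟨E, fun C hC => ?_, fun C hC => ?_⟩
  · exact (hE C C hC (A.rep_zero_digit_add_lt C)).1.mono fun n h φ => (h.eq_W he φ).symm
  · have h1 := (hE C C hC (A.rep_zero_digit_add_lt C)).2
    rw [T_act he] at h1
    simpa only [act_one _ A.pos] using h1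

namespace IsCenter

variable {ε : S → S}

theorem exists_W_eq (h : A.IsCenter r ε) (hs : ∀ i, ∀ᶠ n in r, ∃ j, Sparse k i j n) (s : ℕ) :
    ∃ n, 1 ≤ n ∧ k ^ s ∣ n ∧ ∀ φ, A.W n φ = ε φ := by
  obtain ⟨n, ⟨h1, h2⟩, h3⟩ := (((h.eventually_eq 1 le_rfl).and
    (eventually_pow_dvd_of_sparse hs s)).and
      (le_atTop_of_sparse A.two_le hs (eventually_ge_atTop 1))).exists
  exact ⟨n, h3, h2, by simpa using h1⟩

theorem T_eps (h : A.IsCenter r ε) (he : ∀ φ, A.T 0 (A.T 0 φ) = A.T 0 φ) (φ : S) :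
    A.T 0 (ε φ) = ε φ := by
  obtain ⟨n, hn⟩ := (h.eventually_eq 1 le_rfl).exists
  rw [← hn, A.T_W he]

theorem eps_T (h : A.IsCenter r ε) (he : ∀ φ, A.T 0 (A.T 0 φ) = A.T 0 φ) (φ : S) :
    ε (A.T 0 φ) = ε φ := by
  obtain ⟨j, -, hj⟩ := h.exists_iterate 1 le_rfl
  rw [hj, hj, he]

theorem eps_eps (h : A.IsCenter r ε) (hr : IsIdem r) (hs : ∀ i, ∀ᶠ n in r, ∃ j, Sparse k i j n)
    (he : ∀ φ, A.T 0 (A.T 0 φ) = A.T 0 φ) (φ : S) : ε (ε φ) = ε φ := by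
  have h1 := h.eventually_eq 1 le_rfl
  simp only [one_mul] at h1
  obtain ⟨n, h2, h3⟩ := (h1.and ((hr _).1 h1)).exists
  obtain ⟨m, ⟨h4, h5⟩, h6⟩ := ((h1.and h3).and (eventually_pow_dvd_of_sparse hs (n + 1))).exists
  have h7 := A.W_add he (Nat.lt_pow_self A.two_le) h6 φ
  rw [h5, h2, h4] at h7
  exact h7.symm

theorem W_eps (h : A.IsCenter r ε) (he : ∀ φ, A.T 0 (A.T 0 φ) = A.T 0 φ) (C : ℕ) {φ : S}
    (hφ : A.T 0 φ = φ) : A.W C (ε φ) = ε (A.W C φ) := by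
  rcases Nat.eq_zero_or_pos C with rfl | hC
  · rw [A.W_zero, A.W_zero, h.T_eps he, h.eps_T he]
  · obtain ⟨j, -, hj⟩ := h.exists_iterate C hC
    rw [hj, hj, A.T_W he, hφ, ← Function.iterate_succ_apply, Function.iterate_succ_apply']

theorem T_fixed (h : A.IsCenter r ε) (he : ∀ φ, A.T 0 (A.T 0 φ) = A.T 0 φ) {z : S} (hz : ε z = z) :
    A.T 0 z = z := by
  rw [← hz, h.T_eps he]

theorem eps_W_fixed (h : A.IsCenter r ε) (he : ∀ φ, A.T 0 (A.T 0 φ) = A.T 0 φ) {z : S}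
    (hz : ε z = z) (C : ℕ) : ε (A.W C z) = A.W C z := by
  rw [← h.W_eps he C (h.T_fixed he hz), hz]

theorem W_injOn (h : A.IsCenter r ε) (he : ∀ φ, A.T 0 (A.T 0 φ) = A.T 0 φ) {z z' : S}
    (hz : ε z = z) (hz' : ε z' = z') (C : ℕ) (hC : A.W C z = A.W C z') : z = z' := by
  rcases Nat.eq_zero_or_pos C with rfl | hC0
  · rwa [A.W_zero, A.W_zero, h.T_fixed he hz, h.T_fixed he hz'] at hC
  · obtain ⟨j, hj1, hj⟩ := h.exists_iterate C hC0
    obtain ⟨j, rfl⟩ := Nat.exists_eq_add_of_le' hj1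
    rw [← hz, ← hz', hj, hj, h.T_fixed he hz, h.T_fixed he hz', Function.iterate_succ_apply,
      Function.iterate_succ_apply, hC]

theorem W_surjOn (h : A.IsCenter r ε) (he : ∀ φ, A.T 0 (A.T 0 φ) = A.T 0 φ) {z : S}
    (hz : ε z = z) (C : ℕ) : ∃ z', ε z' = z' ∧ A.W C z' = z := by
  rcases Nat.eq_zero_or_pos C with rfl | hC0
  · exact ⟨z, hz, by rw [A.W_zero, h.T_fixed he hz]⟩
  · obtain ⟨j, hj1, hj⟩ := h.exists_iterate C hC0
    obtain ⟨j, rfl⟩ := Nat.exists_eq_add_of_le' hj1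
    refine ⟨(A.W C)^[j] z, ?_, ?_⟩
    · clear hj hj1
      induction j with
      | zero => exact hz
      | succ j ih =>
        rw [Function.iterate_succ_apply', h.eps_W_fixed he ih]
    · have h1 := hj z
      rw [hz, h.T_fixed he hz, Function.iterate_succ_apply'] at h1
      exact h1.symm

theorem exists_pred [Finite S] (h : A.IsCenter r ε) (hr : IsIdem r)
    (hs : ∀ i, ∀ᶠ n in r, ∃ j, Sparse k i j n) (he : ∀ φ, A.T 0 (A.T 0 φ) = A.T 0 φ)
    (hf : ∀ φ, A.T (k - 1) (A.T (k - 1) φ) = A.T (k - 1) φ) :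
    ∃ κ : S → S, (∀ φ, ε (κ φ) = κ φ) ∧
      ∀ φ C, A.W (C + 1) (κ φ) = ε (A.W C (A.T (k - 1) φ)) := by
  have hk := A.two_le
  have hr' := le_atTop_of_sparse hk hs
  have hεε := h.eps_eps hr hs he
  have hpred : ∀ s C φ, A.W (k ^ (s + 1) * (C + 1) - 1) φ = A.W C (A.T (k - 1) φ) := by
    intro s C φ
    have h1 : 1 ≤ k ^ (s + 1) := Nat.pow_pos A.pos
    rw [show k ^ (s + 1) * (C + 1) - 1 = k ^ (s + 1) - 1 + k ^ (s + 1) * C by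
      rw [mul_add]; omega, A.W_append he (by omega), act_pred, iterate_succ_of_idem hf]
  have h1 : ∀ C, ∀ᶠ n in r, ∀ φ,
      A.W (C + 1) (A.W ((C + 1) * n - 1) φ) = ε (A.W C (A.T (k - 1) φ)) := by
    intro C
    filter_upwards [hs (C + 4), h.eventually_eq (C + 1) (by omega)] with n ⟨j, hj⟩ hn φ
    simp only [W_sparse he (C := C + 1) (by omega) hj] at hn
    rw [← hn, A.T_W he]
    cases hj with
    | @one _ i' hi =>
      obtain ⟨s, hs⟩ : ∃ s, i'.factorial = s + 1 :=
        Nat.exists_eq_succ_of_ne_zero (Nat.factorial_ne_zero i')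
      rw [hs, mul_comm, hpred]
      rfl
    | @cons _ i' j m hi hm =>
      obtain ⟨s, hs⟩ : ∃ s, i'.factorial = s + 1 :=
        Nat.exists_eq_succ_of_ne_zero (Nat.factorial_ne_zero i')
      have hlt : k ^ (s + 1) * (C + 1) - 1 < k ^ (s + 1 + (C + 1)) := by
        rw [pow_add k (s + 1)]
        have := Nat.mul_lt_mul_of_pos_left (Nat.lt_pow_self (n := C + 1) A.two_le)
          (Nat.pow_pos (n := s + 1) A.pos)
        omega
      have hdvd : k ^ (s + 1 + (C + 1) + 1) ∣ (C + 1) * m := by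
        refine Dvd.dvd.mul_left ((pow_dvd_pow k ?_).trans hm.dvd) _
        rw [Nat.factorial_succ, ← hs]
        nlinarith [Nat.factorial_pos i']
      have h0 : 0 < k ^ (s + 1) * (C + 1) := Nat.mul_pos (Nat.pow_pos A.pos) (by omega)
      rw [show (C + 1) * (k ^ i'.factorial + m) - 1 =
        (k ^ (s + 1) * (C + 1) - 1) + (C + 1) * m by rw [hs, mul_add, mul_comm]; omega,
        A.W_add he hlt hdvd, W_sparse he (by omega) hm, hpred, A.T_W he,
        Function.iterate_succ_apply']
  obtain ⟨ψ, C0, hψ⟩ := A.exists_act_eventually_const hr (u := r) (fun _ => (-1 : ℤ)) (fun ι => ι)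
    fun C hC => Eventually.mono (hr' (eventually_ge_atTop 1)) fun n hn => hr' <|
      eventually_atTop.2 ⟨C * n, fun ι hι => by
        have h1 : ι < k ^ ι := Nat.lt_pow_self hk
        have h2 : 1 ≤ C * n := Nat.mul_pos hC hn
        zify at h1 h2 hι
        constructor <;> linarith⟩
  have h2 : ∀ C, C0 ≤ C → ∀ᶠ n : ℕ in r, ∀ φ, A.W (C * n - 1) φ = ψ φ := by
    intro C hC
    filter_upwards [hψ C hC] with n hn φ
    obtain ⟨ι, h1, h2⟩ := (hn.and (hr' (eventually_ge_atTop (C * n - 1 + 1)))).exists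
    obtain ⟨d, rfl⟩ := Nat.exists_eq_add_of_le h2
    have hN : C * n - 1 < k ^ (C * n - 1) := Nat.lt_pow_self A.two_le
    rw [← h1, show (-1 + (C : ℤ) * n).toNat = C * n - 1 by
      have : ((C * n : ℕ) : ℤ) = (C : ℤ) * n := by push_cast; rfl
      omega, add_assoc, add_comm 1, A.act_add_succ he hN, A.W_eq he hN]
  have hψT : ∀ φ, A.T 0 (ψ φ) = ψ φ := by
    intro φ
    obtain ⟨n, hn⟩ := (h2 C0 le_rfl).exists
    rw [← hn, A.T_W he]
  have h3 : ∀ C φ, A.W (C + 1) (ψ φ) = ε (A.W C (A.T (k - 1) φ)) := by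
    intro C φ
    have h0 : C0 ≤ k ^ (C0 + 1) * (C + 1) - 1 := by
      have h1 : C0 + 1 < k ^ (C0 + 1) := Nat.lt_pow_self A.two_le
      have : k ^ (C0 + 1) ≤ k ^ (C0 + 1) * (C + 1) := Nat.le_mul_of_pos_right _ (by omega)
      omega
    have h0' : k ^ (C0 + 1) * (C + 1) - 1 + 1 = k ^ (C0 + 1) * (C + 1) :=
      Nat.sub_add_cancel (Nat.mul_pos (Nat.pow_pos A.pos) (by omega))
    obtain ⟨n, h4, h5⟩ := ((h1 (k ^ (C0 + 1) * (C + 1) - 1)).and (h2 _ (h0.trans (by omega :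
      k ^ (C0 + 1) * (C + 1) - 1 ≤ k ^ (C0 + 1) * (C + 1) - 1 + 1)))).exists
    have h6 := h4 φ
    rwa [h5, h0', A.W_mul he _ _ (hψT φ), hpred, hf] at h6
  refine ⟨fun φ => ε (ψ φ), fun φ => hεε _, fun φ C => ?_⟩
  rw [h.W_eps he _ (hψT φ), h3, hεε]

end IsCenter

end Aut

namespace Aut

variable {k : ℕ} {S : Type} {A : Aut k S} {r : Ultrafilter ℕ}

theorem rep_lt {b ℓ : ℕ} (hb : b < k ^ ℓ) (N : ℕ) : rep k b ℓ N < k ^ (ℓ * N) := by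
  induction N with
  | zero => simp [rep]
  | succ N ih =>
    rw [rep, mul_add, mul_one, pow_add, mul_comm (k ^ (ℓ * N))]
    calc _ < k ^ ℓ * (rep k b ℓ N + 1) := by rw [mul_add]; omega
      _ ≤ _ := Nat.mul_le_mul_left _ ih

theorem act_rep (A : Aut k S) {b ℓ : ℕ} (hb : b < k ^ ℓ) (N : ℕ) (φ : S) :
    A.act (ℓ * N) (rep k b ℓ N) φ = (A.act ℓ b)^[N] φ := by
  induction N generalizing φ with
  | zero => rfl
  | succ N ih =>
    rw [mul_add, mul_one, add_comm, rep, A.act_append hb, ih, Function.iterate_succ_apply]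

namespace IsCenter

variable {ε : S → S}

theorem iterate_W_injOn (h : A.IsCenter r ε) (he : ∀ φ, A.T 0 (A.T 0 φ) = A.T 0 φ)
    (C j : ℕ) {z z' : S}
    (hz : ε z = z) (hz' : ε z' = z') (hC : (A.W C)^[j] z = (A.W C)^[j] z') : z = z' := by
  induction j generalizing z z' with
  | zero => exact hC
  | succ j ih =>
    exact h.W_injOn he hz hz' C (ih (h.eps_W_fixed he hz C) (h.eps_W_fixed he hz' C) hC)

theorem eps_W_eq_iff (h : A.IsCenter r ε) (hr : IsIdem r)
    (hs : ∀ i, ∀ᶠ n in r, ∃ j, Sparse k i j n) (he : ∀ φ, A.T 0 (A.T 0 φ) = A.T 0 φ)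
    (hf : ∀ φ, A.T (k - 1) (A.T (k - 1) φ) = A.T (k - 1) φ)
    (w : ℕ) {b ℓ : ℕ} (hb : b + 1 < k ^ ℓ) (hℓ : 1 ≤ ℓ) {E : S → S}
    (hE : ∀ C M, 1 ≤ C → rep k b ℓ M + C < k ^ (ℓ * M) → ∃ j, 1 ≤ j ∧ ∀ φ,
      E φ = (fun ψ => A.act ℓ b (A.act (ℓ * M) (rep k b ℓ M + C) ψ))^[j] (A.act ℓ b φ))
    {x y : S} (hx : A.act ℓ b x = x) (hy : A.act ℓ b y = y) :
    ε (A.W w x) = ε (A.W w y) ↔ E x = E y := by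
  have hk := A.pos
  have hεε := h.eps_eps hr hs he
  obtain ⟨m, hm1, hm, hmε⟩ := h.exists_W_eq hs (w + 1)
  set N := w + m
  have hN : ∀ φ, A.W N φ = ε (A.W w φ) := fun φ => by
    rw [A.W_add he (Nat.lt_pow_self A.two_le) hm, hmε]
  have hNlt : N < k ^ N := Nat.lt_pow_self A.two_le
  set p := k ^ (ℓ * (N + 1)) with hp
  have hNp : N < p := hNlt.trans_le (Nat.pow_le_pow_right hk (by nlinarith))
  set Y := N + p * (k ^ ℓ - 1)
  have hpow : k ^ (ℓ * (N + 1 + 1)) = p * (k ^ ℓ - 1) + p := by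
    rw [mul_add ℓ (N + 1), mul_one, pow_add, Nat.mul_sub, mul_one, Nat.sub_add_cancel]
    exact Nat.le_mul_of_pos_right _ (Nat.pow_pos hk)
  have hrep : rep k b ℓ (N + 1 + 1) < Y := by
    have h1 := rep_lt (by omega : b < k ^ ℓ) (N + 1)
    have h2 : p * (b + 1) ≤ p * (k ^ ℓ - 1) := Nat.mul_le_mul_left _ (by omega)
    rw [rep_add, ← hp, show rep k b ℓ 1 = b by simp [rep]]
    rw [mul_add] at h2
    omega
  have hact : ∀ φ, A.act (ℓ * (N + 1 + 1)) Y φ = A.T (k - 1) (ε (A.W w φ)) := by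
    intro φ
    obtain ⟨ℓ, rfl⟩ := Nat.exists_eq_add_of_le' hℓ
    obtain ⟨d, hd⟩ : ∃ d, (ℓ + 1) * (N + 1) = N + (d + 1) := ⟨ℓ * (N + 1), by ring⟩
    rw [mul_add _ (N + 1), mul_one, A.act_append hNp, act_pred, iterate_succ_of_idem hf, hd,
      A.act_add_succ he hNlt, ← A.W_eq he hNlt, hN]
  obtain ⟨j, hj1, hj⟩ := hE (Y - rep k b ℓ (N + 1 + 1)) (N + 1 + 1) (by omega) (by omega)
  rw [Nat.add_sub_cancel' hrep.le] at hj
  simp only [hact] at hj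
  constructor
  · intro hw
    obtain ⟨j, rfl⟩ := Nat.exists_eq_add_of_le' hj1
    rw [hj, hj, hx, hy, Function.iterate_succ_apply, Function.iterate_succ_apply, hw]
  · intro hxy
    set C := k - 1 + k * (b + k ^ ℓ * w)
    have hG : ∀ z, ε z = z → ε (A.W w (A.act ℓ b (A.T (k - 1) z))) = A.W C z := by
      intro z hz
      rw [← A.W_append he (by omega : b < k ^ ℓ), ← A.W_digit he (by omega : k - 1 < k),
        h.eps_W_fixed he hz]
    have hit : ∀ j x, ε (A.W w ((fun ψ => A.act ℓ b (A.T (k - 1) (ε (A.W w ψ))))^[j] x)) =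
        (A.W C)^[j] (ε (A.W w x)) := by
      intro j x
      induction j generalizing x with
      | zero => rfl
      | succ j ih => rw [Function.iterate_succ_apply, Function.iterate_succ_apply, ih, hG _ (hεε _)]
    rw [hj, hj, hx, hy] at hxy
    refine h.iterate_W_injOn he C j (hεε _) (hεε _) ?_
    rw [← hit, ← hit, hxy]

theorem val_eps (h : A.IsCenter r ε) (hs : ∀ i, ∀ᶠ n in r, ∃ j, Sparse k i j n)
    (he : ∀ φ, A.T 0 (A.T 0 φ) = A.T 0 φ) (n : ℕ) (φ : S) :
    ∀ᶠ m in r, A.val φ (n + m) = A.val (ε (A.W n φ)) 0 := by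
  filter_upwards [h.eventually_eq 1 le_rfl, eventually_pow_dvd_of_sparse hs (n + 1)] with m h1 h2
  rw [one_mul] at h1
  rw [← h1, ← A.W_add he (Nat.lt_pow_self A.two_le) h2, W, ← A.val_eq_zero]
  exact (Nat.lt_pow_self A.two_le).trans (Nat.pow_lt_pow_succ A.two_le)

variable [Finite S]

theorem eps_W_eq_of_fixed (h : A.IsCenter r ε) (hr : IsIdem r)
    (hs : ∀ i, ∀ᶠ n in r, ∃ j, Sparse k i j n) (he : ∀ φ, A.T 0 (A.T 0 φ) = A.T 0 φ)
    (hf : ∀ φ, A.T (k - 1) (A.T (k - 1) φ) = A.T (k - 1) φ)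
    {b ℓ : ℕ} (hD : ∀ φ, A.act ℓ b (A.act ℓ b φ) = A.act ℓ b φ)
    (hb : b < k ^ ℓ) (hℓ : 1 ≤ ℓ) {x y : S} (hx : A.act ℓ b x = x) (hy : A.act ℓ b y = y)
    {w w' : ℕ} (hw : ε (A.W w x) = ε (A.W w y)) : ε (A.W w' x) = ε (A.W w' y) := by
  rcases Nat.lt_or_ge (b + 1) (k ^ ℓ) with hb' | hb'
  · obtain ⟨E, hE⟩ := exists_center hr hs hD hb' hℓ
    have h1 := fun w => h.eps_W_eq_iff hr hs he hf w hb' hℓ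
      (fun C M h1 h2 => (hE C M h1 h2).2) hx hy
    exact (h1 w').2 ((h1 w).1 hw)
  · obtain ⟨ℓ, rfl⟩ := Nat.exists_eq_add_of_le' hℓ
    obtain rfl : b = k ^ (ℓ + 1) - 1 := by omega
    rw [act_pred, iterate_succ_of_idem hf] at hx hy
    obtain ⟨κ, hκ, hκ'⟩ := h.exists_pred hr hs he hf
    have h1 : κ x = κ y := h.W_injOn he (hκ x) (hκ y) (w + 1) (by rw [hκ', hκ', hx, hy, hw])
    rw [← hx, ← hy, ← hκ', ← hκ', h1]

theorem eps_W_eq_of_modEq (h : A.IsCenter r ε) (hr : IsIdem r)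
    (hs : ∀ i, ∀ᶠ n in r, ∃ j, Sparse k i j n) (he : ∀ φ, A.T 0 (A.T 0 φ) = A.T 0 φ)
    (hf : ∀ φ, A.T (k - 1) (A.T (k - 1) φ) = A.T (k - 1) φ)
    {x y : S} {w w' : ℕ} (hww : w ≡ w' [MOD k ^ Nat.card (S × S)])
    (hw : ε (A.W w x) = ε (A.W w y)) : ε (A.W w' x) = ε (A.W w' y) := by
  have hk := A.pos
  obtain ⟨t, t', htt, h1⟩ : ∃ t t' : Fin (Nat.card (S × S) + 1), t < t' ∧
      (A.act t w x, A.act t w y) = (A.act t' w x, A.act t' w y) := by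
    have := Fintype.ofFinite (S × S)
    obtain ⟨t, t', hne, h1⟩ := Fintype.exists_ne_map_eq_of_card_lt
      (fun t : Fin (Nat.card (S × S) + 1) => (A.act t w x, A.act t w y)) (by simp)
    rcases lt_or_gt_of_ne hne with h | h
    exacts [⟨t, t', h, h1⟩, ⟨t', t, h, h1.symm⟩]
  obtain ⟨t, ht⟩ := t
  obtain ⟨t', ht'⟩ := t'
  rw [Fin.mk_lt_mk] at htt
  obtain ⟨ℓ, rfl⟩ : ∃ ℓ, t' = t + (ℓ + 1) := ⟨t' - t - 1, by omega⟩
  simp only [Prod.mk.injEq, A.act_add t] at h1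
  have hmod : w % k ^ t = w' % k ^ t := hww.of_dvd (pow_dvd_pow k (by omega))
  have hsplit : ∀ v φ, A.W v φ = A.W (v / k ^ t) (A.act t v φ) := by
    intro v φ
    conv_lhs => rw [← Nat.mod_add_div v (k ^ t)]
    rw [A.W_append he (Nat.mod_lt _ (Nat.pow_pos hk)), ← A.act_add_mul _ _ (v / k ^ t),
      Nat.mod_add_div]
  have hact : ∀ φ, A.act t w' φ = A.act t w φ := by
    intro φ
    rw [← Nat.mod_add_div w (k ^ t), ← Nat.mod_add_div w' (k ^ t), act_add_mul, act_add_mul, hmod]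
  rw [hsplit w, hsplit w] at hw
  rw [hsplit w', hsplit w', hact, hact]
  set v := w / k ^ t % k ^ (ℓ + 1) with hv
  have hv' : v < k ^ (ℓ + 1) := Nat.mod_lt _ (Nat.pow_pos hk)
  have hvact : ∀ φ, A.act (ℓ + 1) (w / k ^ t) φ = A.act (ℓ + 1) v φ := by
    intro φ
    conv_lhs => rw [← Nat.mod_add_div (w / k ^ t) (k ^ (ℓ + 1)), act_add_mul]
  obtain ⟨N, hN1, hN⟩ := exists_pos_iterate_idempotent (A.act (ℓ + 1) v)
  refine h.eps_W_eq_of_fixed hr hs he hf (b := rep k v (ℓ + 1) N) (ℓ := (ℓ + 1) * N) ?_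
    (rep_lt hv' N) (Nat.mul_pos (by omega) hN1) ?_ ?_ hw
  · intro φ
    rw [A.act_rep hv', A.act_rep hv', ← Function.iterate_add_apply, ← two_mul, hN 2 _ (by omega)]
  · rw [A.act_rep hv']
    exact Function.iterate_fixed (by rw [← hvact]; exact h1.1.symm) N
  · rw [A.act_rep hv']
    exact Function.iterate_fixed (by rw [← hvact]; exact h1.2.symm) N

theorem W_eq_eps_W_of_modEq (h : A.IsCenter r ε) (hr : IsIdem r)
    (hs : ∀ i, ∀ᶠ n in r, ∃ j, Sparse k i j n) (he : ∀ φ, A.T 0 (A.T 0 φ) = A.T 0 φ)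
    (hf : ∀ φ, A.T (k - 1) (A.T (k - 1) φ) = A.T (k - 1) φ)
    {z φ : S} (hz : ε z = z) {n n' : ℕ}
    (hnn : n ≡ n' [MOD k ^ (Nat.card (S × S) + 1)]) (hn : A.W n z = ε (A.W (n + 1) φ)) :
    A.W n' z = ε (A.W (n' + 1) φ) := by
  have hk := A.two_le
  have hmod : n % k = n' % k := hnn.of_dvd (dvd_pow_self k (by omega))
  have hdiv : n / k ≡ n' / k [MOD k ^ Nat.card (S × S)] := by
    rw [Nat.ModEq, ← Nat.mod_mul_right_div_self, ← Nat.mod_mul_right_div_self, ← pow_succ', hnn]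
  have hlt := Nat.mod_lt n A.pos
  rw [← h.eps_W_fixed he hz] at hn ⊢
  rcases Nat.lt_or_ge (n % k + 1) k with hu | hu
  · have key : ∀ m, m % k = n % k → (ε (A.W m z) = ε (A.W (m / k) (A.T (n % k) z)) ∧
        ε (A.W (m + 1) φ) = ε (A.W (m / k) (A.T (n % k + 1) φ))) := by
      intro m hm
      rw [← A.W_digit he hlt, ← A.W_digit he hu, ← hm, add_right_comm, Nat.mod_add_div]
      exact ⟨rfl, rfl⟩
    rw [(key n rfl).1, (key n rfl).2] at hn
    rw [(key n' hmod.symm).1, (key n' hmod.symm).2]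
    exact h.eps_W_eq_of_modEq hr hs he hf hdiv hn
  · obtain ⟨κ, hκ, hκ'⟩ := h.exists_pred hr hs he hf
    have key : ∀ m, m % k = n % k → (ε (A.W m z) = A.W (m / k + 1) (κ z) ∧
        ε (A.W (m + 1) φ) = A.W (m / k + 1) (ε φ)) := by
      intro m hm
      have h1 : m = k - 1 + k * (m / k) := by
        conv_lhs => rw [← Nat.mod_add_div m k]
        omega
      have h2 : m + 1 = 0 + k * (m / k + 1) := by rw [mul_add]; omega
      constructor
      · rw [hκ', ← A.W_digit he (by omega : k - 1 < k), ← h1]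
      · rw [h2, A.W_digit he A.pos, ← h.W_eps he _ (he φ), h.eps_T he]
    rw [(key n rfl).1, (key n rfl).2] at hn
    rw [(key n' hmod.symm).1, (key n' hmod.symm).2, h.W_injOn he (hκ z) (h.eps_eps hr hs he φ) _ hn]

theorem exists_period (h : A.IsCenter r ε) (hr : IsIdem r)
    (hs : ∀ i, ∀ᶠ n in r, ∃ j, Sparse k i j n) (he : ∀ φ, A.T 0 (A.T 0 φ) = A.T 0 φ)
    (hf : ∀ φ, A.T (k - 1) (A.T (k - 1) φ) = A.T (k - 1) φ) :
    ∃ n₀ d, 0 < d ∧ ∀ n, n₀ ≤ n → ∀ φ, ε (A.W (n + d) φ) = ε (A.W n φ) := by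
  have hεε := h.eps_eps hr hs he
  set p := k ^ (Nat.card (S × S) + 1)
  have hp : 0 < p := Nat.pow_pos A.pos
  obtain ⟨a, b, hab, hW⟩ : ∃ a b, a < b ∧ A.W (p * a) = A.W (p * b) := by
    obtain ⟨a, b, hne, hW⟩ := Finite.exists_ne_map_eq_of_infinite fun a => A.W (p * a)
    rcases lt_or_gt_of_ne hne with h | h
    exacts [⟨a, b, h, hW⟩, ⟨b, a, h, hW.symm⟩]
  have hmod : ∀ n, n ≡ n + p * (b - a) [MOD p] := fun n => by simp [Nat.ModEq]
  have h1 : ∀ n, p * a ≤ n → ∀ z, ε z = z → A.W (n + p * (b - a)) z = A.W n z := by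
    intro n hn
    induction n, hn using Nat.le_induction with
    | base =>
      intro z _
      rw [← mul_add, Nat.add_sub_cancel' hab.le, hW]
    | succ n _ ih =>
      intro z hz
      obtain ⟨z', hz', hzz⟩ := h.W_surjOn he (h.eps_W_fixed he hz (n + 1)) n
      have h2 := h.W_eq_eps_W_of_modEq hr hs he hf (φ := z) hz' (hmod n)
        (by rw [hzz, h.eps_W_fixed he hz])
      rw [ih z' hz', hzz, h.eps_W_fixed he hz] at h2
      rw [h2, add_right_comm]
  refine ⟨p * a + 1, p * (b - a), Nat.mul_pos hp (by omega), fun n hn φ => ?_⟩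
  obtain ⟨n, rfl⟩ := Nat.exists_eq_add_of_le' (show 1 ≤ n by omega)
  obtain ⟨z', hz', hzz⟩ := h.W_surjOn he (hεε (A.W (n + 1) φ)) n
  have h2 := h.W_eq_eps_W_of_modEq hr hs he hf (φ := φ) hz' (hmod n) hzz
  rw [add_right_comm, ← h2, h1 n (by omega) z' hz', hzz]

end IsCenter

end Aut

namespace Aut

variable {k : ℕ} {S : Type} {r : Ultrafilter ℕ}

theorem val_add_eventually_eq_of_fixed (A : Aut k S) (hr : IsIdem r)
    (hs : ∀ i, ∀ᶠ n in r, ∃ j, Sparse k i j n) {ℓ N : ℕ} (hℓ : 1 ≤ ℓ) (hN : 1 ≤ N) {ψ : S}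
    (hψ : A.act ℓ (N % k ^ ℓ) ψ = ψ) (q : ℕ) :
    ∀ᶠ m in r, A.val ψ (N + m / k ^ q) = A.val ψ N := by
  have hr' := le_atTop_of_sparse A.two_le hs
  set b := N % k ^ ℓ
  set κ := k ^ ℓ with hκ'
  have hκ : 2 ≤ κ := A.two_le.trans (Nat.le_self_pow (by omega) k)
  have hb : b < κ := Nat.mod_lt _ (by omega)
  have hval : ∀ a, A.val ψ (b + κ * a) = A.val ψ a := fun a => by rw [A.val_act ℓ b hb, hψ]
  obtain ⟨F, hF, α, β, hgp⟩ := A.gp ψ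
  have hκ1 : (κ : ℝ) - 1 ≠ 0 := by
    have : (2 : ℝ) ≤ κ := by exact_mod_cast hκ
    intro h
    linarith
  set H : ℤ → ℝ := fun x => F fun _ => α / (κ - 1) * x + (β - α / (κ - 1) * b) with hHdef
  have hH : IsProg H := hF.isProg _ _
  have hHval : ∀ n : ℕ, H ((κ - 1) * n + b) = A.val ψ n := by
    intro n
    rw [hgp, hHdef]
    change F _ = F _
    congr 1
    funext _
    push_cast
    field_simp
    ring
  have hHmul : ∀ t n : ℕ, H (((κ - 1) * n + b) * κ ^ t) = A.val ψ n := by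
    intro t
    induction t with
    | zero => simpa using hHval
    | succ t ih =>
      intro n
      rw [← hval n, ← ih]
      congr 1
      push_cast
      ring
  have hadd : ∀ s m : ℕ, ((κ - 1) * N + b : ℤ) * κ ^ s + (κ - 1) * κ ^ s * (m / k ^ q : ℕ) =
      ((κ - 1) * (N + m / k ^ q : ℕ) + b) * κ ^ s := fun s m => by push_cast; ring
  have hpos : 0 < ((κ - 1) * N + b : ℤ) := by
    have h1 : (0 : ℤ) < (κ - 1) * N := by
      apply mul_pos
      · have : (2 : ℤ) ≤ κ := by exact_mod_cast hκ
        linarith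
      · exact_mod_cast hN
    positivity
  have hmain := hH.eventually_eq (κ := κ) hr hr hr' hκ hpos
    (v := fun s m => (κ - 1) * κ ^ s * (m / k ^ q : ℕ)) (fun s => by
      refine ((RVe.natCast (r := r) (u := pure ())).smul
        fun _ => ((κ : ℝ) - 1) * κ ^ s / k ^ q).congr hr ?_
      filter_upwards [eventually_pow_dvd_of_sparse hs q] with m hm
      refine Eventually.of_forall fun _ => ?_
      have : (k : ℝ) ≠ 0 := by exact_mod_cast A.pos.ne'
      obtain ⟨c, rfl⟩ := hm
      rw [Nat.mul_div_cancel_left c (Nat.pow_pos A.pos)]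
      push_cast
      field_simp) (fun s => by
      have h1 : Tendsto (fun m : ℕ => ((m / k ^ q : ℕ) : ℤ)) r atTop :=
        tendsto_natCast_atTop_atTop.comp
          ((Nat.tendsto_div_const_atTop (Nat.pow_pos A.pos).ne').mono_left hr')
      refine h1.const_mul_atTop' ?_
      have : (2 : ℤ) ≤ κ := by exact_mod_cast hκ
      have : (0 : ℤ) < κ - 1 := by linarith
      positivity) (fun s => by rw [hHmul, hHval]) (fun s => Eventually.of_forall fun m t => by
        rw [hadd, mul_assoc, ← pow_add, hHmul, hHmul])
  obtain ⟨s, h1⟩ := hmain.exists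
  filter_upwards [h1] with m hm
  rwa [hadd, hHmul, hHval] at hm

theorem val_add_eventually_eq [Finite S] (A : Aut k S) (hr : IsIdem r)
    (hs : ∀ i, ∀ᶠ n in r, ∃ j, Sparse k i j n) {n : ℕ} (hn : k ^ Nat.card S ≤ n) (φ : S) :
    ∀ᶠ m in r, A.val φ (n + m) = A.val φ n := by
  obtain ⟨t, t', htt, h1⟩ : ∃ t t' : Fin (Nat.card S + 1), t < t' ∧
      A.act t n φ = A.act t' n φ := by
    have := Fintype.ofFinite S
    obtain ⟨t, t', hne, h1⟩ := Fintype.exists_ne_map_eq_of_card_lt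
      (fun t : Fin (Nat.card S + 1) => A.act t n φ) (by simp)
    rcases lt_or_gt_of_ne hne with h | h
    exacts [⟨t, t', h, h1⟩, ⟨t', t, h, h1.symm⟩]
  obtain ⟨t, ht⟩ := t
  obtain ⟨t', ht'⟩ := t'
  rw [Fin.mk_lt_mk] at htt
  obtain ⟨ℓ, rfl⟩ : ∃ ℓ, t' = t + (ℓ + 1) := ⟨t' - t - 1, by omega⟩
  simp only [A.act_add t] at h1
  have hpos : 0 < k ^ t := Nat.pow_pos A.pos
  have hN : 1 ≤ n / k ^ t :=
    (Nat.one_le_div_iff hpos).2 ((Nat.pow_le_pow_right A.pos (by omega)).trans hn)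
  have h2 := A.val_add_eventually_eq_of_fixed hr hs (ℓ := ℓ + 1) (by omega) hN
    (ψ := A.act t n φ) (by
      conv_rhs => rw [h1, ← Nat.mod_add_div (n / k ^ t) (k ^ (ℓ + 1)), act_add_mul]) t
  have hval : ∀ a, A.val φ (n % k ^ t + k ^ t * a) = A.val (A.act t n φ) a := by
    intro a
    rw [A.val_act _ _ (Nat.mod_lt _ hpos)]
    conv_rhs => rw [← Nat.mod_add_div n (k ^ t), act_add_mul]
  filter_upwards [h2, eventually_pow_dvd_of_sparse hs t] with m hm ⟨m', hm'⟩
  subst hm'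
  rw [Nat.mul_div_cancel_left _ hpos] at hm
  rw [← hval, ← hval, mul_add, ← add_assoc, Nat.mod_add_div] at hm
  exact hm

theorem ultimately_periodic_of_idempotent [Finite S] (A : Aut k S)
    (he : ∀ φ, A.T 0 (A.T 0 φ) = A.T 0 φ)
    (hf : ∀ φ, A.T (k - 1) (A.T (k - 1) φ) = A.T (k - 1) φ) (φ : S) :
    ∃ n₀ d, 0 < d ∧ ∀ n, n₀ ≤ n → A.val φ (n + d) = A.val φ n := by
  obtain ⟨r, hr, hs⟩ := exists_isIdem_sparse k
  obtain ⟨ε, hε⟩ := A.exists_isCenter hr hs he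
  obtain ⟨n₀, d, hd, h⟩ := hε.exists_period hr hs he hf
  have key : ∀ n, k ^ Nat.card S ≤ n → A.val φ n = A.val (ε (A.W n φ)) 0 := fun n hn => by
    obtain ⟨m, h1, h2⟩ := ((A.val_add_eventually_eq hr hs hn φ).and (hε.val_eps hs he n φ)).exists
    rw [← h1, h2]
  exact ⟨n₀ + k ^ Nat.card S, d, hd, fun n hn => by
    rw [key _ (by omega), key _ (by omega), h n (by omega)]⟩

theorem ultimately_periodic [Finite S] (A : Aut k S) (φ : S) :
    ∃ n₀ d, 0 < d ∧ ∀ n, n₀ ≤ n → A.val φ (n + d) = A.val φ n := by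
  obtain ⟨N, hN1, hN⟩ := exists_pos_iterate_idempotent (A.T 0)
  obtain ⟨M, hM1, hM⟩ := exists_pos_iterate_idempotent (A.T (k - 1))
  refine (A.baseChange (Nat.mul_pos hM1 hN1)).ultimately_periodic_of_idempotent ?_ ?_ φ
  · intro ψ
    change A.act _ _ (A.act _ _ ψ) = A.act _ _ ψ
    rw [act_zero, act_zero, ← Function.iterate_add_apply, ← add_mul, hN _ _ (by omega),
      hN _ _ (by omega)]
  · intro ψ
    change A.act _ _ (A.act _ _ ψ) = A.act _ _ ψ
    rw [act_pred, act_pred, ← Function.iterate_add_apply, mul_comm, ← add_mul, hM _ _ (by omega),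
      hM _ _ (by omega)]

end Aut

section Construction

variable {k : ℕ} {Q : Type} (st : Q → ℕ → Q) (τ : Q → ℝ)

/-- The output of the automaton started in the state `q`, with prescribed value at zero. -/
def output (k : ℕ) (q : Q) (a : Q) (n : ℕ) : ℝ :=
  if n = 0 then τ a else τ ((Nat.digits k n).foldl st q)

theorem exists_output_section (hk : 2 ≤ k) {b : ℕ} (hb : b < k) (q a : Q) :
    ∃ q' a', (fun n => output st τ k q a (b + k * n)) = output st τ k q' a' := by
  have hd : ∀ n, b ≠ 0 ∨ n ≠ 0 → output st τ k q a (b + k * n) =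
      τ ((Nat.digits k n).foldl st (st q b)) := by
    intro n hn
    rw [output, if_neg, Nat.digits_add k (by omega) b n hb hn, List.foldl_cons]
    rcases hn with hn | hn
    · omega
    · have := Nat.mul_pos (by omega : 0 < k) (Nat.pos_of_ne_zero hn)
      omega
  by_cases h : b = 0
  · refine ⟨st q b, a, funext fun n => ?_⟩
    by_cases hn : n = 0
    · simp [output, h, hn]
    · rw [hd n (.inr hn), output, if_neg hn]
  · refine ⟨st q b, st q b, funext fun n => ?_⟩
    rw [hd n (.inl h), output]
    split_ifs with hn
    · simp [hn]
    · rfl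

/-- The generalised polynomial outputs of an automaton. -/
def outputs (k : ℕ) : Set (ℕ → ℝ) :=
  {φ | (∃ q a, φ = output st τ k q a) ∧ ∃ F : (Fin 1 → ℝ) → ℝ, IsGenPoly F ∧
    ∃ α β : ℝ, ∀ n : ℕ, φ n = F fun _ => α * n + β}

theorem finite_outputs [Finite Q] : (outputs st τ k).Finite :=
  (Set.finite_range fun x : Q × Q => output st τ k x.1 x.2).subset
    fun _ ⟨⟨q, a, h⟩, _⟩ => ⟨(q, a), h.symm⟩

theorem section_mem_outputs (hk : 2 ≤ k) {b : ℕ} (hb : b < k) {φ : ℕ → ℝ}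
    (hφ : φ ∈ outputs st τ k) : (fun n => φ (b + k * n)) ∈ outputs st τ k := by
  obtain ⟨⟨q, a, rfl⟩, F, hF, α, β, h⟩ := hφ
  refine ⟨exists_output_section st τ hk hb q a, F, hF, α * k, α * b + β, fun n => ?_⟩
  change output st τ k q a (b + k * n) = _
  rw [h]
  congr 1
  funext _
  push_cast
  ring

/-- The family of all outputs of an automaton which are generalised polynomials. -/
def outputAut (hk : 2 ≤ k) : Aut k (outputs st τ k) where
  T b φ := if hb : b < k then ⟨_, section_mem_outputs st τ hk hb φ.2⟩ else φ
  val φ := φ.1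
  two_le := hk
  val_T b hb φ n := by rw [dif_pos hb]
  val_inj := Subtype.val_injective
  gp φ := φ.2.2

end Construction

theorem ultimately_periodic_of_isGenPolyNat_of_isKAutomatic {g : ℕ → ℝ} (h1 : IsGenPolyNat g)
    {k : ℕ}
    (hk : 2 ≤ k) (h2 : IsKAutomatic k g) :
    ∃ n₀ d : ℕ, 0 < d ∧ ∀ n : ℕ, n₀ ≤ n → g (n + d) = g n := by
  obtain ⟨Q, _, q, δ, τ, hg⟩ := h2
  obtain ⟨F, hF, hgF⟩ := h1
  set st : Q → ℕ → Q := fun s a => if h : a < k then δ s ⟨a, h⟩ else s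
  have hmem : g ∈ outputs st τ k := by
    refine ⟨⟨q, q, funext fun n => ?_⟩, F, hF, 1, 0, fun n => by simp [hgF]⟩
    rw [output]
    split_ifs with hn
    · simp [hg, hn]
    · exact hg n
  have := (finite_outputs (k := k) st τ).to_subtype
  exact (outputAut st τ hk).ultimately_periodic ⟨g, hmem⟩

end GenPolyAut

/-- A sequence which is both a generalised polynomial and automatic
is ultimately periodic. -/
theorem genPoly_automatic_ultimately_periodic (g : ℕ → ℝ)
    (h1 : IsGenPolyNat g) (h2 : IsAutomatic g) :
    ∃ (n0 d : ℕ), 0 < d ∧ ∀ n : ℕ, n0 ≤ n → g (n + d) = g n := by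
  obtain ⟨k, hk, hg⟩ := h2
  exact GenPolyAut.ultimately_periodic_of_isGenPolyNat_of_isKAutomatic h1 hk hg
end

section
/- Let p be an ultrafilter on ℕ, let (x_i)_{i∈ℕ} be a bounded sequence in ℝ^d, and let h : ℝ^d × ℕ → ℝ be the restriction of a generalised polynomial ℝ^{d+1} → ℝ. Suppose g : ℕ → ℝ satisfies: for every n ∈ ℕ, the sequence i ↦ h(x_i, n) converges to g(n) along p. Then g is a generalised polynomial on ℕ. -/
open Filter Topology

namespace IsGenPolyNat

variable {f g : ℕ → ℝ}

lemma const (c : ℝ) : IsGenPolyNat (fun _ => c) := ⟨_, .const c, fun _ => rfl⟩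

lemma natCast : IsGenPolyNat (fun n => (n : ℝ)) := ⟨_, .coord 0, fun _ => rfl⟩

lemma add (hf : IsGenPolyNat f) (hg : IsGenPolyNat g) : IsGenPolyNat (fun n => f n + g n) := by
  obtain ⟨F, hF, hF'⟩ := hf
  obtain ⟨G, hG, hG'⟩ := hg
  exact ⟨_, hF.add hG, fun n => by simp only [hF', hG']⟩

lemma mul (hf : IsGenPolyNat f) (hg : IsGenPolyNat g) : IsGenPolyNat (fun n => f n * g n) := by
  obtain ⟨F, hF, hF'⟩ := hf
  obtain ⟨G, hG, hG'⟩ := hg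
  exact ⟨_, hF.mul hG, fun n => by simp only [hF', hG']⟩

lemma floor (hf : IsGenPolyNat f) : IsGenPolyNat (fun n => (⌊f n⌋ : ℝ)) := by
  obtain ⟨F, hF, hF'⟩ := hf
  exact ⟨_, hF.intPart, fun n => by simp only [hF']⟩

lemma neg (hf : IsGenPolyNat f) : IsGenPolyNat (fun n => - f n) := by
  simpa using (const (-1)).mul hf

lemma sub (hf : IsGenPolyNat f) (hg : IsGenPolyNat g) : IsGenPolyNat (fun n => f n - g n) := by
  simpa [sub_eq_add_neg] using hf.add hg.neg

lemma sum {ι : Type*} (s : Finset ι) {a : ι → ℕ → ℝ} (ha : ∀ j, IsGenPolyNat (a j)) :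
    IsGenPolyNat (fun n => ∑ j ∈ s, a j n) := by
  classical
  induction s using Finset.induction_on with
  | empty => simpa using const 0
  | insert j s hj ih => simpa [Finset.sum_insert hj] using (ha j).add ih

end IsGenPolyNat

/-- A predicate on `ℕ` whose indicator function is a generalised polynomial. -/
def GenPolyDecidable (P : ℕ → Prop) : Prop :=
  ∃ f : ℕ → ℝ, IsGenPolyNat f ∧ ∀ n, (P n → f n = 1) ∧ (¬ P n → f n = 0)

namespace GenPolyDecidable

variable {P Q : ℕ → Prop} {f : ℕ → ℝ}

lemma congr (hP : GenPolyDecidable P) (h : ∀ n, P n ↔ Q n) : GenPolyDecidable Q := by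
  rwa [← funext fun n => propext (h n)]

lemma false : GenPolyDecidable (fun _ => False) := ⟨_, .const 0, by simp⟩

lemma not (hP : GenPolyDecidable P) : GenPolyDecidable (fun n => ¬ P n) := by
  obtain ⟨f, hf, h⟩ := hP
  refine ⟨_, (IsGenPolyNat.const 1).sub hf, fun n => ⟨fun hn => ?_, fun hn => ?_⟩⟩
  · rw [(h n).2 hn, sub_zero]
  · rw [(h n).1 (not_not.1 hn), sub_self]

lemma and (hP : GenPolyDecidable P) (hQ : GenPolyDecidable Q) :
    GenPolyDecidable (fun n => P n ∧ Q n) := by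
  obtain ⟨f, hf, h⟩ := hP
  obtain ⟨g, hg, h'⟩ := hQ
  refine ⟨_, hf.mul hg, fun n => ⟨fun hn => ?_, fun hn => ?_⟩⟩
  · rw [(h n).1 hn.1, (h' n).1 hn.2, mul_one]
  · by_cases hPn : P n
    · rw [(h' n).2 fun hQn => hn ⟨hPn, hQn⟩, mul_zero]
    · rw [(h n).2 hPn, zero_mul]

lemma or (hP : GenPolyDecidable P) (hQ : GenPolyDecidable Q) :
    GenPolyDecidable (fun n => P n ∨ Q n) :=
  (hP.not.and hQ.not).not.congr fun n => by tauto

lemma exists_intCast (hf : IsGenPolyNat f) : GenPolyDecidable (fun n => ∃ m : ℤ, f n = m) := by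
  refine ⟨_, (hf.floor.add hf.neg.floor).add (.const 1), fun n => ⟨?_, fun hn => ?_⟩⟩
  · rintro ⟨m, hm⟩
    simp only [hm, ← Int.cast_neg, Int.floor_intCast]
    simp
  · have h1 : (⌊f n⌋ : ℝ) < f n := lt_of_le_of_ne (Int.floor_le _) fun h => hn ⟨_, h.symm⟩
    have h2 : ⌊-f n⌋ = -⌊f n⌋ - 1 := by
      rw [Int.floor_eq_iff]
      push_cast
      constructor <;> linarith [Int.lt_floor_add_one (f n)]
    simp only [h2]
    push_cast
    ring

/-- The zero set is recovered by testing integrality of `α * f n` for a generic scalar `α`. -/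
lemma eq_zero (hf : IsGenPolyNat f) : GenPolyDecidable (fun n => f n = 0) := by
  obtain ⟨α, hα⟩ : ∃ α : ℝ, α ∉ Set.range fun q : ℕ × ℤ => (q.2 : ℝ) / f q.1 := by
    by_contra! h
    exact Cardinal.not_countable_real
      ((Set.countable_range _).mono fun y _ => h y)
  refine (exists_intCast ((IsGenPolyNat.const α).mul hf)).congr fun n =>
    ⟨?_, fun h => ⟨0, by simp [h]⟩⟩
  rintro ⟨m, hm⟩
  by_contra hn
  exact hα ⟨(n, m), (div_eq_iff hn).2 hm.symm⟩

lemma eq_const (hf : IsGenPolyNat f) (c : ℝ) : GenPolyDecidable (fun n => f n = c) :=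
  (eq_zero (hf.sub (.const c))).congr fun _ => sub_eq_zero

end GenPolyDecidable

/-- Functions of the form `∑ j, n ^ j * b j n` with `b j` bounded generalised polynomials,
built by Horner's rule. -/
inductive BoundedCoeffGenPoly : (ℕ → ℝ) → Prop
  | zero : BoundedCoeffGenPoly (fun _ => 0)
  | step {u b : ℕ → ℝ} (B : ℝ) : BoundedCoeffGenPoly u → IsGenPolyNat b → (∀ n, |b n| ≤ B) →
      BoundedCoeffGenPoly (fun n => n * u n + b n)

namespace BoundedCoeffGenPoly

variable {f g b : ℕ → ℝ}

lemma isGenPolyNat (hf : BoundedCoeffGenPoly f) : IsGenPolyNat f := by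
  induction hf with
  | zero => exact .const 0
  | step B _ hb _ ih => exact (IsGenPolyNat.natCast.mul ih).add hb

lemma of_bounded {B : ℝ} (hb : IsGenPolyNat b) (hB : ∀ n, |b n| ≤ B) : BoundedCoeffGenPoly b := by
  simpa using zero.step B hb hB

lemma add (hf : BoundedCoeffGenPoly f) (hg : BoundedCoeffGenPoly g) :
    BoundedCoeffGenPoly (fun n => f n + g n) := by
  induction hf generalizing g with
  | zero => simpa using hg
  | @step u b B hu hb hB ih =>
    cases hg with
    | zero => simpa using hu.step B hb hB
    | @step v c C hv hc hC =>
      convert (ih hv).step (B + C) (hb.add hc) fun n =>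
        (abs_add_le _ _).trans (add_le_add (hB n) (hC n)) using 2 with n
      ring

lemma bounded_mul {B : ℝ} (hb : IsGenPolyNat b) (hB : ∀ n, |b n| ≤ B)
    (hg : BoundedCoeffGenPoly g) : BoundedCoeffGenPoly (fun n => b n * g n) := by
  induction hg with
  | zero => simpa using zero
  | @step v c C _ hc hC ih =>
    convert ih.step (B * C) (hb.mul hc) fun n => by
      rw [abs_mul]
      exact mul_le_mul (hB n) (hC n) (abs_nonneg _) ((abs_nonneg _).trans (hB n)) using 2 with n
    ring

lemma natCast_mul (hf : BoundedCoeffGenPoly f) : BoundedCoeffGenPoly (fun n => n * f n) := by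
  simpa using hf.step 0 (.const 0) (by simp)

lemma mul (hf : BoundedCoeffGenPoly f) (hg : BoundedCoeffGenPoly g) :
    BoundedCoeffGenPoly (fun n => f n * g n) := by
  induction hf with
  | zero => simpa using zero
  | @step u b B _ hb hB ih =>
    convert ih.natCast_mul.add (bounded_mul hb hB hg) using 2 with n
    ring

lemma const (c : ℝ) : BoundedCoeffGenPoly (fun _ => c) :=
  of_bounded (.const c) fun _ => le_rfl

lemma floor (hf : BoundedCoeffGenPoly f) : BoundedCoeffGenPoly (fun n => (⌊f n⌋ : ℝ)) := by
  have hG := hf.isGenPolyNat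
  have h : BoundedCoeffGenPoly (fun n => (⌊f n⌋ : ℝ) - f n) := by
    refine of_bounded (B := 1) (hG.floor.sub hG) fun n => abs_le.2 ⟨?_, ?_⟩ <;>
    linarith [Int.floor_le (f n), Int.lt_floor_add_one (f n)]
  convert hf.add h using 2 with n
  ring

lemma of_isGenPolyNat (hg : IsGenPolyNat g) : BoundedCoeffGenPoly g := by
  obtain ⟨F, hF, h⟩ := hg
  obtain rfl : g = fun n : ℕ => F (fun _ => (n : ℝ)) := funext h
  clear h
  induction hF with
  | coord i => simpa using (const 1).natCast_mul
  | const c => exact const c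
  | add _ _ h1 h2 => exact h1.add h2
  | mul _ _ h1 h2 => exact h1.mul h2
  | intPart _ h => exact h.floor

lemma genPolyDecidable_pos (hf : BoundedCoeffGenPoly f) : GenPolyDecidable (fun n => 0 < f n) := by
  induction hf with
  | zero => simpa using GenPolyDecidable.false
  | @step u b B hu hb hB ih =>
    have hg := (hu.step B hb hB).isGenPolyNat
    have hB0 : 0 ≤ B := (abs_nonneg _).trans (hB 0)
    have hfl := (hg.mul (.const (B + 1)⁻¹)).floor
    have h0 := GenPolyDecidable.eq_const hfl 0
    have h1 := GenPolyDecidable.eq_const hfl (-1)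
    refine ((h0.and (GenPolyDecidable.eq_zero hg).not).or ((h0.or h1).not.and ih)).congr
      fun n => ?_
    have hBn := abs_le.1 (hB n)
    have hpos : 0 < B + 1 := by linarith
    have e0 : ((⌊(n * u n + b n) * (B + 1)⁻¹⌋ : ℝ) = 0) ↔
        0 ≤ n * u n + b n ∧ n * u n + b n < B + 1 := by
      rw [Int.cast_eq_zero, Int.floor_eq_zero_iff, ← div_eq_mul_inv, Set.mem_Ico,
        div_lt_one hpos, le_div_iff₀ hpos, zero_mul]
    have e1 : ((⌊(n * u n + b n) * (B + 1)⁻¹⌋ : ℝ) = -1) ↔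
        -(B + 1) ≤ n * u n + b n ∧ n * u n + b n < 0 := by
      rw [show (-1 : ℝ) = ((-1 : ℤ) : ℝ) by simp, Int.cast_inj, Int.floor_eq_iff,
        ← div_eq_mul_inv, le_div_iff₀ hpos, div_lt_iff₀ hpos]
      simp
    rw [e0, e1]
    have hn : (0 : ℝ) ≤ n := n.cast_nonneg
    constructor
    · rintro (⟨h, h'⟩ | ⟨h, h'⟩)
      · exact lt_of_le_of_ne h.1 (Ne.symm h')
      · have := mul_nonneg hn h'.le
        by_contra! hc
        exact h (by
          rcases hc.lt_or_eq with hc | hc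
          · exact .inr ⟨by linarith, hc⟩
          · exact .inl ⟨hc.ge, by linarith⟩)
    · intro h
      by_cases hlt : n * u n + b n < B + 1
      · exact .inl ⟨⟨h.le, hlt⟩, h.ne'⟩
      · refine .inr ⟨?_, ?_⟩
        · rintro (h' | h') <;> linarith [h'.2]
        · by_contra! hc
          linarith [mul_nonpos_of_nonneg_of_nonpos hn hc]

end BoundedCoeffGenPoly

lemma GenPolyDecidable.pos {f : ℕ → ℝ} (hf : IsGenPolyNat f) :
    GenPolyDecidable (fun n => 0 < f n) :=
  (BoundedCoeffGenPoly.of_isGenPolyNat hf).genPolyDecidable_pos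

lemma Ultrafilter.exists_tendsto_of_eventually_abs_le {α : Type*} (p : Ultrafilter α) {u : α → ℝ}
    {C : ℝ} (h : ∀ᶠ i in p, |u i| ≤ C) : ∃ c, Tendsto u p (𝓝 c) := by
  obtain ⟨c, -, hc⟩ := (isCompact_Icc (a := -C) (b := C)).ultrafilter_le_nhds (p.map u)
    (le_principal_iff.2 (h.mono fun i hi => abs_le.1 hi))
  exact ⟨c, hc⟩

/-- Deciding the sign of a combination of generalised polynomials with nonstandard coefficients:
divide by the dominant coefficient and compare the standard part first. -/
lemma GenPolyDecidable.eventually_sum_pos (p : Ultrafilter ℕ) {ι : Type*} {a : ι → ℕ → ℝ}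
    (ha : ∀ j, IsGenPolyNat (a j)) (s : Finset ι) (ε : ι → ℕ → ℝ) :
    GenPolyDecidable (fun n => ∀ᶠ i in p, 0 < ∑ j ∈ s, a j n * ε j i) := by
  classical
  induction s using Finset.strongInduction generalizing ε with
  | H s ih =>
    rcases s.eq_empty_or_nonempty with rfl | hs
    · simpa [p.neBot.ne] using GenPolyDecidable.false
    obtain ⟨j₀, hj₀, hmax⟩ : ∃ j₀ ∈ s, ∀ᶠ i in p, ∀ j ∈ s, |ε j i| ≤ |ε j₀ i| := by
      simp only [← Finset.mem_coe]
      rw [← Ultrafilter.eventually_exists_mem_iff s.finite_toSet]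
      exact .of_forall fun i => s.exists_max_image (fun j => |ε j i|) hs
    rcases p.eventually_or.1 (.of_forall fun i => eq_or_ne (ε j₀ i) 0) with hz | hnz
    · refine GenPolyDecidable.false.congr fun n => ⟨False.elim, fun h => ?_⟩
      obtain ⟨i, h, hz, hmax⟩ := (h.and (hz.and hmax)).exists
      refine h.ne' (Finset.sum_eq_zero fun j hj => ?_)
      have := hmax j hj
      rw [hz, abs_zero, abs_nonpos_iff] at this
      rw [this, mul_zero]
    set δ : ι → ℕ → ℝ := fun j i => ε j i / |ε j₀ i| with hδ
    have hlim : ∀ j, ∃ c, j ∈ s → Tendsto (δ j) p (𝓝 c) := fun j => by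
      by_cases hj : j ∈ s
      · obtain ⟨c, hc⟩ := p.exists_tendsto_of_eventually_abs_le (u := δ j) (C := 1) (by
          filter_upwards [hmax] with i hi
          rw [hδ, abs_div, abs_abs]
          exact div_le_one_of_le₀ (hi j hj) (abs_nonneg _))
        exact ⟨c, fun _ => hc⟩
      · exact ⟨0, fun h => (hj h).elim⟩
    choose c hc using hlim
    have hδ₀ : ∀ᶠ i in p, δ j₀ i = c j₀ := by
      obtain ⟨e, he⟩ : ∃ e, ∀ᶠ i in p, δ j₀ i = e := by
        rcases p.eventually_or.1 (hnz.mono fun i hi => lt_or_gt_of_ne hi) with h | h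
        · exact ⟨-1, h.mono fun i hi => by
            simp only [hδ]; rw [abs_of_neg hi, div_neg, div_self hi.ne]⟩
        · exact ⟨1, h.mono fun i hi => by
            simp only [hδ]; rw [abs_of_pos hi, div_self hi.ne']⟩
      have : c j₀ = e := tendsto_nhds_unique (hc j₀ hj₀)
        (tendsto_const_nhds.congr' (he.mono fun i hi => hi.symm))
      rwa [this]
    have hG : IsGenPolyNat (fun n => ∑ j ∈ s, a j n * c j) :=
      IsGenPolyNat.sum s fun j => (ha j).mul (.const (c j))
    refine ((GenPolyDecidable.pos hG).or ((GenPolyDecidable.eq_zero hG).and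
      (ih _ (Finset.erase_ssubset hj₀) fun j i => δ j i - c j))).congr fun n => ?_
    have hscale : (∀ᶠ i in p, 0 < ∑ j ∈ s, a j n * ε j i) ↔
        ∀ᶠ i in p, 0 < ∑ j ∈ s, a j n * δ j i := by
      refine eventually_congr (hnz.mono fun i hi => ?_)
      have : ∑ j ∈ s, a j n * δ j i = (∑ j ∈ s, a j n * ε j i) / |ε j₀ i| := by
        rw [Finset.sum_div]
        exact Finset.sum_congr rfl fun j _ => (mul_div_assoc _ _ _).symm
      rw [this, div_pos_iff_of_pos_right (abs_pos.2 hi)]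
    have htend : Tendsto (fun i => ∑ j ∈ s, a j n * δ j i) p (𝓝 (∑ j ∈ s, a j n * c j)) :=
      tendsto_finsetSum _ fun j hj => (hc j hj).const_mul _
    rw [hscale]
    rcases lt_trichotomy (∑ j ∈ s, a j n * c j) 0 with h | h | h
    · refine iff_of_false (by rintro (h' | ⟨h', -⟩) <;> linarith) fun h' => ?_
      obtain ⟨i, h1, h2⟩ := (h'.and (htend.eventually_lt_const h)).exists
      exact lt_asymm h1 h2
    · simp only [h, lt_irrefl, true_and, false_or]
      refine eventually_congr (hδ₀.mono fun i hi => ?_)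
      have : ∑ j ∈ s, a j n * δ j i = ∑ j ∈ s.erase j₀, a j n * (δ j i - c j) := by
        rw [Finset.sum_erase s (by rw [hi, sub_self, mul_zero])]
        simp only [mul_sub, Finset.sum_sub_distrib, h, sub_zero]
      rw [this]
    · exact iff_of_true (.inl h) (htend.eventually_const_lt h)

/-- Families `F i n` which, along `p` in `i`, are finite sums of generalised polynomials in `n` with
coefficients converging along `p`. -/
def HasGenPolyExpansion (p : Ultrafilter ℕ) (F : ℕ → ℕ → ℝ) : Prop :=
  ∃ (ι : Type) (_ : Fintype ι) (a ε : ι → ℕ → ℝ) (c : ι → ℝ), (∀ j, IsGenPolyNat (a j)) ∧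
    (∀ j, Tendsto (ε j) p (𝓝 (c j))) ∧ ∀ n, ∀ᶠ i in p, F i n = ∑ j, a j n * ε j i

namespace HasGenPolyExpansion

variable {p : Ultrafilter ℕ} {F G : ℕ → ℕ → ℝ} {a ε g : ℕ → ℝ} {c : ℝ}

lemma mk_single (ha : IsGenPolyNat a) (hε : Tendsto ε p (𝓝 c))
    (h : ∀ n, ∀ᶠ i in p, F i n = a n * ε i) : HasGenPolyExpansion p F :=
  ⟨Unit, inferInstance, fun _ => a, fun _ => ε, fun _ => c, fun _ => ha, fun _ => hε, by simpa⟩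

lemma of_isGenPolyNat (ha : IsGenPolyNat a) (h : ∀ n, ∀ᶠ i in p, F i n = a n) :
    HasGenPolyExpansion p F :=
  mk_single ha (tendsto_const_nhds (x := 1)) (by simpa)

lemma add (hF : HasGenPolyExpansion p F) (hG : HasGenPolyExpansion p G) :
    HasGenPolyExpansion p (fun i n => F i n + G i n) := by
  obtain ⟨ι, _, a, ε, c, ha, hε, h⟩ := hF
  obtain ⟨κ, _, b, η, d, hb, hη, h'⟩ := hG
  refine ⟨ι ⊕ κ, inferInstance, Sum.elim a b, Sum.elim ε η, Sum.elim c d, ?_, ?_, fun n => ?_⟩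
  · rintro (j | j)
    exacts [ha j, hb j]
  · rintro (j | j)
    exacts [hε j, hη j]
  · filter_upwards [h n, h' n] with i hi hi'
    simp [hi, hi']

lemma mul (hF : HasGenPolyExpansion p F) (hG : HasGenPolyExpansion p G) :
    HasGenPolyExpansion p (fun i n => F i n * G i n) := by
  obtain ⟨ι, _, a, ε, c, ha, hε, h⟩ := hF
  obtain ⟨κ, _, b, η, d, hb, hη, h'⟩ := hG
  refine ⟨ι × κ, inferInstance, fun q n => a q.1 n * b q.2 n, fun q i => ε q.1 i * η q.2 i,
    fun q => c q.1 * d q.2, fun q => (ha _).mul (hb _), fun q => (hε _).mul (hη _), fun n => ?_⟩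
  filter_upwards [h n, h' n] with i hi hi'
  rw [hi, hi', Finset.sum_mul_sum, Fintype.sum_prod_type]
  exact Finset.sum_congr rfl fun j _ => Finset.sum_congr rfl fun k _ => mul_mul_mul_comm _ _ _ _

lemma isGenPolyNat_of_tendsto (hF : HasGenPolyExpansion p F)
    (hg : ∀ n, Tendsto (fun i => F i n) p (𝓝 (g n))) : IsGenPolyNat g := by
  obtain ⟨ι, _, a, ε, c, ha, hε, h⟩ := hF
  have : g = fun n => ∑ j, a j n * c j := funext fun n =>
    tendsto_nhds_unique (hg n) (Tendsto.congr' ((h n).mono fun i hi => hi.symm)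
      (tendsto_finsetSum _ fun j _ => (hε j).const_mul _))
  rw [this]
  exact IsGenPolyNat.sum _ fun j => (ha j).mul (.const _)

lemma floor (hF : HasGenPolyExpansion p F) :
    HasGenPolyExpansion p (fun i n => (⌊F i n⌋ : ℝ)) := by
  obtain ⟨ι, _, a, ε, c, ha, hε, h⟩ := hF
  have hG : IsGenPolyNat (fun n => ∑ j, a j n * c j) :=
    IsGenPolyNat.sum _ fun j => (ha j).mul (.const _)
  obtain ⟨f, hf, hf'⟩ := (GenPolyDecidable.exists_intCast hG).and
    (GenPolyDecidable.eventually_sum_pos p ha Finset.univ fun j i => c j - ε j i)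
  refine of_isGenPolyNat (hG.floor.sub hf) fun n => ?_
  have htend : Tendsto (fun i => ∑ j, a j n * ε j i) p (𝓝 (∑ j, a j n * c j)) :=
    tendsto_finsetSum _ fun j _ => (hε j).const_mul _
  specialize hf' n
  simp only [mul_sub, Finset.sum_sub_distrib, sub_pos] at hf'
  set L := ∑ j, a j n * c j
  by_cases hm : ∃ m : ℤ, L = m
  · obtain ⟨m, hm⟩ := hm
    by_cases hlt : ∀ᶠ i in p, ∑ j, a j n * ε j i < L
    · rw [hf'.1 ⟨⟨m, hm⟩, hlt⟩]
      filter_upwards [h n, hlt, htend.eventually_const_lt (sub_one_lt L)] with i hi h1 h2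
      have : ⌊F i n⌋ = m - 1 := by
        rw [Int.floor_eq_iff, hi]
        push_cast
        constructor <;> linarith
      rw [this, hm, Int.floor_intCast]
      push_cast
      rfl
    · rw [hf'.2 fun h => hlt h.2]
      filter_upwards [h n, Ultrafilter.eventually_not.2 hlt,
        htend.eventually_lt_const (lt_add_one L)] with i hi h1 h2
      have : ⌊F i n⌋ = m := by
        rw [Int.floor_eq_iff, hi]
        constructor <;> linarith
      rw [this, hm, Int.floor_intCast, sub_zero]
  · rw [hf'.2 fun h => hm h.1]
    have hlt : (⌊L⌋ : ℝ) < L := lt_of_le_of_ne (Int.floor_le _) fun h => hm ⟨_, h.symm⟩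
    filter_upwards [h n, htend.eventually_const_lt hlt,
      htend.eventually_lt_const (Int.lt_floor_add_one L)] with i hi h1 h2
    have : ⌊F i n⌋ = ⌊L⌋ := by
      rw [Int.floor_eq_iff, hi]
      exact ⟨h1.le, h2⟩
    rw [this, sub_zero]

lemma of_isGenPoly {d : ℕ} {x : ℕ → (Fin d → ℝ)} {C : ℝ} (hx : ∀ i, ‖x i‖ ≤ C)
    {H : (Fin (d + 1) → ℝ) → ℝ} (hH : IsGenPoly H) :
    HasGenPolyExpansion p (fun i n => H (Fin.snoc (x i) (n : ℝ))) := by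
  induction hH with
  | coord k =>
    refine Fin.lastCases ?_ (fun j => ?_) k
    · exact of_isGenPolyNat .natCast (by simp)
    · obtain ⟨c, hc⟩ := p.exists_tendsto_of_eventually_abs_le (u := fun i => x i j) (C := C)
        (.of_forall fun i => (norm_le_pi_norm (x i) j).trans (hx i))
      exact mk_single (.const 1) hc (by simp)
  | const c => exact of_isGenPolyNat (.const c) (by simp)
  | add _ _ h1 h2 => exact h1.add h2
  | mul _ _ h1 h2 => exact h1.mul h2
  | intPart _ h => exact h.floor

end HasGenPolyExpansion

/-- If `p` is an ultrafilter on `ℕ`, `(x_i)` a bounded sequence in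
`ℝ^d`, `h(x, n) = H (x, n)` the restriction of a generalised polynomial
`H : ℝ^{d+1} → ℝ`, and `g(n)` is the limit of `i ↦ h(x_i, n)` along `p` for each `n`,
then `g` is a generalised polynomial on `ℕ`. -/
theorem limit_of_genPoly_is_genPoly (d : ℕ) (p : Ultrafilter ℕ)
    (x : ℕ → (Fin d → ℝ)) (hx : ∃ C : ℝ, ∀ i, ‖x i‖ ≤ C)
    (H : (Fin (d + 1) → ℝ) → ℝ) (hH : IsGenPoly H) (g : ℕ → ℝ)
    (hg : ∀ n : ℕ,
      Filter.Tendsto (fun i => H (Fin.snoc (x i) (n : ℝ))) ↑p (nhds (g n))) :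
    IsGenPolyNat g := by
  obtain ⟨C, hC⟩ := hx
  exact (HasGenPolyExpansion.of_isGenPoly hC hH).isGenPolyNat_of_tendsto hg
end
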